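/- arXiv:1711.11060 — 3 statements merged into one kernel-verified Lean document; each statement's English description precedes it below -/
import Mathlib

section
/- Let ε > 0 and let θ = (1+√5)/2. Let A, B ⊆ ℤ be finite sets with |A| = |B| = n ≥ max{3, 2ε^{-1/2}}, and let Γ ⊆ A × B satisfy |Γ| ≥ (1−ε)n². If |A +_Γ B| < (1 + θ − 11ε^{1/2})n, then there exist arithmetic progressions P, Q of integers with the same common difference and each of size at most |A +_Γ B| − (1 − 5ε^{1/2})n, such that |A ∩ P| ≥ (1 − ε^{1/2})n and |B ∩ Q| ≥ (1 − ε^{1/2})n. -/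
open Finset
open scoped Pointwise
namespace RF

section atom
lemma f_nonneg {G : Type*} [AddCommGroup G] [DecidableEq G] (A X : Finset G) (hA : A.Nonempty) : X.card ≤ (X + A).card :=
  Finset.card_le_card_add_right hA

/-- The isoperimetric atom argument. -/
lemma atom {G : Type*} [AddCommGroup G] [Fintype G] [DecidableEq G] (A : Finset G) (hA : A.Nonempty) (hD : A - A ≠ univ) :
    ∃ (H : AddSubgroup G) (F : Finset G), (∀ x, x ∈ F ↔ x ∈ H) ∧ F + A ≠ univ ∧
      (F + A).card + A.card ≤ (A - A).card + F.card := by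
  classical
  let f : Finset G → ℕ := fun X => (X + A).card - X.card
  have hf : ∀ X, (X + A).card = f X + X.card := fun X => by
    have := f_nonneg A X hA
    simp only [f]; omega
  let V : Finset (Finset G) := univ.filter fun X => X.Nonempty ∧ X + A ≠ univ
  have hV : ∀ X, X ∈ V ↔ X.Nonempty ∧ X + A ≠ univ := fun X => by simp [V]
  have hVne : V.Nonempty := ⟨-A, by
    rw [hV]; refine ⟨hA.neg, ?_⟩
    rwa [neg_add_eq_sub]⟩
  obtain ⟨X0, hX0, hmin0⟩ := V.exists_min_image f hVne
  let W := V.filter fun X => f X = f X0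
  have hWne : W.Nonempty := ⟨X0, by simp [W, hX0]⟩
  obtain ⟨X, hX, hmin⟩ := W.exists_min_image card hWne
  have hXV : X ∈ V := (mem_filter.1 hX).1
  have hfX : f X = f X0 := (mem_filter.1 hX).2
  have hdual : X.card + (X + A).card ≤ Fintype.card G := by
    let Y := -((X + A)ᶜ)
    have hYne : Y.Nonempty := by
      simp only [Y, neg_nonempty_iff]
      rw [← Finset.card_pos, card_compl]
      have := (Finset.card_lt_iff_ne_univ (X + A)).2 ((hV X).1 hXV).2
      omega
    have hsub : Y + A ⊆ (-X)ᶜ := by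
      intro z hz
      obtain ⟨y, hy, a, ha, rfl⟩ := mem_add.1 hz
      rw [mem_compl]
      intro hzx
      have h1 : -(y + a) ∈ X := by simpa using hzx
      have h2 : -y ∉ X + A := by simpa [Y] using hy
      apply h2
      have := add_mem_add h1 ha
      simpa using this
    have hYV : Y ∈ V := by
      rw [hV]
      refine ⟨hYne, fun h => ?_⟩
      rw [h] at hsub
      obtain ⟨x, hx⟩ := ((hV X).1 hXV).1
      have := hsub (mem_univ (-x))
      simp [hx] at this
    have c1 := card_le_card hsub
    rw [card_compl, card_neg] at c1
    have c2 : Y.card = Fintype.card G - (X + A).card := by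
      simp only [Y]; rw [card_neg, card_compl]
    have c3 := hf Y
    have c4 := hf X
    have c5 := hmin0 Y hYV
    have c6 : X.card ≤ Fintype.card G := card_le_univ X
    have c7 : (X + A).card ≤ Fintype.card G := card_le_univ _
    have c8 : f Y = f X0 := by omega
    have c9 := hmin Y (by simp [W, hYV, c8])
    omega
  have hinter : ∀ Y ∈ W, Y.card = X.card → (X ∩ Y).Nonempty → Y = X := by
    intro Y hY hc hne
    by_contra hneq
    have hYV : Y ∈ V := (mem_filter.1 hY).1
    have hfY : f Y = f X0 := (mem_filter.1 hY).2
    have hlt : (X ∩ Y).card < X.card := by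
      apply card_lt_card
      refine ⟨inter_subset_left, fun h => ?_⟩
      have : X ⊆ Y := fun z hz => (mem_inter.1 (h hz)).2
      exact hneq (eq_of_subset_of_card_le this hc.le).symm
    have hIV : X ∩ Y ∈ V := by
      rw [hV]
      refine ⟨hne, fun h => ?_⟩
      apply ((hV X).1 hXV).2
      rw [← univ_subset_iff, ← h]
      exact add_subset_add_right inter_subset_left
    have hfI : f X0 < f (X ∩ Y) := by
      refine lt_of_le_of_ne (hmin0 _ hIV) fun h => ?_
      have := hmin _ (mem_filter.2 ⟨hIV, h.symm⟩)
      omega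
    have hI : (X ∩ Y) + A ⊆ (X + A) ∩ (Y + A) :=
      subset_inter (add_subset_add_right inter_subset_left)
        (add_subset_add_right inter_subset_right)
    have hU : (X ∪ Y) + A = (X + A) ∪ (Y + A) := union_add
    have e1 := card_le_card hI
    have e2 := card_union_add_card_inter (X + A) (Y + A)
    have e3 := card_union_add_card_inter X Y
    rw [← hU] at e2
    have e4 := hf X
    have e5 := hf Y
    have e6 := hf (X ∩ Y)
    have e7 := hf (X ∪ Y)
    have e8 : f (X ∪ Y) < f X0 := by omega
    have e9 : (X ∪ Y) + A = univ := by
      by_contra h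
      have : X ∪ Y ∈ V := by
        rw [hV]
        exact ⟨((hV X).1 hXV).1.mono subset_union_left, h⟩
      have := hmin0 _ this
      omega
    have e10 : ((X ∪ Y) + A).card = Fintype.card G := by rw [e9, card_univ]
    have e11 := hne.card_pos
    omega
  obtain ⟨x0, hx0⟩ := ((hV X).1 hXV).1
  have hadd : ∀ c : G, (X + {c}) + A = (X + A) + {c} := fun c => by
    rw [add_right_comm]
  have htr : ∀ c : G, X + {c} ∈ W ∧ (X + {c}).card = X.card := by
    intro c
    have hc : (X + {c}).card = X.card := by
      rw [add_singleton]; exact card_image_of_injective _ (add_left_injective c)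
    have hc2 : (X + {c} + A).card = (X + A).card := by
      rw [hadd, add_singleton]; exact card_image_of_injective _ (add_left_injective c)
    refine ⟨mem_filter.2 ⟨(hV _).2 ⟨⟨x0 + c, add_mem_add hx0 (mem_singleton_self c)⟩, ?_⟩, ?_⟩, hc⟩
    · rw [← Finset.card_lt_iff_ne_univ, hc2, Finset.card_lt_iff_ne_univ]
      exact ((hV X).1 hXV).2
    · simp only [f] at hfX ⊢
      rw [hc2, hc, hfX]
  have hstab : ∀ x ∈ X, ∀ y ∈ X, ∀ z ∈ X, z + (y - x) ∈ X := by
    intro x hx y hy z hz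
    have h := hinter (X + {y - x}) (htr _).1 (htr _).2 ⟨y, by
      rw [mem_inter]; refine ⟨hy, ?_⟩
      exact mem_add.2 ⟨x, hx, y - x, by simp, by abel⟩⟩
    rw [← h]
    exact mem_add.2 ⟨z, hz, y - x, by simp, rfl⟩
  let H : AddSubgroup G :=
    { carrier := {g | x0 + g ∈ X}
      zero_mem' := by simpa using hx0
      add_mem' := by
        intro a b ha hb
        have := hstab x0 hx0 _ hb _ ha
        change x0 + (a + b) ∈ X
        convert this using 1; abel
      neg_mem' := by
        intro a ha
        have := hstab _ ha x0 hx0 x0 hx0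
        change x0 + -a ∈ X
        convert this using 1; abel }
  refine ⟨H, X + {-x0}, ?_, ?_, ?_⟩
  · intro x
    change _ ↔ x0 + x ∈ X
    constructor
    · intro h
      obtain ⟨y, hy, z, hz, rfl⟩ := mem_add.1 h
      rw [mem_singleton.1 hz]
      simpa using hy
    · intro h
      exact mem_add.2 ⟨x0 + x, h, -x0, by simp, by abel⟩
  · exact ((hV _).1 (mem_filter.1 (htr (-x0)).1).1).2
  · have h1 := (mem_filter.1 (htr (-x0)).1).2
    have h2 := hf (X + {-x0})
    have h3 := hmin0 (-A) ((hV _).2 ⟨hA.neg, by rwa [neg_add_eq_sub]⟩)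
    have h4 := hf (-A)
    rw [neg_add_eq_sub, card_neg] at h4
    omega
end atom
lemma diff_reps {G : Type*} [AddCommGroup G] [DecidableEq G]
    (A B S : Finset G) (R : G → G → Prop) (k : ℝ)
    (hS : ∀ a ∈ A, ∀ b ∈ B, R a b → a + b ∈ S)
    [∀ a, DecidablePred fun b => ¬ R a b]
    (hmA : ∀ a ∈ A, ((B.filter fun b => ¬ R a b).card : ℝ) ≤ k)
    (a a' : G) (ha : a ∈ A) (ha' : a' ∈ A) :
    2 * (B.card : ℝ) - 2 * k - S.card ≤ ((B.filter fun b => b + (a - a') ∈ B).card : ℝ) := by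
  classical
  let N : G → Finset G := fun a => (B.filter fun b => R a b).image fun b => a + b
  have hN : ∀ a ∈ A, (B.card : ℝ) - k ≤ (N a).card ∧ N a ⊆ S := by
    intro a ha
    constructor
    · have h1 : (N a).card = (B.filter fun b => R a b).card :=
        card_image_of_injective _ (add_right_injective a)
      have h2 := card_filter_add_card_filter_not (s := B) (fun b => R a b)
      have h3 := hmA a ha
      rw [h1]
      have h4 : ((B.filter fun b => R a b).card : ℝ) + ((B.filter fun b => ¬ R a b).card : ℝ)
        = B.card := by
        rw [← h2]; push_cast; congr!
      linarith
    · intro z hz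
      obtain ⟨b, hb, rfl⟩ := mem_image.1 hz
      exact hS a ha b (mem_filter.1 hb).1 (mem_filter.1 hb).2
  have h1 := card_union_add_card_inter (N a) (N a')
  have h2 : (N a ∪ N a').card ≤ S.card := card_le_card (union_subset (hN a ha).2 (hN a' ha').2)
  have h3 : (N a ∩ N a').card ≤ (B.filter fun b => b + (a - a') ∈ B).card := by
    apply card_le_card_of_injOn (fun z => z - a)
    · intro z hz
      have hz := mem_inter.1 (Finset.mem_coe.1 hz)
      obtain ⟨b, hb, hb2⟩ := mem_image.1 hz.1
      obtain ⟨b', hb', hb2'⟩ := mem_image.1 hz.2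
      simp only [coe_filter, Set.mem_ofPred_eq]
      have e1 : z - a = b := by rw [← hb2]; abel
      have e2 : z - a + (a - a') = b' := by rw [← hb2']; abel
      rw [e2, e1]
      exact ⟨(mem_filter.1 hb).1, (mem_filter.1 hb').1⟩
    · intro x _ y _ h
      exact sub_left_injective h
  have h1' : ((N a ∪ N a').card : ℝ) + (N a ∩ N a').card = (N a).card + (N a').card := by
    exact_mod_cast h1
  have h2' : ((N a ∪ N a').card : ℝ) ≤ S.card := by exact_mod_cast h2
  have h3' : ((N a ∩ N a').card : ℝ) ≤ (B.filter fun b => b + (a - a') ∈ B).card := by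
    exact_mod_cast h3
  have := (hN a ha).1
  have := (hN a' ha').1
  linarith

/-- there is a popular sum -/
lemma pop_sum {G : Type*} [AddCommGroup G] [DecidableEq G]
    (A B S : Finset G) (R : G → G → Prop) [DecidablePred fun p : G × G => ¬ R p.1 p.2] (K : ℝ)
    (hS : ∀ a ∈ A, ∀ b ∈ B, R a b → a + b ∈ S)
    (hM : (((A ×ˢ B).filter fun p : G × G => ¬ R p.1 p.2).card : ℝ) ≤ K)
    (hpos : K < (A.card : ℝ) * B.card) :
    ∃ s ∈ S, (A.card : ℝ) * B.card - K ≤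
      ((B.filter fun b => s - b ∈ A).card : ℝ) * S.card := by
  classical
  let P := (A ×ˢ B).filter fun p : G × G => R p.1 p.2
  have hP : (A.card : ℝ) * B.card - K ≤ P.card := by
    have h2 := card_filter_add_card_filter_not (s := A ×ˢ B) (fun p : G × G => R p.1 p.2)
    rw [card_product] at h2
    have h4 : ((P.card : ℝ)) + (((A ×ˢ B).filter fun p : G × G => ¬ R p.1 p.2).card : ℝ)
        = A.card * B.card := by
        rw [← Nat.cast_mul, ← h2]; push_cast; congr!
    linarith
  have hmaps : ∀ p ∈ P, p.1 + p.2 ∈ S := by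
    intro p hp
    have := mem_filter.1 hp
    exact hS _ (mem_product.1 this.1).1 _ (mem_product.1 this.1).2 this.2
  have hfib := card_eq_sum_card_fiberwise (f := fun p : G × G => p.1 + p.2) (s := P) (t := S)
    (fun p hp => hmaps p hp)
  have hfle : ∀ s ∈ S, (P.filter fun p => p.1 + p.2 = s).card ≤
      (B.filter fun b => s - b ∈ A).card := by
    intro s _
    apply card_le_card_of_injOn (fun p => p.2)
    · intro p hp
      have hp := mem_filter.1 (Finset.mem_coe.1 hp)
      have h3 := mem_product.1 (mem_filter.1 hp.1).1
      simp only [coe_filter, Set.mem_ofPred_eq]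
      refine ⟨h3.2, ?_⟩
      rw [← hp.2]; simpa using h3.1
    · intro p hp q hq h
      have hp := (mem_filter.1 (Finset.mem_coe.1 hp)).2
      have hq := (mem_filter.1 (Finset.mem_coe.1 hq)).2
      simp only at h
      have : p.1 = q.1 := by
        rw [h] at hp
        exact add_right_cancel (hp.trans hq.symm)
      exact Prod.ext this h
  have hSne : S.Nonempty := by
    have : (0 : ℝ) < P.card := by linarith
    obtain ⟨p, hp⟩ := card_pos.1 (by exact_mod_cast this : 0 < P.card)
    exact ⟨_, hmaps p hp⟩
  obtain ⟨s, hs, hmax⟩ := S.exists_max_image (fun s => (B.filter fun b => s - b ∈ A).card) hSne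
  refine ⟨s, hs, hP.trans ?_⟩
  have : P.card ≤ (B.filter fun b => s - b ∈ A).card * S.card := by
    rw [hfib]
    calc _ ≤ ∑ x ∈ S, (B.filter fun b => s - b ∈ A).card :=
          sum_le_sum fun x hx => (hfle x hx).trans (hmax x hx)
      _ = _ := by rw [sum_const, smul_eq_mul, mul_comm]
  exact_mod_cast this

lemma pop_few {G : Type*} [AddCommGroup G] [DecidableEq G]
    (A B S T : Finset G) (R : G → G → Prop) [DecidablePred fun p : G × G => ¬ R p.1 p.2] (k : ℝ)
    (hk : 0 < k)
    (hS : ∀ a ∈ A, ∀ b ∈ B, R a b → a + b ∈ S)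
    (hM : (((A ×ˢ B).filter fun p : G × G => ¬ R p.1 p.2).card : ℝ) ≤ k ^ 2)
    (hT : ∀ x ∈ T, k ≤ ((B.filter fun b => x - b ∈ A).card : ℝ)) :
    (T.card : ℝ) ≤ S.card + k := by
  classical
  let M := (A ×ˢ B).filter fun p : G × G => ¬ R p.1 p.2
  have h1 : ((T \ S).card : ℝ) * k ≤ k ^ 2 := by
    refine le_trans ?_ hM
    have hle : ∀ x ∈ T \ S, k ≤ ((M.filter fun p => p.1 + p.2 = x).card : ℝ) := by
      intro x hx
      have hx := mem_sdiff.1 hx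
      refine (hT x hx.1).trans ?_
      norm_cast
      apply card_le_card_of_injOn (fun b => (x - b, b))
      · intro b hb
        have hb := mem_filter.1 (Finset.mem_coe.1 hb)
        simp only [coe_filter, Set.mem_ofPred_eq, M, mem_filter, mem_product]
        refine ⟨⟨⟨hb.2, hb.1⟩, fun hR => hx.2 ?_⟩, by abel⟩
        have := hS _ hb.2 _ hb.1 hR
        simpa using this
      · intro b _ c _ h
        exact (Prod.mk.inj h).2
    calc ((T \ S).card : ℝ) * k = ∑ x ∈ T \ S, k := by rw [sum_const, nsmul_eq_mul]
      _ ≤ ∑ x ∈ T \ S, ((M.filter fun p => p.1 + p.2 = x).card : ℝ) := sum_le_sum hle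
      _ ≤ M.card := by
        norm_cast
        rw [← card_biUnion]
        · exact card_le_card (biUnion_subset.2 fun x _ => filter_subset _ _)
        · intro x _ y _ hxy
          rw [Function.onFun, disjoint_left]
          intro p hp hq
          exact hxy ((mem_filter.1 hp).2.symm.trans (mem_filter.1 hq).2)
  have h2 : ((T \ S).card : ℝ) ≤ k := by
    rw [sq] at h1
    exact le_of_mul_le_mul_right h1 hk
  have h3 : T.card ≤ S.card + (T \ S).card := by
    have := card_le_card_sdiff_add_card (s := T) (t := S)
    omega
  have h3' : (T.card : ℝ) ≤ S.card + (T \ S).card := by exact_mod_cast h3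
  linarith
lemma num1 (θ n k a b s r : ℝ) (h1 : θ ^ 2 = θ + 1) (h2 : 1.618 < θ) (h3 : θ < 1.6181)
    (hk : 0 < k) (hkn : 4 * k ≤ n) (ha : n - 1.5 * k ≤ a) (hb : n - 1.5 * k ≤ b)
    (hs0 : 0 < s) (hs : s ≤ θ * n - 7.5 * k) (hr : a * b - k ^ 2 ≤ r * s) :
    k ≤ r + (2 * b - 2 * k - s) - b := by
  have hab : (n - 1.5 * k) * (n - 1.5 * k) ≤ a * b := by
    apply mul_le_mul ha hb <;> linarith
  have key : 0 ≤ (n - 1.5 * k) * (n - 1.5 * k) - k ^ 2 + s * (n - 4.5 * k - s) := by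
    have e1 : s * (n - 4.5 * k - (θ * n - 7.5 * k)) ≤ s * (n - 4.5 * k - s) := by
      apply mul_le_mul_of_nonneg_left _ hs0.le; linarith
    have c0 : 0 ≤ (n - 1.5 * k) * (n - 1.5 * k) - k ^ 2 := by nlinarith
    rcases le_total (θ * n - 7.5 * k) (n - 4.5 * k) with h | h
    · have : 0 ≤ s * (n - 4.5 * k - (θ * n - 7.5 * k)) := mul_nonneg hs0.le (by linarith)
      linarith
    · have e2 : (θ * n - 7.5 * k) * (n - 4.5 * k - (θ * n - 7.5 * k)) ≤
          s * (n - 4.5 * k - (θ * n - 7.5 * k)) :=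
        mul_le_mul_of_nonpos_right hs (by linarith)
      have e3 : (n - 1.5 * k) * (n - 1.5 * k) - k ^ 2 +
          (θ * n - 7.5 * k) * (n - 4.5 * k - (θ * n - 7.5 * k)) =
          n ^ 2 * (1 + θ - θ ^ 2) + n * k * (-3 - 4.5 * θ - 7.5 + 15 * θ) - 21.25 * k ^ 2 := by
        ring
      rw [h1] at e3
      have e4 : 0 ≤ n * k * (θ - 1.618) := by
        apply mul_nonneg (mul_nonneg (by linarith) hk.le); linarith
      have e5 : 4 * k * k ≤ n * k := mul_le_mul_of_nonneg_right hkn hk.le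
      nlinarith
  have h5 : 0 ≤ (r + b - 3 * k - s) * s := by
    have : s * (n - 4.5 * k - s) ≤ s * (b - 3 * k - s) := by
      apply mul_le_mul_of_nonneg_left _ hs0.le; linarith
    nlinarith
  have := nonneg_of_mul_nonneg_left h5 hs0
  linarith

lemma struct {G : Type*} [AddCommGroup G] [Fintype G] [DecidableEq G]
    (A B S : Finset G) (R : G → G → Prop) [∀ a, DecidablePred fun b => ¬ R a b]
    [∀ b, DecidablePred fun a => ¬ R a b] [DecidablePred fun p : G × G => ¬ R p.1 p.2]
    (θ n k : ℝ) (h1 : θ ^ 2 = θ + 1) (h2 : 1.618 < θ) (h3 : θ < 1.6181)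
    (hk : 0 < k) (hkn : 4 * k ≤ n) (hA : n - 1.5 * k ≤ A.card) (hB : n - 1.5 * k ≤ B.card)
    (hS : ∀ a ∈ A, ∀ b ∈ B, R a b → a + b ∈ S)
    (hmA : ∀ a ∈ A, ((B.filter fun b => ¬ R a b).card : ℝ) ≤ k)
    (hmB : ∀ b ∈ B, ((A.filter fun a => ¬ R a b).card : ℝ) ≤ k)
    (hM : (((A ×ˢ B).filter fun p : G × G => ¬ R p.1 p.2).card : ℝ) ≤ k ^ 2)
    (hs : (S.card : ℝ) ≤ θ * n - 7.5 * k) (hsG : (S.card : ℝ) + k < Fintype.card G)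
    (hgen : ∀ H : AddSubgroup G, (∀ a ∈ A, ∀ a' ∈ A, a - a' ∈ H) →
      (∀ b ∈ B, ∀ b' ∈ B, b - b' ∈ H) → H = ⊤) :
    ∃ (H : AddSubgroup G), ∃ x ∈ A, ∃ x' ∈ A, ∃ y ∈ B, ∃ y' ∈ B, x' - x = y' - y ∧
      x' - x ∉ H ∧ (x' - x) + (x' - x) ∉ H ∧ (∀ a ∈ A, a - x ∈ H ∨ a - x' ∈ H) ∧
      (∀ b ∈ B, b - y ∈ H ∨ b - y' ∈ H) := by
  classical
  have hAne : A.Nonempty := by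
    rw [← card_pos]; have : (0 : ℝ) < A.card := by linarith
    exact_mod_cast this
  have hAB : k ^ 2 < (A.card : ℝ) * B.card := by
    have : (n - 1.5 * k) * (n - 1.5 * k) ≤ (A.card : ℝ) * B.card := by
      apply mul_le_mul hA hB <;> linarith
    nlinarith
  obtain ⟨s, hsS, hr⟩ := pop_sum A B S R (k ^ 2) hS hM hAB
  have hSpos : (0 : ℝ) < S.card := by exact_mod_cast card_pos.2 ⟨s, hsS⟩
  have hdA := diff_reps A B S R k hS hmA
  have hdB := diff_reps B A S (fun b a => R a b) k
    (fun b hb a ha h => by rw [add_comm]; exact hS a ha b hb h) hmB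
  have hθn : θ * n ≤ 1.6181 * n := mul_le_mul_of_nonneg_right h3.le (by linarith)
  have hDAB : ∀ a ∈ A, ∀ a' ∈ A, ∃ b ∈ B, ∃ b' ∈ B, a - a' = b' - b := by
    intro a ha a' ha'
    have := hdA a a' ha ha'
    have h0 : (0 : ℝ) < ((B.filter fun b => b + (a - a') ∈ B).card : ℝ) := by linarith
    obtain ⟨b, hb⟩ := card_pos.1 (by exact_mod_cast h0 : 0 < (B.filter fun b => b + (a - a') ∈ B).card)
    have hb := mem_filter.1 hb
    exact ⟨b, hb.1, _, hb.2, by abel⟩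
  have hDBA : ∀ a ∈ B, ∀ a' ∈ B, ∃ b ∈ A, ∃ b' ∈ A, a - a' = b' - b := by
    intro a ha a' ha'
    have := hdB a a' ha ha'
    have h0 : (0 : ℝ) < ((A.filter fun b => b + (a - a') ∈ A).card : ℝ) := by linarith
    obtain ⟨b, hb⟩ := card_pos.1 (by exact_mod_cast h0 : 0 < (A.filter fun b => b + (a - a') ∈ A).card)
    have hb := mem_filter.1 hb
    exact ⟨b, hb.1, _, hb.2, by abel⟩
  have hgen' : ∀ H : AddSubgroup G, (∀ a ∈ A, ∀ a' ∈ A, a - a' ∈ H) → H = ⊤ := by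
    intro H h
    refine hgen H h fun b hb b' hb' => ?_
    obtain ⟨a, ha, a', ha', e⟩ := hDBA b hb b' hb'
    rw [e]; exact h a' ha' a ha
  have hD : ((A - A).card : ℝ) ≤ S.card + k := by
    have hT := pop_few A B S ((A - A).image fun d => s + d) R k hk hS hM (by
      intro z hz
      obtain ⟨d, hd, rfl⟩ := mem_image.1 hz
      obtain ⟨a, ha, a', ha', rfl⟩ := mem_sub.1 hd
      have q1 := hdA a a' ha ha'
      let U := B.filter fun b => b + (a - a') ∈ B
      let V := B.filter fun b => s - b ∈ A
      have q2 := card_union_add_card_inter U V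
      have q3 : (U ∪ V).card ≤ B.card :=
        card_le_card (union_subset (filter_subset _ _) (filter_subset _ _))
      have q4 : (U ∩ V).card ≤ (B.filter fun b => s + (a - a') - b ∈ A).card := by
        apply card_le_card_of_injOn (fun b => b + (a - a'))
        · intro b hb
          have hb := mem_inter.1 (Finset.mem_coe.1 hb)
          have hb1 := mem_filter.1 hb.1
          have hb2 := mem_filter.1 hb.2
          simp only [coe_filter, Set.mem_ofPred_eq]
          refine ⟨hb1.2, ?_⟩
          rw [add_sub_add_right_eq_sub]; exact hb2.2
        · intro b _ c _ h
          exact add_right_cancel h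
      have q5 := num1 θ n k A.card B.card S.card V.card h1 h2 h3 hk hkn hA hB hSpos hs hr
      have q2' : ((U ∪ V).card : ℝ) + (U ∩ V).card = U.card + V.card := by exact_mod_cast q2
      have q3' : ((U ∪ V).card : ℝ) ≤ B.card := by exact_mod_cast q3
      have q4' : ((U ∩ V).card : ℝ) ≤ (B.filter fun b => s + (a - a') - b ∈ A).card := by
        exact_mod_cast q4
      linarith)
    rwa [card_image_of_injective _ (add_right_injective s)] at hT
  have hDne : A - A ≠ univ := by
    intro h
    rw [h, card_univ] at hD
    linarith
  obtain ⟨H, F, hF, hFA, hcard⟩ := atom A hAne hDne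
  have hcard' : ((F + A).card : ℝ) + A.card ≤ (A - A).card + F.card := by exact_mod_cast hcard
  have hcos : ∀ x, (F + {x}).card = F.card := fun x => by
    rw [add_singleton]; exact card_image_of_injective _ (add_left_injective x)
  have hcosm : ∀ x z, z ∈ F + {x} ↔ z - x ∈ H := by
    intro x z
    rw [← hF, mem_add]
    constructor
    · rintro ⟨f, hf, w, hw, rfl⟩
      rw [mem_singleton.1 hw]; simpa using hf
    · intro h
      exact ⟨_, h, x, mem_singleton_self x, by abel⟩
  have hcosd : ∀ x x', x' - x ∉ H → Disjoint (F + {x}) (F + {x'}) := by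
    intro x x' h
    rw [disjoint_left]
    intro z hz hz'
    rw [hcosm] at hz hz'
    apply h
    have := H.sub_mem hz hz'
    simpa using this
  have hsubFA : ∀ x ∈ A, F + {x} ⊆ F + A := fun x hx =>
    add_subset_add_left (singleton_subset_iff.2 hx)
  obtain ⟨x, hx⟩ := hAne
  by_cases hone : ∀ a ∈ A, a - x ∈ H
  · exfalso
    have hH := hgen' H fun a ha a' ha' => by
      have := H.sub_mem (hone a ha) (hone a' ha')
      simpa using this
    apply hFA
    rw [eq_univ_iff_forall]
    intro z
    apply hsubFA x hx
    rw [hcosm, hH]; trivial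
  push Not at hone
  obtain ⟨x', hx', hxx'⟩ := hone
  have hAFA : (A.card : ℝ) ≤ (F + A).card := by
    have : A ⊆ F + A := fun a ha => hsubFA a ha (by rw [hcosm]; simp)
    exact_mod_cast card_le_card this
  have htwo : ∀ a ∈ A, a - x ∈ H ∨ a - x' ∈ H := by
    intro a ha
    by_contra hcon
    push Not at hcon
    have hsub3 : (F + {x}) ∪ (F + {x'}) ∪ (F + {a}) ⊆ F + A :=
      union_subset (union_subset (hsubFA x hx) (hsubFA x' hx')) (hsubFA a ha)
    have c := card_le_card hsub3
    rw [card_union_of_disjoint (disjoint_union_left.2 ⟨hcosd _ _ hcon.1, hcosd _ _ hcon.2⟩),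
      card_union_of_disjoint (hcosd _ _ hxx'), hcos, hcos, hcos] at c
    have c' : (F.card : ℝ) + F.card + F.card ≤ (F + A).card := by exact_mod_cast c
    nlinarith
  set t := x' - x with ht
  have hsub2 : (F + {x}) ∪ (F + {x'}) ⊆ F + A :=
      union_subset (hsubFA x hx) (hsubFA x' hx')
  have c2 := card_le_card hsub2
  rw [card_union_of_disjoint (hcosd _ _ hxx'), hcos, hcos] at c2
  have c2' : (F.card : ℝ) + F.card ≤ (F + A).card := by exact_mod_cast c2
  have hFle : (F.card : ℝ) ≤ (θ - 1) * n - 5 * k := by nlinarith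
  have hDcl : ∀ a ∈ A, ∀ a' ∈ A, a - a' ∈ H ∨ a - a' - t ∈ H ∨ a - a' + t ∈ H := by
    intro a ha a' ha'
    rcases htwo a ha with h | h <;> rcases htwo a' ha' with h' | h'
    · left; have := H.sub_mem h h'; simpa using this
    · right; right
      have := H.sub_mem h h'
      rw [ht]; convert this using 1; abel
    · right; left
      have := H.sub_mem h h'
      rw [ht]; convert this using 1; abel
    · left; have := H.sub_mem h h'; simpa using this
  have hDclB : ∀ a ∈ B, ∀ a' ∈ B, a - a' ∈ H ∨ a - a' - t ∈ H ∨ a - a' + t ∈ H := by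
    intro b hb b' hb'
    obtain ⟨a, ha, a', ha', e⟩ := hDBA b hb b' hb'
    rw [e]; exact hDcl a' ha' a ha
  have h2t : t + t ∉ H := by
    intro h2t
    let K : AddSubgroup G :=
      { carrier := {g | g ∈ H ∨ g - t ∈ H}
        zero_mem' := Or.inl H.zero_mem
        add_mem' := by
          rintro a b (ha | ha) (hb | hb)
          · exact Or.inl (H.add_mem ha hb)
          · right; have := H.add_mem ha hb
            convert this using 1; abel
          · right; have := H.add_mem ha hb
            convert this using 1; abel
          · left; have := H.add_mem (H.add_mem ha hb) h2t
            convert this using 1; abel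
        neg_mem' := by
          rintro a (ha | ha)
          · exact Or.inl (H.neg_mem ha)
          · right; have := H.neg_mem (H.add_mem ha h2t)
            convert this using 1; abel }
    have hK : K = ⊤ := hgen' K fun a ha a' ha' => by
      rcases hDcl a ha a' ha' with h | h | h
      · exact Or.inl h
      · exact Or.inr h
      · right
        have := H.sub_mem h h2t
        convert this using 1; abel
    apply hFA
    rw [eq_univ_iff_forall]
    intro z
    have hz : z - x ∈ K := by rw [hK]; trivial
    rcases hz with h | h
    · exact hsubFA x hx (by rw [hcosm]; exact h)
    · refine hsubFA x' hx' ?_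
      rw [hcosm]; rw [ht] at h; convert h using 1; abel
  obtain ⟨y, hy, y', hy', hyy⟩ := hDAB x' hx' x hx
  refine ⟨H, x, hx, x', hx', y, hy, y', hy', hyy, hxx', h2t, htwo, ?_⟩
  rw [← ht] at hyy
  intro b hb
  by_contra hcon
  push Not at hcon
  have hbt : b - y + t ∈ H := by
    rcases hDclB b hb y hy with h | h | h
    · exact absurd h hcon.1
    · exfalso; apply hcon.2; rw [hyy] at h; convert h using 1; abel
    · exact h
  have h3t : t + t + t ∈ H := by
    have e0 : b - y' = b - y - t := by rw [hyy]; abel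
    rcases hDclB b hb y' hy' with h | h | h
    · exact absurd h hcon.2
    · have := H.sub_mem hbt h
      rw [e0] at this; convert this using 1; abel
    · exfalso; apply hxx'
      have := H.sub_mem hbt h
      rw [e0] at this; convert this using 1; abel
  apply hDne
  let K : AddSubgroup G :=
      { carrier := {g | g ∈ H ∨ g - t ∈ H ∨ g + t ∈ H}
        zero_mem' := Or.inl H.zero_mem
        add_mem' := by
          rintro a b (ha | ha | ha) (hb | hb | hb) <;> have hh := H.add_mem ha hb
          · exact Or.inl hh
          · right; left; convert hh using 1; abel
          · right; right; convert hh using 1; abel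
          · right; left; convert hh using 1; abel
          · right; right; convert H.add_mem hh h3t using 1; abel
          · left; convert hh using 1; abel
          · right; right; convert hh using 1; abel
          · left; convert hh using 1; abel
          · right; left; convert H.sub_mem hh h3t using 1; abel
        neg_mem' := by
          rintro a (ha | ha | ha)
          · exact Or.inl (H.neg_mem ha)
          · right; right; convert H.neg_mem ha using 1; abel
          · right; left; convert H.neg_mem ha using 1; abel }
  have hK : K = ⊤ := hgen' K fun a ha a' ha' => hDcl a ha a' ha'
  let A0 := A.filter fun a => a - x ∈ H
  let A1 := A.filter fun a => a - x' ∈ H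
  have hA0F : (A0.card : ℝ) ≤ F.card := by
    rw [← hcos x]
    exact_mod_cast card_le_card fun a ha => (hcosm x a).2 (mem_filter.1 ha).2
  have hA1F : (A1.card : ℝ) ≤ F.card := by
    rw [← hcos x']
    exact_mod_cast card_le_card fun a ha => (hcosm x' a).2 (mem_filter.1 ha).2
  have hA01 : (A.card : ℝ) ≤ A0.card + A1.card := by
    have : A ⊆ A0 ∪ A1 := by
      intro a ha
      rcases htwo a ha with h | h
      · exact mem_union_left _ (mem_filter.2 ⟨ha, h⟩)
      · exact mem_union_right _ (mem_filter.2 ⟨ha, h⟩)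
    exact_mod_cast (card_le_card this).trans (card_union_le _ _)
  have pig : ∀ (X Y : Finset G) (c g : G), (∀ a ∈ X, a + g - c ∈ H) → (∀ a ∈ Y, a - c ∈ H) →
      X ⊆ A → Y ⊆ A → (F.card : ℝ) < X.card + Y.card → g ∈ A - A := by
    intro X Y c g hX hY hXA hYA hlt
    have h5 : ¬ Disjoint (X + {g}) Y := by
      intro hd
      have h6 : (X + {g}) ∪ Y ⊆ F + {c} := by
        apply union_subset
        · intro z hz
          obtain ⟨a, ha, w, hw, rfl⟩ := mem_add.1 hz
          rw [mem_singleton.1 hw, hcosm]; exact hX a ha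
        · intro z hz
          rw [hcosm]; exact hY z hz
      have h7 := card_le_card h6
      have hXg : (X + {g}).card = X.card := by
        rw [add_singleton]; exact card_image_of_injective _ (add_left_injective g)
      rw [card_union_of_disjoint hd, hcos, hXg] at h7
      have : (X.card : ℝ) + Y.card ≤ F.card := by exact_mod_cast h7
      linarith
    rw [not_disjoint_iff] at h5
    obtain ⟨z, hz, hzY⟩ := h5
    obtain ⟨a, ha, w, hw, rfl⟩ := mem_add.1 hz
    rw [mem_singleton.1 hw] at hzY
    exact mem_sub.2 ⟨_, hYA hzY, a, hXA ha, by abel⟩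
  rw [eq_univ_iff_forall]
  intro g
  have hg : g ∈ K := by rw [hK]; trivial
  rcases hg with h | h | h
  · apply pig A0 A0 x g _ _ (filter_subset _ _) (filter_subset _ _)
    · nlinarith
    · intro a ha
      convert H.add_mem (mem_filter.1 ha).2 h using 1; abel
    · intro a ha; exact (mem_filter.1 ha).2
  · apply pig A0 A1 x' g _ _ (filter_subset _ _) (filter_subset _ _)
    · nlinarith
    · intro a ha
      convert H.add_mem (mem_filter.1 ha).2 h using 1; rw [ht]; abel
    · intro a ha; exact (mem_filter.1 ha).2
  · apply pig A1 A0 x g _ _ (filter_subset _ _) (filter_subset _ _)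
    · nlinarith
    · intro a ha
      convert H.add_mem (mem_filter.1 ha).2 h using 1; rw [ht]; abel
    · intro a ha; exact (mem_filter.1 ha).2

lemma restr_sum (X Y Z : Finset ℤ) (R : ℤ → ℤ → Prop) [∀ a, DecidablePred fun b => ¬ R a b]
    [∀ b, DecidablePred fun a => ¬ R a b] (k : ℝ) (hX : X.Nonempty) (hY : Y.Nonempty)
    (hZ : ∀ a ∈ X, ∀ b ∈ Y, R a b → a + b ∈ Z)
    (hmA : ∀ a ∈ X, ((Y.filter fun b => ¬ R a b).card : ℝ) ≤ k)
    (hmB : ∀ b ∈ Y, ((X.filter fun a => ¬ R a b).card : ℝ) ≤ k) :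
    (X.card : ℝ) + Y.card - 1 - 2 * k ≤ Z.card := by
  classical
  set x := X.min' hX with hx
  set y := Y.max' hY with hy
  have hxX : x ∈ X := X.min'_mem hX
  have hyY : y ∈ Y := Y.max'_mem hY
  let U := (Y.filter fun b => R x b).image fun b => x + b
  let V := (X.filter fun a => R a y).image fun a => a + y
  have hU : (Y.card : ℝ) - k ≤ U.card := by
    have h1 : U.card = (Y.filter fun b => R x b).card :=
      card_image_of_injective _ (add_right_injective x)
    have h2 := card_filter_add_card_filter_not (s := Y) (fun b => R x b)
    have h3 := hmA x hxX
    have h4 : ((Y.filter fun b => R x b).card : ℝ) + ((Y.filter fun b => ¬ R x b).card : ℝ)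
        = Y.card := by
      rw [← h2]; push_cast; congr!
    rw [h1]; linarith
  have hV : (X.card : ℝ) - k ≤ V.card := by
    have h1 : V.card = (X.filter fun a => R a y).card :=
      card_image_of_injective _ (add_left_injective y)
    have h2 := card_filter_add_card_filter_not (s := X) (fun a => R a y)
    have h3 := hmB y hyY
    have h4 : ((X.filter fun a => R a y).card : ℝ) + ((X.filter fun a => ¬ R a y).card : ℝ)
        = X.card := by
      rw [← h2]; push_cast; congr!
    rw [h1]; linarith
  have hUV : U ∩ V ⊆ {x + y} := by
    intro z hz
    have hz := mem_inter.1 hz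
    obtain ⟨b, hb, hb'⟩ := mem_image.1 hz.1
    obtain ⟨a, ha, ha'⟩ := mem_image.1 hz.2
    have e1 : b ≤ y := Y.le_max' b (mem_filter.1 hb).1
    have e2 : x ≤ a := X.min'_le a (mem_filter.1 ha).1
    rw [mem_singleton]
    omega
  have hsub : U ∪ V ⊆ Z := by
    apply union_subset
    · intro z hz
      obtain ⟨b, hb, rfl⟩ := mem_image.1 hz
      exact hZ x hxX b (mem_filter.1 hb).1 (mem_filter.1 hb).2
    · intro z hz
      obtain ⟨a, ha, rfl⟩ := mem_image.1 hz
      exact hZ a (mem_filter.1 ha).1 y hyY (mem_filter.1 ha).2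
  have c1 := card_le_card hUV
  rw [card_singleton] at c1
  have c2 := card_le_card hsub
  have c3 := card_union_add_card_inter U V
  have c1' : ((U ∩ V).card : ℝ) ≤ 1 := by exact_mod_cast c1
  have c2' : ((U ∪ V).card : ℝ) ≤ Z.card := by exact_mod_cast c2
  have c3' : ((U ∪ V).card : ℝ) + (U ∩ V).card = U.card + V.card := by exact_mod_cast c3
  linarith

open Classical in
lemma core (A B S : Finset ℤ) (R : ℤ → ℤ → Prop) (l : ℤ)
    (θ n k : ℝ) (h1 : θ ^ 2 = θ + 1) (h2 : 1.618 < θ) (h3 : θ < 1.6181)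
    (hk : 2 ≤ k) (hkn : 4 * k ≤ n) (hA : n - k ≤ A.card) (hB : n - k ≤ B.card)
    (hA0 : 0 ∈ A) (hAl : l ∈ A) (hB0 : 0 ∈ B)
    (hAr : ∀ a ∈ A, 0 ≤ a ∧ a ≤ l) (hBr : ∀ b ∈ B, 0 ≤ b ∧ b ≤ l)
    (hS : ∀ a ∈ A, ∀ b ∈ B, R a b → a + b ∈ S)
    (hmA : ∀ a ∈ A, ((B.filter fun b => ¬ R a b).card : ℝ) ≤ k)
    (hmB : ∀ b ∈ B, ((A.filter fun a => ¬ R a b).card : ℝ) ≤ k)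
    (hM : (((A ×ˢ B).filter fun p : ℤ × ℤ => ¬ R p.1 p.2).card : ℝ) ≤ k ^ 2)
    (hs : (S.card : ℝ) < (1 + θ) * n - 11 * k)
    (hgen : ∀ H : AddSubgroup ℤ, (∀ a ∈ A, a ∈ H) → (∀ b ∈ B, b ∈ H) → H = ⊤) :
    (l : ℝ) + 1 ≤ S.card - (n - 5 * k) := by
  by_contra hcon
  push Not at hcon
  have hlpos : 0 < l := by
    rcases (hAr l hAl).1.lt_or_eq with h | h
    · exact h
    · exfalso
      have : A ⊆ {0} := fun a ha => by
        have := hAr a ha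
        rw [mem_singleton]; omega
      have := card_le_card this
      rw [card_singleton] at this
      have : (A.card : ℝ) ≤ 1 := by exact_mod_cast this
      linarith
  obtain ⟨m, rfl⟩ : ∃ m : ℕ, l = m := ⟨l.toNat, by omega⟩
  have hm : 0 < m := by exact_mod_cast hlpos
  have : NeZero m := ⟨hm.ne'⟩
  let π : ℤ →+* ZMod m := Int.castRingHom (ZMod m)
  have hπm : π (m : ℤ) = 0 := by simp [π]
  let A2 := A.erase m
  let B2 := B.erase m
  have hA2r : ∀ a ∈ A2, a ∈ A ∧ 0 ≤ a ∧ a < m := by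
    intro a ha
    have h := mem_erase.1 ha
    have := hAr a h.2
    exact ⟨h.2, this.1, lt_of_le_of_ne this.2 h.1⟩
  have hB2r : ∀ a ∈ B2, a ∈ B ∧ 0 ≤ a ∧ a < m := by
    intro a ha
    have h := mem_erase.1 ha
    have := hBr a h.2
    exact ⟨h.2, this.1, lt_of_le_of_ne this.2 h.1⟩
  have hval : ∀ a : ℤ, 0 ≤ a → a < m → ((π a).val : ℤ) = a := by
    intro a h0 hl
    simp only [π, eq_intCast]
    rw [ZMod.val_intCast, Int.emod_eq_of_lt h0 hl]
  have hA2c : n - 1.5 * k ≤ A2.card := by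
    have : A.card ≤ A2.card + 1 := by
      have := pred_card_le_card_erase (s := A) (a := (m : ℤ))
      simp only [A2]; omega
    have : (A.card : ℝ) ≤ A2.card + 1 := by exact_mod_cast this
    linarith
  have hB2c : n - 1.5 * k ≤ B2.card := by
    have : B.card ≤ B2.card + 1 := by
      have := pred_card_le_card_erase (s := B) (a := (m : ℤ))
      simp only [B2]; omega
    have : (B.card : ℝ) ≤ B2.card + 1 := by exact_mod_cast this
    linarith
  have hSm : ((S.image π).card : ℝ) ≤ S.card - n + 3.5 * k := by
    let C := B2.filter fun b => R 0 b ∧ R m b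
    have hC : (B2.card : ℝ) - 2 * k ≤ C.card := by
      have : B2 ⊆ C ∪ ((B.filter fun b => ¬ R 0 b) ∪ (B.filter fun b => ¬ R m b)) := by
        intro b hb
        have hbB := (hB2r b hb).1
        simp only [C, mem_union, mem_filter]
        tauto
      have h4 := (card_le_card this).trans (card_union_le _ _)
      have h5 := card_union_le (B.filter fun b => ¬ R 0 b) (B.filter fun b => ¬ R m b)
      have h6 : (B2.card : ℝ) ≤ C.card + ((B.filter fun b => ¬ R 0 b).card
        + (B.filter fun b => ¬ R m b).card) := by
        exact_mod_cast h4.trans (Nat.add_le_add_left h5 _)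
      have := hmA 0 hA0
      have := hmA m hAl
      linarith
    let E := C.image fun b => (m : ℤ) + b
    have hE : E.card = C.card := card_image_of_injective _ (add_right_injective (m : ℤ))
    have hES : E ⊆ S := by
      intro z hz
      obtain ⟨b, hb, rfl⟩ := mem_image.1 hz
      have hb := mem_filter.1 hb
      exact hS _ hAl _ (hB2r b hb.1).1 hb.2.2
    have hsub : S.image π ⊆ (S \ E).image π := by
      intro z hz
      obtain ⟨u, hu, rfl⟩ := mem_image.1 hz
      by_cases huE : u ∈ E
      · obtain ⟨b, hb, rfl⟩ := mem_image.1 huE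
        have hb := mem_filter.1 hb
        have hbr := hB2r b hb.1
        refine mem_image.2 ⟨b, mem_sdiff.2 ⟨?_, fun hbE => ?_⟩, ?_⟩
        · have := hS 0 hA0 b hbr.1 hb.2.1
          simpa using this
        · obtain ⟨c, hc, hc'⟩ := mem_image.1 hbE
          have := hB2r c (mem_filter.1 hc).1
          omega
        · simp only [map_add, hπm, zero_add]
      · exact mem_image.2 ⟨u, mem_sdiff.2 ⟨hu, huE⟩, rfl⟩
    have h4 := (card_le_card hsub).trans card_image_le
    have h5 := card_sdiff_add_card_eq_card hES
    have h4' : ((S.image π).card : ℝ) ≤ (S \ E).card := by exact_mod_cast h4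
    have h5' : ((S \ E).card : ℝ) + C.card = S.card := by rw [← hE]; exact_mod_cast h5
    linarith
  let R' : ZMod m → ZMod m → Prop := fun u v => R (u.val : ℤ) (v.val : ℤ)
  have hcardim : ∀ X : Finset ℤ, (∀ a ∈ X, 0 ≤ a ∧ a < m) → (X.image π).card = X.card := by
    intro X hX
    apply card_image_of_injOn
    intro a ha b hb h
    have e1 := hval a (hX a ha).1 (hX a ha).2
    have e2 := hval b (hX b hb).1 (hX b hb).2
    rw [← e1, ← e2, h]
  have hA2im := hcardim A2 fun a ha => (hA2r a ha).2
  have hB2im := hcardim B2 fun a ha => (hB2r a ha).2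
  have hgen2 : ∀ H : AddSubgroup (ZMod m), (∀ a ∈ A2.image π, ∀ a' ∈ A2.image π, a - a' ∈ H) →
      (∀ b ∈ B2.image π, ∀ b' ∈ B2.image π, b - b' ∈ H) → H = ⊤ := by
    intro H hHA hHB
    have hK := hgen (H.comap π.toAddMonoidHom) (by
      intro a ha
      change π a ∈ H
      by_cases ham : a = m
      · rw [ham, hπm]; exact H.zero_mem
      · have := hHA (π a) (mem_image_of_mem _ (mem_erase.2 ⟨ham, ha⟩)) (π 0)
          (mem_image_of_mem _ (mem_erase.2 ⟨by omega, hA0⟩))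
        simpa using this) (by
      intro a ha
      change π a ∈ H
      by_cases ham : a = m
      · rw [ham, hπm]; exact H.zero_mem
      · have := hHB (π a) (mem_image_of_mem _ (mem_erase.2 ⟨ham, ha⟩)) (π 0)
          (mem_image_of_mem _ (mem_erase.2 ⟨by omega, hB0⟩))
        simpa using this)
    rw [eq_top_iff]
    intro z _
    obtain ⟨u, rfl⟩ := ZMod.intCast_surjective z
    have : u ∈ H.comap π.toAddMonoidHom := by rw [hK]; trivial
    exact this
  obtain ⟨H, x, hx, x', hx', y, hy, y', hy', hxy, ht, h2t, hAc, hBc⟩ :=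
    struct (A2.image π) (B2.image π) (S.image π) R' θ n k h1 h2 h3 (by linarith) hkn
      (by rw [hA2im]; exact hA2c) (by rw [hB2im]; exact hB2c)
      (by
        intro a ha b hb hR
        obtain ⟨a, ha2, rfl⟩ := mem_image.1 ha
        obtain ⟨b, hb2, rfl⟩ := mem_image.1 hb
        have ha := hA2r a ha2
        have hb := hB2r b hb2
        simp only [R'] at hR
        rw [hval a ha.2.1 ha.2.2, hval b hb.2.1 hb.2.2] at hR
        rw [← map_add]
        exact mem_image_of_mem _ (hS a ha.1 b hb.1 hR))
      (by
        intro a ha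
        obtain ⟨a, ha2, rfl⟩ := mem_image.1 ha
        have ha := hA2r a ha2
        refine le_trans ?_ (hmA a ha.1)
        norm_cast
        refine le_trans (card_le_card ?_)
          (card_image_le (s := B.filter fun b => ¬ R a b) (f := π))
        intro z hz
        have hz := mem_filter.1 hz
        obtain ⟨b, hb2, rfl⟩ := mem_image.1 hz.1
        have hb := hB2r b hb2
        refine mem_image_of_mem _ (mem_filter.2 ⟨hb.1, ?_⟩)
        have hR := hz.2
        simp only [R'] at hR
        rwa [hval a ha.2.1 ha.2.2, hval b hb.2.1 hb.2.2] at hR)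
      (by
        intro b hb
        obtain ⟨b, hb2, rfl⟩ := mem_image.1 hb
        have hb := hB2r b hb2
        refine le_trans ?_ (hmB b hb.1)
        norm_cast
        refine le_trans (card_le_card ?_)
          (card_image_le (s := A.filter fun a => ¬ R a b) (f := π))
        intro z hz
        have hz := mem_filter.1 hz
        obtain ⟨a, ha2, rfl⟩ := mem_image.1 hz.1
        have ha := hA2r a ha2
        refine mem_image_of_mem _ (mem_filter.2 ⟨ha.1, ?_⟩)
        have hR := hz.2
        simp only [R'] at hR
        rwa [hval a ha.2.1 ha.2.2, hval b hb.2.1 hb.2.2] at hR)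
      (by
        refine le_trans ?_ hM
        norm_cast
        refine le_trans (card_le_card ?_)
          (card_image_le (s := (A ×ˢ B).filter fun p : ℤ × ℤ => ¬ R p.1 p.2)
            (f := fun p => (π p.1, π p.2)))
        rintro ⟨u, v⟩ hz
        have hz := mem_filter.1 hz
        have hz1 := mem_product.1 hz.1
        obtain ⟨a, ha2, e1⟩ := mem_image.1 hz1.1
        obtain ⟨b, hb2, e2⟩ := mem_image.1 hz1.2
        simp only at e1 e2
        subst e1 e2
        have ha := hA2r a ha2
        have hb := hB2r b hb2
        refine mem_image.2 ⟨(a, b), mem_filter.2 ⟨mem_product.2 ⟨ha.1, hb.1⟩, ?_⟩, rfl⟩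
        have hR := hz.2
        simp only [R'] at hR
        rwa [hval a ha.2.1 ha.2.2, hval b hb.2.1 hb.2.2] at hR)
      (by linarith)
      (by
        rw [ZMod.card]
        have : (((m : ℕ) : ℤ) : ℝ) = (m : ℝ) := by norm_cast
        rw [this] at hcon
        linarith)
      hgen2
  set t := x' - x with htd
  let X0 := A2.filter fun a => π a - x ∈ H
  let X1 := A2.filter fun a => π a - x' ∈ H
  let Y0 := B2.filter fun b => π b - y ∈ H
  let Y1 := B2.filter fun b => π b - y' ∈ H
  have hX0 : X0.Nonempty := by
    obtain ⟨a, ha, rfl⟩ := mem_image.1 hx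
    exact ⟨a, mem_filter.2 ⟨ha, by simp⟩⟩
  have hX1 : X1.Nonempty := by
    obtain ⟨a, ha, rfl⟩ := mem_image.1 hx'
    exact ⟨a, mem_filter.2 ⟨ha, by simp⟩⟩
  have hY0 : Y0.Nonempty := by
    obtain ⟨a, ha, rfl⟩ := mem_image.1 hy
    exact ⟨a, mem_filter.2 ⟨ha, by simp⟩⟩
  have hY1 : Y1.Nonempty := by
    obtain ⟨a, ha, rfl⟩ := mem_image.1 hy'
    exact ⟨a, mem_filter.2 ⟨ha, by simp⟩⟩
  have hXc : (A2.card : ℝ) ≤ X0.card + X1.card := by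
    have : A2 ⊆ X0 ∪ X1 := by
      intro a ha
      rcases hAc (π a) (mem_image_of_mem _ ha) with h | h
      · exact mem_union_left _ (mem_filter.2 ⟨ha, h⟩)
      · exact mem_union_right _ (mem_filter.2 ⟨ha, h⟩)
    exact_mod_cast (card_le_card this).trans (card_union_le _ _)
  have hYc : (B2.card : ℝ) ≤ Y0.card + Y1.card := by
    have : B2 ⊆ Y0 ∪ Y1 := by
      intro a ha
      rcases hBc (π a) (mem_image_of_mem _ ha) with h | h
      · exact mem_union_left _ (mem_filter.2 ⟨ha, h⟩)
      · exact mem_union_right _ (mem_filter.2 ⟨ha, h⟩)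
    exact_mod_cast (card_le_card this).trans (card_union_le _ _)
  have hZ : ∀ (X Y : Finset ℤ) (u v w : ZMod m), X ⊆ A → Y ⊆ B → X.Nonempty → Y.Nonempty →
      (∀ a ∈ X, π a - u ∈ H) → (∀ b ∈ Y, π b - v ∈ H) → u + v = w →
      (X.card : ℝ) + Y.card - 1 - 2 * k ≤ (S.filter fun z => π z - w ∈ H).card := by
    intro X Y u v w hXA hYB hXn hYn hXu hYv huv
    apply restr_sum X Y _ R k hXn hYn
    · intro a ha b hb hR
      refine mem_filter.2 ⟨hS a (hXA ha) b (hYB hb) hR, ?_⟩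
      have := H.add_mem (hXu a ha) (hYv b hb)
      rw [map_add, ← huv]
      convert this using 1; abel
    · intro a ha
      refine le_trans ?_ (hmA a (hXA ha))
      exact_mod_cast card_le_card (filter_subset_filter _ hYB)
    · intro b hb
      refine le_trans ?_ (hmB b (hYB hb))
      exact_mod_cast card_le_card (filter_subset_filter _ hXA)
  have sX0 : X0 ⊆ A := (filter_subset _ _).trans (erase_subset _ _)
  have sX1 : X1 ⊆ A := (filter_subset _ _).trans (erase_subset _ _)
  have sY0 : Y0 ⊆ B := (filter_subset _ _).trans (erase_subset _ _)
  have sY1 : Y1 ⊆ B := (filter_subset _ _).trans (erase_subset _ _)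
  have pX0 : ∀ a ∈ X0, π a - x ∈ H := fun a ha => (mem_filter.1 ha).2
  have pX1 : ∀ a ∈ X1, π a - x' ∈ H := fun a ha => (mem_filter.1 ha).2
  have pY0 : ∀ a ∈ Y0, π a - y ∈ H := fun a ha => (mem_filter.1 ha).2
  have pY1 : ∀ a ∈ Y1, π a - y' ∈ H := fun a ha => (mem_filter.1 ha).2
  have z00 := hZ X0 Y0 x y (x + y) sX0 sY0 hX0 hY0 pX0 pY0 rfl
  have ex : x' = x + t := by rw [htd]; abel
  have ey : y' = y + t := by rw [hxy]; abel
  have z01 := hZ X0 Y1 x y' (x + y + t) sX0 sY1 hX0 hY1 pX0 pY1 (by rw [ey]; abel)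
  have z10 := hZ X1 Y0 x' y (x + y + t) sX1 sY0 hX1 hY0 pX1 pY0 (by rw [ex]; abel)
  have z11 := hZ X1 Y1 x' y' (x + y + t + t) sX1 sY1 hX1 hY1 pX1 pY1 (by rw [ex, ey]; abel)
  let Z0 := S.filter fun z => π z - (x + y) ∈ H
  let Z1 := S.filter fun z => π z - (x + y + t) ∈ H
  let Z2 := S.filter fun z => π z - (x + y + t + t) ∈ H
  have hdis : ∀ w w' : ZMod m, w' - w ∉ H → Disjoint (S.filter fun z => π z - w ∈ H)
      (S.filter fun z => π z - w' ∈ H) := by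
    intro w w' h
    rw [disjoint_left]
    intro z hz hz'
    apply h
    have := H.sub_mem (mem_filter.1 hz).2 (mem_filter.1 hz').2
    simpa using this
  have d01 : Disjoint Z0 Z1 := hdis _ _ (by simpa using ht)
  have d12 : Disjoint Z1 Z2 := hdis _ _ (by simpa using ht)
  have d02 : Disjoint Z0 Z2 := hdis _ _ (by
    intro h; apply h2t; convert h using 1; abel)
  have hcc : Z0.card + Z1.card + Z2.card ≤ S.card := by
    rw [← card_union_of_disjoint d01,
      ← card_union_of_disjoint (disjoint_union_left.2 ⟨d02, d12⟩)]
    exact card_le_card (union_subset (union_subset (filter_subset _ _) (filter_subset _ _))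
      (filter_subset _ _))
  have hcc' : (Z0.card : ℝ) + Z1.card + Z2.card ≤ S.card := by exact_mod_cast hcc
  have hθn : θ * n ≤ 1.6181 * n := mul_le_mul_of_nonneg_right h3.le (by linarith)
  linarith

open Classical in
lemma normalised (A B S : Finset ℤ) (R : ℤ → ℤ → Prop)
    (θ n k : ℝ) (h1 : θ ^ 2 = θ + 1) (h2 : 1.618 < θ) (h3 : θ < 1.6181)
    (hk : 2 ≤ k) (hkn : 4 * k ≤ n) (hA : n - k ≤ A.card) (hB : n - k ≤ B.card)
    (hS : ∀ a ∈ A, ∀ b ∈ B, R a b → a + b ∈ S)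
    (hmA : ∀ a ∈ A, ((B.filter fun b => ¬ R a b).card : ℝ) ≤ k)
    (hmB : ∀ b ∈ B, ((A.filter fun a => ¬ R a b).card : ℝ) ≤ k)
    (hM : (((A ×ˢ B).filter fun p : ℤ × ℤ => ¬ R p.1 p.2).card : ℝ) ≤ k ^ 2)
    (hs : (S.card : ℝ) < (1 + θ) * n - 11 * k) :
    ∃ (d x y : ℤ) (l : ℕ), 0 < d ∧ (l : ℝ) + 1 ≤ S.card - (n - 5 * k) ∧
      (∀ a ∈ A, ∃ i : ℕ, i ≤ l ∧ a = x + d * i) ∧ (∀ b ∈ B, ∃ i : ℕ, i ≤ l ∧ b = y + d * i) := by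
  have hA1 : 1 < A.card := by
    have : (1 : ℝ) < A.card := by linarith
    exact_mod_cast this
  have hAne : A.Nonempty := card_pos.1 (by omega)
  have hBne : B.Nonempty := by
    have : (0 : ℝ) < B.card := by linarith
    exact card_pos.1 (by exact_mod_cast this)
  set x := A.min' hAne with hx
  set y := B.min' hBne with hy
  have hxA : x ∈ A := A.min'_mem hAne
  have hyB : y ∈ B := B.min'_mem hBne
  have hxle : ∀ a ∈ A, x ≤ a := fun a ha => A.min'_le a ha
  have hyle : ∀ a ∈ B, y ≤ a := fun a ha => B.min'_le a ha
  let K : AddSubgroup ℤ := AddSubgroup.closure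
    (↑((A.image fun a => a - x) ∪ (B.image fun b => b - y)) : Set ℤ)
  obtain ⟨g, hg0, hgK⟩ : ∃ g : ℤ, 0 ≤ g ∧ ∀ z, z ∈ K ↔ g ∣ z := by
    obtain ⟨c, hc⟩ := Int.subgroup_cyclic K
    refine ⟨|c|, abs_nonneg c, fun z => ?_⟩
    rw [hc, abs_dvd, ← AddSubgroup.zmultiples_eq_closure, Int.mem_zmultiples_iff]
  have hgA : ∀ a ∈ A, g ∣ a - x := fun a ha => (hgK _).1 (AddSubgroup.subset_closure
    (mem_coe.2 (mem_union_left _ (mem_image.2 ⟨a, ha, rfl⟩))))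
  have hgB : ∀ a ∈ B, g ∣ a - y := fun a ha => (hgK _).1 (AddSubgroup.subset_closure
    (mem_coe.2 (mem_union_right _ (mem_image.2 ⟨a, ha, rfl⟩))))
  have hg : 0 < g := by
    rcases hg0.lt_or_eq with h | h
    · exact h
    · exfalso
      obtain ⟨a, ha, hax⟩ := exists_mem_ne hA1 x
      have := hgA a ha
      rw [← h, zero_dvd_iff] at this
      omega
  let fA : ℤ → ℤ := fun a => (a - x) / g
  let fB : ℤ → ℤ := fun a => (a - y) / g
  have efA : ∀ a ∈ A, x + g * fA a = a := fun a ha => by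
    simp only [fA]; rw [Int.mul_ediv_cancel' (hgA a ha)]; ring
  have efB : ∀ a ∈ B, y + g * fB a = a := fun a ha => by
    simp only [fB]; rw [Int.mul_ediv_cancel' (hgB a ha)]; ring
  let A1 := A.image fA
  let B1 := B.image fB
  have hA1c : A1.card = A.card := card_image_of_injOn fun a ha b hb h => by
    rw [← efA a ha, ← efA b hb, h]
  have hB1c : B1.card = B.card := card_image_of_injOn fun a ha b hb h => by
    rw [← efB a ha, ← efB b hb, h]
  have mA1 : ∀ u ∈ A1, x + g * u ∈ A := fun u hu => by
    obtain ⟨a, ha, rfl⟩ := mem_image.1 hu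
    rw [efA a ha]; exact ha
  have mB1 : ∀ u ∈ B1, y + g * u ∈ B := fun u hu => by
    obtain ⟨a, ha, rfl⟩ := mem_image.1 hu
    rw [efB a ha]; exact ha
  have h0A : 0 ∈ A1 := mem_image.2 ⟨x, hxA, by simp [fA]⟩
  have h0B : 0 ∈ B1 := mem_image.2 ⟨y, hyB, by simp [fB]⟩
  have pA : ∀ u ∈ A1, 0 ≤ u := fun u hu => by
    have := hxle _ (mA1 u hu)
    exact nonneg_of_mul_nonneg_right (by linarith : 0 ≤ g * u) hg
  have pB : ∀ u ∈ B1, 0 ≤ u := fun u hu => by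
    have := hyle _ (mB1 u hu)
    exact nonneg_of_mul_nonneg_right (by linarith : 0 ≤ g * u) hg
  let R1 : ℤ → ℤ → Prop := fun u v => R (x + g * u) (y + g * v)
  let S1 := S.image fun z => (z - x - y) / g
  have hS1c : (S1.card : ℝ) ≤ S.card := by exact_mod_cast card_image_le
  have hS1 : ∀ a ∈ A1, ∀ b ∈ B1, R1 a b → a + b ∈ S1 := by
    intro a ha b hb hR
    refine mem_image.2 ⟨_, hS _ (mA1 a ha) _ (mB1 b hb) hR, ?_⟩
    have : x + g * a + (y + g * b) - x - y = g * (a + b) := by ring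
    rw [this, Int.mul_ediv_cancel_left _ hg.ne']
  have inj : ∀ x : ℤ, Function.Injective fun u : ℤ => x + g * u := by
    intro x u v h
    have h : x + g * u = x + g * v := h
    have : g * u = g * v := by linarith
    exact mul_left_cancel₀ hg.ne' this
  have hmA1 : ∀ a ∈ A1, ((B1.filter fun b => ¬ R1 a b).card : ℝ) ≤ k := by
    intro a ha
    refine le_trans ?_ (hmA _ (mA1 a ha))
    norm_cast
    apply card_le_card_of_injOn (fun u => y + g * u)
    · intro b hb
      have hb := mem_filter.1 (mem_coe.1 hb)
      exact mem_coe.2 (mem_filter.2 ⟨mB1 b hb.1, hb.2⟩)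
    · exact (inj y).injOn
  have hmB1 : ∀ b ∈ B1, ((A1.filter fun a => ¬ R1 a b).card : ℝ) ≤ k := by
    intro b hb
    refine le_trans ?_ (hmB _ (mB1 b hb))
    norm_cast
    apply card_le_card_of_injOn (fun u => x + g * u)
    · intro a ha
      have ha := mem_filter.1 (mem_coe.1 ha)
      exact mem_coe.2 (mem_filter.2 ⟨mA1 a ha.1, ha.2⟩)
    · exact (inj x).injOn
  have hM1 : (((A1 ×ˢ B1).filter fun p : ℤ × ℤ => ¬ R1 p.1 p.2).card : ℝ) ≤ k ^ 2 := by
    refine le_trans ?_ hM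
    norm_cast
    apply card_le_card_of_injOn (fun p => (x + g * p.1, y + g * p.2))
    · intro p hp
      have hp := mem_filter.1 (mem_coe.1 hp)
      have hp1 := mem_product.1 hp.1
      exact mem_coe.2 (mem_filter.2 ⟨mem_product.2 ⟨mA1 _ hp1.1, mB1 _ hp1.2⟩, hp.2⟩)
    · intro p _ q _ h
      have h := Prod.mk.inj h
      exact Prod.ext (inj x h.1) (inj y h.2)
  have hM1' : (((B1 ×ˢ A1).filter fun p : ℤ × ℤ => ¬ R1 p.2 p.1).card : ℝ) ≤ k ^ 2 := by
    refine le_trans ?_ hM1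
    norm_cast
    apply card_le_card_of_injOn Prod.swap
    · intro p hp
      have hp := mem_filter.1 (mem_coe.1 hp)
      have hp1 := mem_product.1 hp.1
      exact mem_coe.2 (mem_filter.2 ⟨mem_product.2 ⟨hp1.2, hp1.1⟩, hp.2⟩)
    · exact Prod.swap_injective.injOn
  have hgen : ∀ H : AddSubgroup ℤ, (∀ a ∈ A1, a ∈ H) → (∀ b ∈ B1, b ∈ H) → H = ⊤ := by
    intro H hHA hHB
    have hle : K ≤ H.map (AddMonoidHom.mulLeft g) := by
      rw [AddSubgroup.closure_le]
      intro z hz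
      rcases mem_union.1 (mem_coe.1 hz) with h | h
      · obtain ⟨a, ha, rfl⟩ := mem_image.1 h
        refine ⟨fA a, hHA _ (mem_image_of_mem _ ha), ?_⟩
        have := efA a ha
        simp only [AddMonoidHom.coe_mulLeft]
        linarith
      · obtain ⟨a, ha, rfl⟩ := mem_image.1 h
        refine ⟨fB a, hHB _ (mem_image_of_mem _ ha), ?_⟩
        have := efB a ha
        simp only [AddMonoidHom.coe_mulLeft]
        linarith
    have hgm : g ∈ K := (hgK g).2 dvd_rfl
    obtain ⟨u, hu, hu'⟩ := hle hgm
    simp only [AddMonoidHom.coe_mulLeft] at hu'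
    have hu1 : u = 1 := mul_left_cancel₀ hg.ne' (by rw [hu', mul_one])
    rw [eq_top_iff]
    intro z _
    have := H.zsmul_mem hu z
    rw [hu1] at this
    simpa using this
  have hA1ne : A1.Nonempty := ⟨0, h0A⟩
  have hB1ne : B1.Nonempty := ⟨0, h0B⟩
  have hfin : ∀ l : ℤ, 0 ≤ l → (∀ a ∈ A1, a ≤ l) → (∀ b ∈ B1, b ≤ l) →
      (l : ℝ) + 1 ≤ S1.card - (n - 5 * k) → 
      ∃ (d x y : ℤ) (l : ℕ), 0 < d ∧ (l : ℝ) + 1 ≤ S.card - (n - 5 * k) ∧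
      (∀ a ∈ A, ∃ i : ℕ, i ≤ l ∧ a = x + d * i) ∧
      (∀ b ∈ B, ∃ i : ℕ, i ≤ l ∧ b = y + d * i) := by
    intro l hl hlA hlB hle
    refine ⟨g, x, y, l.toNat, hg, ?_, ?_, ?_⟩
    · have : ((l.toNat : ℕ) : ℝ) = (l : ℝ) := by
        have : ((l.toNat : ℕ) : ℤ) = l := Int.toNat_of_nonneg hl
        exact_mod_cast congrArg (fun z : ℤ => (z : ℝ)) this
      rw [this]; linarith
    · intro a ha
      have hm := mem_image_of_mem fA ha
      have := hlA _ hm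
      have h0 := pA _ hm
      refine ⟨(fA a).toNat, by omega, ?_⟩
      rw [Int.toNat_of_nonneg h0, efA a ha]
    · intro a ha
      have hm := mem_image_of_mem fB ha
      have := hlB _ hm
      have h0 := pB _ hm
      refine ⟨(fB a).toNat, by omega, ?_⟩
      rw [Int.toNat_of_nonneg h0, efB a ha]
  have lA : ∀ a ∈ A1, a ≤ A1.max' hA1ne := fun a ha => A1.le_max' a ha
  have lB : ∀ a ∈ B1, a ≤ B1.max' hB1ne := fun a ha => B1.le_max' a ha
  have mA := A1.max'_mem hA1ne
  have mB := B1.max'_mem hB1ne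
  rcases le_total (B1.max' hB1ne) (A1.max' hA1ne) with h | h
  · refine hfin _ (pA _ mA) lA (fun b hb => (lB b hb).trans h) ?_
    exact core A1 B1 S1 R1 _ θ n k h1 h2 h3 hk hkn (by rw [hA1c]; exact hA)
      (by rw [hB1c]; exact hB) h0A mA h0B (fun a ha => ⟨pA a ha, lA a ha⟩)
      (fun b hb => ⟨pB b hb, (lB b hb).trans h⟩) hS1 hmA1 hmB1 hM1 (by linarith) hgen
  · refine hfin _ (pB _ mB) (fun b hb => (lA b hb).trans h) lB ?_
    exact core B1 A1 S1 (fun b a => R1 a b) _ θ n k h1 h2 h3 hk hkn (by rw [hB1c]; exact hB)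
      (by rw [hA1c]; exact hA) h0B mB h0A (fun a ha => ⟨pB a ha, lB a ha⟩)
      (fun b hb => ⟨pA b hb, (lA b hb).trans h⟩)
      (fun b hb a ha hR => by rw [add_comm]; exact hS1 a ha b hb hR) hmB1 hmA1 hM1' (by linarith)
      (fun H hb ha => hgen H ha hb)

lemma ap_card (x d : ℤ) (hd : 0 < d) (l : ℕ) :
    ((range (l + 1)).image fun i : ℕ => x + d * (i : ℤ)).card = l + 1 := by
  rw [card_image_of_injective, card_range]
  intro i j h
  have h : x + d * (i : ℤ) = x + d * (j : ℤ) := h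
  have : d * (i : ℤ) = d * (j : ℤ) := by linarith
  exact_mod_cast mul_left_cancel₀ hd.ne' this

/-- few elements have large bad degree -/
lemma few_bad (A B : Finset ℤ) (Q : ℤ → ℤ → Prop) [∀ a, DecidablePred (Q a)]
    [DecidablePred fun p : ℤ × ℤ => Q p.1 p.2] (k : ℝ) (hk : 0 < k)
    (hM : (((A ×ˢ B).filter fun p : ℤ × ℤ => Q p.1 p.2).card : ℝ) ≤ k ^ 2) (T : Finset ℤ)
    (hTA : T ⊆ A) (hT : ∀ a ∈ T, k ≤ ((B.filter (Q a)).card : ℝ)) : (T.card : ℝ) ≤ k := by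
  classical
  have h : (T.card : ℝ) * k ≤ k * k := by
    calc (T.card : ℝ) * k = ∑ a ∈ T, k := by rw [sum_const, nsmul_eq_mul]
      _ ≤ ∑ a ∈ T, ((B.filter (Q a)).card : ℝ) := sum_le_sum hT
      _ ≤ (((A ×ˢ B).filter fun p : ℤ × ℤ => Q p.1 p.2).card : ℝ) := by
        norm_cast
        rw [← card_sigma]
        apply card_le_card_of_injOn (fun p => (p.1, p.2))
        · rintro ⟨a, b⟩ hp
          have hp := mem_sigma.1 (mem_coe.1 hp)
          have hb := mem_filter.1 hp.2
          exact mem_coe.2 (mem_filter.2 ⟨mem_product.2 ⟨hTA hp.1, hb.1⟩, hb.2⟩)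
        · rintro ⟨a, b⟩ _ ⟨c, e⟩ _ h
          have h := Prod.mk.inj h
          simp only at h
          rw [h.1, h.2]
      _ ≤ k * k := by rw [← sq]; exact hM
  exact le_of_mul_le_mul_right h hk
end RF

/-- A robust version of Freiman's 3k-4 theorem for restricted sumsets. -/
theorem robust_freiman_theta (ε : ℝ) (hε : 0 < ε) (A B : Finset ℤ) (n : ℕ)
    (hA : A.card = n) (hB : B.card = n) (hn3 : 3 ≤ n) (hnε : 2 / Real.sqrt ε ≤ (n : ℝ))
    (Γ : Finset (ℤ × ℤ)) (hΓsub : Γ ⊆ A ×ˢ B)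
    (hΓcard : (1 - ε) * (n : ℝ) ^ 2 ≤ (Γ.card : ℝ))
    (hsmall : ((Γ.image fun p => p.1 + p.2).card : ℝ)
      < (1 + (Real.sqrt 5 + 1) / 2 - 11 * Real.sqrt ε) * n) :
    ∃ (P Q : Finset ℤ) (d : ℤ),
      (∃ x, P = (Finset.range P.card).image fun i : ℕ => x + d * (i : ℤ)) ∧
      (∃ y, Q = (Finset.range Q.card).image fun i : ℕ => y + d * (i : ℤ)) ∧
      (P.card : ℝ) ≤ ((Γ.image fun p => p.1 + p.2).card : ℝ) - (1 - 5 * Real.sqrt ε) * n ∧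
      (Q.card : ℝ) ≤ ((Γ.image fun p => p.1 + p.2).card : ℝ) - (1 - 5 * Real.sqrt ε) * n ∧
      (1 - Real.sqrt ε) * n ≤ ((A ∩ P).card : ℝ) ∧
      (1 - Real.sqrt ε) * n ≤ ((B ∩ Q).card : ℝ) := by
  classical
  set δ := Real.sqrt ε with hδ
  have hδpos : 0 < δ := Real.sqrt_pos.2 hε
  have hδsq : δ ^ 2 = ε := Real.sq_sqrt hε.le
  set S := Γ.image fun p => p.1 + p.2 with hSdef
  set θ := (Real.sqrt 5 + 1) / 2 with hθ
  have h5 : Real.sqrt 5 ^ 2 = 5 := Real.sq_sqrt (by norm_num)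
  have h50 : 0 ≤ Real.sqrt 5 := Real.sqrt_nonneg 5
  have h1 : θ ^ 2 = θ + 1 := by rw [hθ]; nlinarith
  have h2 : 1.618 < θ := by
    have : 2.236 < Real.sqrt 5 := Real.lt_sqrt_of_sq_lt (by norm_num)
    rw [hθ]; linarith
  have h3 : θ < 1.6181 := by
    have : Real.sqrt 5 < 2.2362 := (Real.sqrt_lt' (by norm_num)).2 (by norm_num)
    rw [hθ]; linarith
  have hn : (3 : ℝ) ≤ n := by exact_mod_cast hn3
  set k : ℝ := δ * n with hkdef
  have hk : 2 ≤ k := by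
    rw [div_le_iff₀ hδpos] at hnε
    rw [hkdef]; linarith
  have hkn : 4 * k ≤ n := by
    have h0 : (0 : ℝ) ≤ S.card := Nat.cast_nonneg _
    have h00 : 0 < (1 + θ - 11 * δ) * n := lt_of_le_of_lt h0 hsmall
    have := pos_of_mul_pos_left h00 (by linarith)
    rw [hkdef]; nlinarith
  obtain ⟨R, hR⟩ : ∃ R : ℤ → ℤ → Prop, ∀ a b, R a b ↔ (a, b) ∈ Γ :=
    ⟨fun a b => (a, b) ∈ Γ, fun _ _ => Iff.rfl⟩
  have hMfull : (((A ×ˢ B).filter fun p : ℤ × ℤ => ¬ R p.1 p.2).card : ℝ) ≤ k ^ 2 := by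
    have e1 : ((A ×ˢ B).filter fun p : ℤ × ℤ => ¬ R p.1 p.2) = (A ×ˢ B) \ Γ := by
      ext p; simp [hR]
    have e2 := card_sdiff_add_card_eq_card hΓsub
    rw [card_product, hA, hB] at e2
    have e2' : (((A ×ˢ B) \ Γ).card : ℝ) + Γ.card = n * n := by exact_mod_cast e2
    rw [e1, hkdef, mul_pow, hδsq]
    nlinarith
  let A' := A.filter fun a => ((B.filter fun b => ¬ R a b).card : ℝ) ≤ k
  let B' := B.filter fun b => ((A.filter fun a => ¬ R a b).card : ℝ) ≤ k
  have hA' : (n : ℝ) - k ≤ A'.card := by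
    have e := card_filter_add_card_filter_not (s := A)
      (fun a => ((B.filter fun b => ¬ R a b).card : ℝ) ≤ k)
    have f := RF.few_bad A B (fun a b => ¬ R a b) k (by linarith) hMfull
      (A.filter fun a => ¬ ((B.filter fun b => ¬ R a b).card : ℝ) ≤ k) (filter_subset _ _)
      (fun a ha => (not_le.1 (mem_filter.1 ha).2).le)
    rw [hA] at e
    have e' : (A'.card : ℝ) +
      (A.filter fun a => ¬ ((B.filter fun b => ¬ R a b).card : ℝ) ≤ k).card = n := by
      exact_mod_cast e
    linarith
  have hMfull' : (((B ×ˢ A).filter fun p : ℤ × ℤ => ¬ R p.2 p.1).card : ℝ) ≤ k ^ 2 := by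
    refine le_trans ?_ hMfull
    norm_cast
    apply card_le_card_of_injOn Prod.swap
    · intro p hp
      have hp := mem_filter.1 (mem_coe.1 hp)
      have hp1 := mem_product.1 hp.1
      exact mem_coe.2 (mem_filter.2 ⟨mem_product.2 ⟨hp1.2, hp1.1⟩, hp.2⟩)
    · exact Prod.swap_injective.injOn
  have hB' : (n : ℝ) - k ≤ B'.card := by
    have e := card_filter_add_card_filter_not (s := B)
      (fun b => ((A.filter fun a => ¬ R a b).card : ℝ) ≤ k)
    have f := RF.few_bad B A (fun b a => ¬ R a b) k (by linarith) hMfull'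
      (B.filter fun b => ¬ ((A.filter fun a => ¬ R a b).card : ℝ) ≤ k) (filter_subset _ _)
      (fun a ha => (not_le.1 (mem_filter.1 ha).2).le)
    rw [hB] at e
    have e' : (B'.card : ℝ) +
      (B.filter fun b => ¬ ((A.filter fun a => ¬ R a b).card : ℝ) ≤ k).card = n := by
      exact_mod_cast e
    linarith
  have sA : A' ⊆ A := filter_subset _ _
  have sB : B' ⊆ B := filter_subset _ _
  obtain ⟨d, x, y, l, hd, hl, hPA, hPB⟩ := RF.normalised A' B' S R θ n k h1 h2 h3 hk hkn hA' hB'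
    (fun a _ b _ h => mem_image.2 ⟨(a, b), (hR a b).1 h, rfl⟩)
    (fun a ha => le_trans (Nat.cast_le.2 (card_le_card fun z hz =>
        mem_filter.2 ⟨sB (mem_filter.1 hz).1, (mem_filter.1 hz).2⟩))
      (mem_filter.1 ha).2)
    (fun b hb => le_trans (Nat.cast_le.2 (card_le_card fun z hz =>
        mem_filter.2 ⟨sA (mem_filter.1 hz).1, (mem_filter.1 hz).2⟩))
      (mem_filter.1 hb).2)
    (le_trans (Nat.cast_le.2 (card_le_card fun z hz => mem_filter.2
        ⟨product_subset_product sA sB (mem_filter.1 hz).1, (mem_filter.1 hz).2⟩))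
      hMfull)
    (by rw [hkdef]; linarith)
  refine ⟨(range (l + 1)).image fun i : ℕ => x + d * (i : ℤ),
    (range (l + 1)).image fun i : ℕ => y + d * (i : ℤ), d, ⟨x, ?_⟩, ⟨y, ?_⟩, ?_, ?_, ?_, ?_⟩
  · rw [RF.ap_card x d hd l]
  · rw [RF.ap_card y d hd l]
  · rw [RF.ap_card x d hd l]
    push_cast
    rw [hkdef] at hl; linarith
  · rw [RF.ap_card y d hd l]
    push_cast
    rw [hkdef] at hl; linarith
  · have : A' ⊆ A ∩ (range (l + 1)).image fun i : ℕ => x + d * (i : ℤ) := by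
      intro a ha
      obtain ⟨i, hi, e⟩ := hPA a ha
      exact mem_inter.2 ⟨sA ha, mem_image.2 ⟨i, mem_range.2 (by omega), e.symm⟩⟩
    have : (A'.card : ℝ) ≤ _ := Nat.cast_le.2 (card_le_card this)
    rw [hkdef] at hA'; linarith
  · have : B' ⊆ B ∩ (range (l + 1)).image fun i : ℕ => y + d * (i : ℤ) := by
      intro a ha
      obtain ⟨i, hi, e⟩ := hPB a ha
      exact mem_inter.2 ⟨sB ha, mem_image.2 ⟨i, mem_range.2 (by omega), e.symm⟩⟩
    have : (B'.card : ℝ) ≤ _ := Nat.cast_le.2 (card_le_card this)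
    rw [hkdef] at hB'; linarith
end

section
/- Let ε > 0. Let A ⊆ ℤ be a finite set with |A| = n ≥ max{3, 2ε^{-1/2}}, and let Γ ⊆ A × A satisfy |Γ| ≥ (1−ε)n². If |A −_Γ A| < (3 − 11ε^{1/2})n, then there exists an arithmetic progression P of integers of size at most |A −_Γ A| − (1 − 5ε^{1/2})n such that |A ∩ P| ≥ (1 − ε^{1/2})n. -/
open Finset

section helpers
open scoped Pointwise

theorem mann_atom {G : Type*} [AddCommGroup G] [Fintype G] [DecidableEq G] (A : Finset G) (hne : A ≠ univ) :
    ∃ H : Finset G, 0 ∈ H ∧ (∀ a ∈ H, ∀ b ∈ H, a - b ∈ H) ∧ H + A ≠ univ ∧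
      ∀ X : Finset G, X.Nonempty → X + A ≠ univ →
        X.card + (H + A).card ≤ (X + A).card + H.card := by
  classical
  set F : Finset (Finset G) := univ.filter (fun X => X.Nonempty ∧ X + A ≠ univ) with hF
  have memF : ∀ X, X ∈ F ↔ X.Nonempty ∧ X + A ≠ univ := by intro X; simp [hF]
  set f : Finset G → ℤ := fun X => ((X + A).card : ℤ) - X.card with hf
  have hFne : F.Nonempty := by
    refine ⟨{0}, (memF _).2 ⟨by simp, ?_⟩⟩
    rw [Finset.singleton_zero, zero_add]; exact hne
  obtain ⟨M0, hM0F, hM0⟩ := Finset.exists_min_image F f hFne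
  obtain ⟨M1, hM1', hM1⟩ := Finset.exists_min_image (F.filter (fun X => f X = f M0)) Finset.card
    ⟨M0, by simp [hM0F]⟩
  rw [Finset.mem_filter] at hM1'
  obtain ⟨hM1F, hM1f⟩ := hM1'
  have hmin : ∀ X ∈ F, f M1 ≤ f X := fun X hX => hM1f ▸ hM0 X hX
  have hmin2 : ∀ X ∈ F, f X ≤ f M1 → M1.card ≤ X.card := fun X hX h =>
    hM1 X (by rw [Finset.mem_filter]; exact ⟨hX, by have := hM0 X hX; linarith⟩)
  -- the dual fragment
  have hdual : M1.card + (M1 + A).card ≤ Fintype.card G := by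
    obtain ⟨hne1, hne2⟩ := (memF _).1 hM1F
    set Y : Finset G := (univ \ (M1 + A)).image (fun y => -y) with hY
    have hYc : Y.card = Fintype.card G - (M1 + A).card := by
      rw [hY, Finset.card_image_of_injective _ neg_injective, Finset.card_univ_sdiff]
    have hle : (M1 + A).card ≤ Fintype.card G := Finset.card_le_univ _
    have hsub : Y + A ⊆ (univ \ M1).image (fun y => -y) := by
      intro z hz
      obtain ⟨y, hy, a, ha, rfl⟩ := Finset.mem_add.1 hz
      obtain ⟨w, hw, rfl⟩ := Finset.mem_image.1 hy
      refine Finset.mem_image.2 ⟨w - a, ?_, by abel⟩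
      simp only [Finset.mem_sdiff, Finset.mem_univ, true_and] at hw ⊢
      intro h
      exact hw (Finset.mem_add.2 ⟨w - a, h, a, ha, by abel⟩)
    have hc := Finset.card_le_card hsub
    rw [Finset.card_image_of_injective _ neg_injective, Finset.card_univ_sdiff] at hc
    have hM1c : M1.card ≤ Fintype.card G := Finset.card_le_univ _
    have hM1p : 0 < M1.card := hne1.card_pos
    have hlt : (M1 + A).card < Fintype.card G :=
      lt_of_le_of_ne hle (fun h => hne2 ((Finset.card_eq_iff_eq_univ _).1 h))
    have hYF : Y ∈ F := by
      refine (memF _).2 ⟨Finset.card_pos.1 (by omega), fun h => ?_⟩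
      rw [h, Finset.card_univ] at hc
      omega
    have := hmin2 Y hYF (by simp only [hf]; omega)
    omega
  -- translates
  have htrans : ∀ g : G, ∀ X : Finset G, ((X.image (fun x => g + x)) + A).card = (X + A).card := by
    intro g X
    have : (X.image (fun x => g + x)) + A = (X + A).image (fun x => g + x) := by
      ext z; simp only [Finset.mem_add, Finset.mem_image]
      constructor
      · rintro ⟨_, ⟨x, hx, rfl⟩, a, ha, rfl⟩
        exact ⟨x + a, ⟨x, hx, a, ha, rfl⟩, by abel⟩
      · rintro ⟨_, ⟨x, hx, a, ha, rfl⟩, rfl⟩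
        exact ⟨g + x, ⟨x, hx, rfl⟩, a, ha, by abel⟩
    rw [this, Finset.card_image_of_injective _ (add_right_injective g)]
  have hinter : ∀ N : Finset G, N.card = M1.card → (N + A).card = (M1 + A).card →
      (M1 ∩ N).Nonempty → M1 = N := by
    intro N hNc hNA hI
    by_contra hMN
    have hlt : (M1 ∩ N).card < M1.card := by
      refine lt_of_le_of_ne (Finset.card_le_card Finset.inter_subset_left) (fun h => hMN ?_)
      have h1 : M1 ∩ N = M1 := Finset.eq_of_subset_of_card_le Finset.inter_subset_left h.ge
      exact Finset.eq_of_subset_of_card_le (Finset.inter_eq_left.1 h1) hNc.le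
    have hsubI : (M1 ∩ N) + A ⊆ (M1 + A) ∩ (N + A) :=
      Finset.subset_inter (Finset.add_subset_add_right Finset.inter_subset_left)
        (Finset.add_subset_add_right Finset.inter_subset_right)
    have hU : (M1 ∪ N) + A = (M1 + A) ∪ (N + A) := Finset.union_add
    have hIF : M1 ∩ N ∈ F := by
      refine (memF _).2 ⟨hI, fun h => ((memF _).1 hM1F).2 ?_⟩
      rw [h] at hsubI
      exact Finset.univ_subset_iff.1 (hsubI.trans Finset.inter_subset_left)
    have h1 : f M1 < f (M1 ∩ N) := by
      by_contra h
      have := hmin2 _ hIF (not_lt.1 h)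
      omega
    have h2 := Finset.card_union_add_card_inter (M1 + A) (N + A)
    have h3 := Finset.card_union_add_card_inter M1 N
    have h4 := Finset.card_le_card hsubI
    have hIp := hI.card_pos
    by_cases hUF : (M1 ∪ N) + A = univ
    · rw [← hU, hUF, Finset.card_univ] at h2
      simp only [hf] at h1
      omega
    · have h5 := hmin (M1 ∪ N) ((memF _).2 ⟨hI.mono (Finset.inter_subset_left.trans Finset.subset_union_left), hUF⟩)
      rw [← hU] at h2
      simp only [hf] at h1 h5
      omega
  obtain ⟨m0, hm0⟩ := ((memF _).1 hM1F).1
  set H : Finset G := M1.image (fun x => -m0 + x) with hH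
  have hHc : H.card = M1.card := Finset.card_image_of_injective _ (add_right_injective _)
  have hHA : (H + A).card = (M1 + A).card := htrans _ _
  refine ⟨H, Finset.mem_image.2 ⟨m0, hm0, by abel⟩, ?_, ?_, ?_⟩
  · intro a ha b hb
    obtain ⟨x, hx, rfl⟩ := Finset.mem_image.1 ha
    obtain ⟨y, hy, rfl⟩ := Finset.mem_image.1 hb
    have := hinter (M1.image (fun z => (m0 - y) + z))
      (Finset.card_image_of_injective _ (add_right_injective _)) (htrans _ _)
      ⟨m0, Finset.mem_inter.2 ⟨hm0, Finset.mem_image.2 ⟨y, hy, by abel⟩⟩⟩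
    have hx2 := Finset.mem_image_of_mem (fun z => (m0 - y) + z) hx
    rw [← this] at hx2
    exact Finset.mem_image.2 ⟨_, hx2, by abel⟩
  · intro h
    have h2 := ((memF _).1 hM1F).2
    rw [h, Finset.card_univ] at hHA
    exact h2 ((Finset.card_eq_iff_eq_univ _).1 hHA.symm)
  · intro X hX hXA
    have := hmin X ((memF _).2 ⟨hX, hXA⟩)
    simp only [hf] at this
    omega

theorem coset_pair {G : Type*} [AddCommGroup G] [DecidableEq G] (A H : Finset G)
    (H0 : 0 ∈ H) (Hsub : ∀ a ∈ H, ∀ b ∈ H, a - b ∈ H)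
    (a b : G) (ha : a ∈ A) (hb : b ∈ A) (hab : a - b ∉ H) :
    2 * H.card + A.card ≤ (A.filter (fun u => u - a ∈ H)).card +
      (A.filter (fun u => u - b ∈ H)).card + (A + H).card := by
  have Hneg : ∀ a ∈ H, -a ∈ H := fun a ha => by simpa using Hsub 0 H0 a ha
  have Hadd : ∀ a ∈ H, ∀ b ∈ H, a + b ∈ H := fun a ha b hb => by
    simpa using Hsub a ha _ (Hneg b hb)
  have hAsub : A ⊆ A + H := fun x hx => Finset.mem_add.2 ⟨x, hx, 0, H0, by simp⟩
  have hcos : ∀ c ∈ A, ((A + H).filter (fun u => u - c ∈ H)).card = H.card := by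
    intro c hc
    have : (A + H).filter (fun u => u - c ∈ H) = H.image (fun h => c + h) := by
      ext z
      simp only [Finset.mem_filter, Finset.mem_image]
      constructor
      · rintro ⟨_, h⟩; exact ⟨z - c, h, by abel⟩
      · rintro ⟨h, hh, rfl⟩
        exact ⟨Finset.mem_add.2 ⟨c, hc, h, hh, rfl⟩, by simpa using hh⟩
    rw [this, Finset.card_image_of_injective _ (add_right_injective c)]
  have hsplit : ∀ c, ((A + H).filter (fun u => u - c ∈ H)).card =
      (A.filter (fun u => u - c ∈ H)).card + (((A + H) \ A).filter (fun u => u - c ∈ H)).card := by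
    intro c
    rw [← Finset.card_union_of_disjoint, ← Finset.filter_union, Finset.union_sdiff_of_subset hAsub]
    exact Finset.disjoint_filter_filter Finset.disjoint_sdiff
  have hdis : Disjoint (((A + H) \ A).filter (fun u => u - a ∈ H))
      (((A + H) \ A).filter (fun u => u - b ∈ H)) := by
    rw [Finset.disjoint_left]
    intro z hz1 hz2
    have h1 := (Finset.mem_filter.1 hz1).2
    have h2 := (Finset.mem_filter.1 hz2).2
    apply hab
    have := Hsub _ h2 _ h1
    simpa using this
  have hle : (((A + H) \ A).filter (fun u => u - a ∈ H)).card +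
      (((A + H) \ A).filter (fun u => u - b ∈ H)).card ≤ ((A + H) \ A).card := by
    rw [← Finset.card_union_of_disjoint hdis]
    exact Finset.card_le_card (Finset.union_subset (Finset.filter_subset _ _) (Finset.filter_subset _ _))
  have h3 := Finset.card_sdiff_add_card_eq_card hAsub
  have h4 := hsplit a
  have h5 := hsplit b
  rw [hcos a ha] at h4
  rw [hcos b hb] at h5
  omega

theorem coset_meet {G : Type*} [AddCommGroup G] [DecidableEq G] (A H : Finset G)
    (H0 : 0 ∈ H) (Hsub : ∀ a ∈ H, ∀ b ∈ H, a - b ∈ H)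
    (a b h : G) (hh : h ∈ H)
    (hc : H.card < (A.filter (fun u => u - a ∈ H)).card + (A.filter (fun u => u - b ∈ H)).card) :
    a - b + h ∈ A - A := by
  have Hneg : ∀ a ∈ H, -a ∈ H := fun a ha => by simpa using Hsub 0 H0 a ha
  have Hadd : ∀ a ∈ H, ∀ b ∈ H, a + b ∈ H := fun a ha b hb => by
    simpa using Hsub a ha _ (Hneg b hb)
  set X := (A.filter (fun u => u - a ∈ H)).image (fun u => u - a) with hX
  set Y := (A.filter (fun u => u - b ∈ H)).image (fun u => u - b + h) with hY
  have hXc : X.card = (A.filter (fun u => u - a ∈ H)).card :=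
    Finset.card_image_of_injective _ (fun x y hxy => by simpa using hxy)
  have hYc : Y.card = (A.filter (fun u => u - b ∈ H)).card :=
    Finset.card_image_of_injective _ (fun x y hxy => by simpa using hxy)
  have hXs : X ⊆ H := by
    intro z hz
    obtain ⟨u, hu, rfl⟩ := Finset.mem_image.1 hz
    exact (Finset.mem_filter.1 hu).2
  have hYs : Y ⊆ H := by
    intro z hz
    obtain ⟨u, hu, rfl⟩ := Finset.mem_image.1 hz
    exact Hadd _ (Finset.mem_filter.1 hu).2 _ hh
  have hne : (X ∩ Y).Nonempty := by
    rw [← Finset.card_pos]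
    have h1 := Finset.card_union_add_card_inter X Y
    have h2 := Finset.card_le_card (Finset.union_subset hXs hYs)
    omega
  obtain ⟨z, hz⟩ := hne
  obtain ⟨hz1, hz2⟩ := Finset.mem_inter.1 hz
  obtain ⟨u, hu, rfl⟩ := Finset.mem_image.1 hz1
  obtain ⟨v, hv, hv2⟩ := Finset.mem_image.1 hz2
  refine Finset.mem_sub.2 ⟨u, (Finset.mem_filter.1 hu).1, v, (Finset.mem_filter.1 hv).1, ?_⟩
  have : u = v - b + h + a := by rw [hv2]; abel
  rw [this]; abel

theorem diff_periodic {G : Type*} [AddCommGroup G] [DecidableEq G] (A H : Finset G)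
    (hA0 : 0 ∈ A) (H0 : 0 ∈ H) (Hsub : ∀ a ∈ H, ∀ b ∈ H, a - b ∈ H)
    (hnot : ∃ b ∈ A, b ∉ H) (hbig : (A + H).card < A.card + H.card) :
    (A - A) + H = A - A := by
  have Hneg : ∀ a ∈ H, -a ∈ H := fun a ha => by simpa using Hsub 0 H0 a ha
  have Hadd : ∀ a ∈ H, ∀ b ∈ H, a + b ∈ H := fun a ha b hb => by
    simpa using Hsub a ha _ (Hneg b hb)
  apply Finset.Subset.antisymm
  · intro z hz
    obtain ⟨w, hw, h, hh, rfl⟩ := Finset.mem_add.1 hz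
    obtain ⟨a, ha, b, hb, rfl⟩ := Finset.mem_sub.1 hw
    by_cases hab : a - b ∈ H
    · obtain ⟨c, hc, hcH⟩ := hnot
      have hp := coset_pair A H H0 Hsub c 0 hc hA0 (by simpa using hcH)
      have hex : ∃ d, H.card < (A.filter (fun u => u - d ∈ H)).card +
          (A.filter (fun u => u - d ∈ H)).card := by
        by_contra hcon
        push Not at hcon
        have h1 := hcon c
        have h2 := hcon 0
        omega
      obtain ⟨d, hd⟩ := hex
      have := coset_meet A H H0 Hsub d d (a - b + h) (Hadd _ hab _ hh) hd
      simpa using this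
    · have hp := coset_pair A H H0 Hsub a b ha hb hab
      exact coset_meet A H H0 Hsub a b h hh (by omega)
  · intro z hz
    exact Finset.mem_add.2 ⟨z, hz, 0, H0, by simp⟩

theorem count_split {G : Type*} [DecidableEq G] (S : Finset ℤ) (f : ℤ → G) (A C : Finset G)
    (Q Z : Finset ℤ) (hQ : ∀ q ∈ Q, f q ∈ A) (hZ : ∀ z ∈ Z, f z ∈ C) (hAC : Disjoint A C) :
    (Q ∩ S).card + (Z ∩ S).card + (S.image f).card ≤ S.card + A.card + C.card := by
  have h1 : (S.image f) ⊆ (S.filter (fun s => f s ∉ A ∪ C)).image f ∪ (A ∪ C) := by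
    intro z hz
    obtain ⟨s, hs, rfl⟩ := Finset.mem_image.1 hz
    by_cases h : f s ∈ A ∪ C
    · exact Finset.mem_union_right _ h
    · exact Finset.mem_union_left _ (Finset.mem_image_of_mem _ (Finset.mem_filter.2 ⟨hs, h⟩))
  have h2 := Finset.card_le_card h1
  have h3 := Finset.card_union_le ((S.filter (fun s => f s ∉ A ∪ C)).image f) (A ∪ C)
  have h4 := Finset.card_union_le A C
  have h5 : ((S.filter (fun s => f s ∉ A ∪ C)).image f).card ≤ _ := Finset.card_image_le
  have hd1 : Disjoint (Q ∩ S) (Z ∩ S) := by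
    rw [Finset.disjoint_left]
    intro z hz1 hz2
    exact Finset.disjoint_left.1 hAC (hQ z (Finset.mem_inter.1 hz1).1) (hZ z (Finset.mem_inter.1 hz2).1)
  have hd2 : Disjoint ((Q ∩ S) ∪ (Z ∩ S)) (S.filter (fun s => f s ∉ A ∪ C)) := by
    rw [Finset.disjoint_left]
    intro z hz1 hz2
    have h := (Finset.mem_filter.1 hz2).2
    rcases Finset.mem_union.1 hz1 with hz | hz
    · exact h (Finset.mem_union_left _ (hQ z (Finset.mem_inter.1 hz).1))
    · exact h (Finset.mem_union_right _ (hZ z (Finset.mem_inter.1 hz).1))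
  have h6 : ((Q ∩ S) ∪ (Z ∩ S)) ∪ (S.filter (fun s => f s ∉ A ∪ C)) ⊆ S :=
    Finset.union_subset (Finset.union_subset Finset.inter_subset_right Finset.inter_subset_right)
      (Finset.filter_subset _ _)
  have h7 := Finset.card_le_card h6
  rw [Finset.card_union_of_disjoint hd2, Finset.card_union_of_disjoint hd1] at h7
  omega

theorem loss_col (B S : Finset ℤ) (M : Finset (ℤ × ℤ))
    (hS : ∀ a ∈ B, ∀ b ∈ B, (a, b) ∉ M → a - b ∈ S) (v : ℤ) (hv : v ∈ B) :
    ((B.image (fun u => u - v)) \ S).card ≤ (M.filter (fun p => p.2 = v)).card := by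
  refine le_trans (Finset.card_le_card ?_)
    (Finset.card_image_le (s := M.filter (fun p => p.2 = v)) (f := fun p => p.1 - p.2))
  intro z hz
  obtain ⟨hz1, hz2⟩ := Finset.mem_sdiff.1 hz
  obtain ⟨u, hu, rfl⟩ := Finset.mem_image.1 hz1
  refine Finset.mem_image.2 ⟨(u, v), Finset.mem_filter.2 ⟨?_, rfl⟩, rfl⟩
  by_contra h
  exact hz2 (hS u hu v hv h)

theorem loss_row (B S : Finset ℤ) (M : Finset (ℤ × ℤ))
    (hS : ∀ a ∈ B, ∀ b ∈ B, (a, b) ∉ M → a - b ∈ S) (v : ℤ) (hv : v ∈ B) :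
    ((B.image (fun u => v - u)) \ S).card ≤ (M.filter (fun p => p.1 = v)).card := by
  refine le_trans (Finset.card_le_card ?_)
    (Finset.card_image_le (s := M.filter (fun p => p.1 = v)) (f := fun p => p.1 - p.2))
  intro z hz
  obtain ⟨hz1, hz2⟩ := Finset.mem_sdiff.1 hz
  obtain ⟨u, hu, rfl⟩ := Finset.mem_image.1 hz1
  refine Finset.mem_image.2 ⟨(v, u), Finset.mem_filter.2 ⟨?_, rfl⟩, rfl⟩
  by_contra h
  exact hz2 (hS v hv u hu h)

/-- If an unrestricted residue difference is missed and unpopular, the image of `S` is large. -/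
theorem unpopular_col {G : Type*} [AddCommGroup G] [DecidableEq G] (π : ℤ →+ G)
    (B S : Finset ℤ) (M : Finset (ℤ × ℤ))
    (hS : ∀ a ∈ B, ∀ b ∈ B, (a, b) ∉ M → a - b ∈ S) (a b : ℤ) (ha : a ∈ B) (hb : b ∈ B) :
    2 * (B.image π).card ≤ (S.image π).card +
      ((B ×ˢ B).filter (fun p => π p.1 - π p.2 = π a - π b)).card +
      (M.filter (fun p => p.2 = a)).card + (M.filter (fun p => p.2 = b)).card := by
  set A := B.image π with hA
  set X := A.image (fun u => u - π a) with hX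
  set Y := A.image (fun u => u - π b) with hY
  have hXc : X.card = A.card :=
    Finset.card_image_of_injective _ (fun x y hxy => by simpa using hxy)
  have hYc : Y.card = A.card :=
    Finset.card_image_of_injective _ (fun x y hxy => by simpa using hxy)
  have key : ∀ c ∈ B, (A.image (fun u => u - π c) \ (S.image π)).card ≤
      (M.filter (fun p => p.2 = c)).card := by
    intro c hc
    refine le_trans ?_ (loss_col B S M hS c hc)
    refine le_trans (Finset.card_le_card ?_) (Finset.card_image_le (f := π))
    intro z hz
    obtain ⟨hz1, hz2⟩ := Finset.mem_sdiff.1 hz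
    obtain ⟨u, hu, rfl⟩ := Finset.mem_image.1 hz1
    obtain ⟨w, hw, rfl⟩ := Finset.mem_image.1 hu
    refine Finset.mem_image.2 ⟨w - c, Finset.mem_sdiff.2 ⟨Finset.mem_image_of_mem _ hw, ?_⟩, by simp⟩
    intro h
    exact hz2 (Finset.mem_image.2 ⟨_, h, by simp⟩)
  have hI : (X ∩ Y).card ≤ ((B ×ˢ B).filter (fun p => π p.1 - π p.2 = π a - π b)).card := by
    refine le_trans (Finset.card_le_card ?_) (Finset.card_image_le (f := fun p => π p.1 - π a))
    intro z hz
    obtain ⟨hz1, hz2⟩ := Finset.mem_inter.1 hz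
    obtain ⟨u', hu', rfl⟩ := Finset.mem_image.1 hz1
    obtain ⟨u, hu, rfl⟩ := Finset.mem_image.1 hu'
    obtain ⟨w', hw', h⟩ := Finset.mem_image.1 hz2
    obtain ⟨w, hw, rfl⟩ := Finset.mem_image.1 hw'
    refine Finset.mem_image.2 ⟨(u, w), Finset.mem_filter.2
      ⟨Finset.mem_product.2 ⟨hu, hw⟩, ?_⟩, rfl⟩
    simp only at h ⊢
    have : π u = π w - π b + π a := by rw [h]; abel
    rw [this]; abel
  have h1 := Finset.card_union_add_card_inter X Y
  have h2 : X ∪ Y ⊆ (S.image π) ∪ ((X \ (S.image π)) ∪ (Y \ (S.image π))) := by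
    intro z hz
    by_cases h : z ∈ S.image π
    · exact Finset.mem_union_left _ h
    · refine Finset.mem_union_right _ ?_
      rw [← Finset.union_sdiff_distrib]
      exact Finset.mem_sdiff.2 ⟨hz, h⟩
  have h3 := Finset.card_le_card h2
  have h4 := Finset.card_union_le (S.image π) ((X \ (S.image π)) ∪ (Y \ (S.image π)))
  have h5 := Finset.card_union_le (X \ (S.image π)) (Y \ (S.image π))
  have h6 : (X \ (S.image π)).card ≤ _ := key a ha
  have h7 : (Y \ (S.image π)).card ≤ _ := key b hb
  omega

theorem unpopular_row {G : Type*} [AddCommGroup G] [DecidableEq G] (π : ℤ →+ G)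
    (B S : Finset ℤ) (M : Finset (ℤ × ℤ))
    (hS : ∀ a ∈ B, ∀ b ∈ B, (a, b) ∉ M → a - b ∈ S) (a b : ℤ) (ha : a ∈ B) (hb : b ∈ B) :
    2 * (B.image π).card ≤ (S.image π).card +
      ((B ×ˢ B).filter (fun p => π p.1 - π p.2 = π a - π b)).card +
      (M.filter (fun p => p.1 = a)).card + (M.filter (fun p => p.1 = b)).card := by
  set A := B.image π with hA
  set X := A.image (fun u => π a - u) with hX
  set Y := A.image (fun u => π b - u) with hY
  have hXc : X.card = A.card :=
    Finset.card_image_of_injective _ (fun x y hxy => by simpa using hxy)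
  have hYc : Y.card = A.card :=
    Finset.card_image_of_injective _ (fun x y hxy => by simpa using hxy)
  have key : ∀ c ∈ B, (A.image (fun u => π c - u) \ (S.image π)).card ≤
      (M.filter (fun p => p.1 = c)).card := by
    intro c hc
    refine le_trans ?_ (loss_row B S M hS c hc)
    refine le_trans (Finset.card_le_card ?_) (Finset.card_image_le (f := π))
    intro z hz
    obtain ⟨hz1, hz2⟩ := Finset.mem_sdiff.1 hz
    obtain ⟨u, hu, rfl⟩ := Finset.mem_image.1 hz1
    obtain ⟨w, hw, rfl⟩ := Finset.mem_image.1 hu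
    refine Finset.mem_image.2 ⟨c - w, Finset.mem_sdiff.2 ⟨Finset.mem_image_of_mem _ hw, ?_⟩, by simp⟩
    intro h
    exact hz2 (Finset.mem_image.2 ⟨_, h, by simp⟩)
  have hI : (X ∩ Y).card ≤ ((B ×ˢ B).filter (fun p => π p.1 - π p.2 = π a - π b)).card := by
    refine le_trans (Finset.card_le_card ?_) (Finset.card_image_le (f := fun p => π a - π p.1))
    intro z hz
    obtain ⟨hz1, hz2⟩ := Finset.mem_inter.1 hz
    obtain ⟨u', hu', rfl⟩ := Finset.mem_image.1 hz1
    obtain ⟨u, hu, rfl⟩ := Finset.mem_image.1 hu'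
    obtain ⟨w', hw', h⟩ := Finset.mem_image.1 hz2
    obtain ⟨w, hw, rfl⟩ := Finset.mem_image.1 hw'
    refine Finset.mem_image.2 ⟨(u, w), Finset.mem_filter.2
      ⟨Finset.mem_product.2 ⟨hu, hw⟩, ?_⟩, rfl⟩
    simp only at h ⊢
    have : π a = π b - π w + π u := by rw [h]; abel
    rw [this]; abel
  have h1 := Finset.card_union_add_card_inter X Y
  have h2 : X ∪ Y ⊆ (S.image π) ∪ ((X \ (S.image π)) ∪ (Y \ (S.image π))) := by
    intro z hz
    by_cases h : z ∈ S.image π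
    · exact Finset.mem_union_left _ h
    · refine Finset.mem_union_right _ ?_
      rw [← Finset.union_sdiff_distrib]
      exact Finset.mem_sdiff.2 ⟨hz, h⟩
  have h3 := Finset.card_le_card h2
  have h4 := Finset.card_union_le (S.image π) ((X \ (S.image π)) ∪ (Y \ (S.image π)))
  have h5 := Finset.card_union_le (X \ (S.image π)) (Y \ (S.image π))
  have h6 : (X \ (S.image π)).card ≤ _ := key a ha
  have h7 : (Y \ (S.image π)).card ≤ _ := key b hb
  omega

/-- Integer lower bound for a restricted difference set of two subsets. -/
theorem two_sets (B S : Finset ℤ) (M : Finset (ℤ × ℤ)) (K : ℝ)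
    (hS : ∀ a ∈ B, ∀ b ∈ B, (a, b) ∉ M → a - b ∈ S)
    (hreg : ∀ b ∈ B, ((M.filter (fun p => p.1 = b)).card : ℝ) +
      ((M.filter (fun p => p.2 = b)).card : ℝ) ≤ 2 * K)
    (U V : Finset ℤ) (hU : U ⊆ B) (hV : V ⊆ B) (hUne : U.Nonempty) (hVne : V.Nonempty) :
    ∃ Z : Finset ℤ, (∀ z ∈ Z, ∃ u ∈ U, ∃ v ∈ V, z = u - v) ∧
      (U.card : ℝ) + V.card - 1 - 4 * K ≤ ((Z ∩ S).card : ℝ) := by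
  set u1 := U.max' hUne with hu1
  set v0 := V.max' hVne with hv0
  have hu1m : u1 ∈ U := Finset.max'_mem _ _
  have hv0m : v0 ∈ V := Finset.max'_mem _ _
  set X := U.image (fun u => u - v0) with hX
  set Y := V.image (fun v => u1 - v) with hY
  have hXc : X.card = U.card :=
    Finset.card_image_of_injective _ (fun x y hxy => by simpa using hxy)
  have hYc : Y.card = V.card :=
    Finset.card_image_of_injective _ (fun x y hxy => by simpa using hxy)
  refine ⟨X ∪ Y, ?_, ?_⟩
  · intro z hz
    rcases Finset.mem_union.1 hz with h | h
    · obtain ⟨u, hu, rfl⟩ := Finset.mem_image.1 h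
      exact ⟨u, hu, v0, hv0m, rfl⟩
    · obtain ⟨v, hv, rfl⟩ := Finset.mem_image.1 h
      exact ⟨u1, hu1m, v, hv, rfl⟩
  · have hI : (X ∩ Y).card ≤ 1 := by
      rw [← Finset.card_singleton (u1 - v0)]
      apply Finset.card_le_card
      intro z hz
      obtain ⟨hz1, hz2⟩ := Finset.mem_inter.1 hz
      obtain ⟨u, hu, rfl⟩ := Finset.mem_image.1 hz1
      obtain ⟨v, hv, h⟩ := Finset.mem_image.1 hz2
      have e1 : u ≤ u1 := Finset.le_max' U u hu
      have e2 : v ≤ v0 := Finset.le_max' V v hv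
      have e3 : u1 - v = u - v0 := h
      rw [Finset.mem_singleton]
      omega
    have h1 := Finset.card_union_add_card_inter X Y
    have hXS : (X \ S).card ≤ (M.filter (fun p => p.2 = v0)).card :=
      le_trans (Finset.card_le_card (Finset.sdiff_subset_sdiff (Finset.image_subset_image hU) (Finset.Subset.refl _)))
        (loss_col B S M hS v0 (hV hv0m))
    have hYS : (Y \ S).card ≤ (M.filter (fun p => p.1 = u1)).card :=
      le_trans (Finset.card_le_card (Finset.sdiff_subset_sdiff (Finset.image_subset_image hV) (Finset.Subset.refl _)))
        (loss_row B S M hS u1 (hU hu1m))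
    have h2 := Finset.card_inter_add_card_sdiff (X ∪ Y) S
    rw [Finset.union_sdiff_distrib] at h2
    have h3 := Finset.card_union_le (X \ S) (Y \ S)
    have h4 := hreg v0 (hV hv0m)
    have h5 := hreg u1 (hU hu1m)
    have h6 : U.card + V.card ≤ ((X ∪ Y) ∩ S).card + 1 +
      ((M.filter (fun p => p.2 = v0)).card + (M.filter (fun p => p.1 = u1)).card) := by omega
    have h7 : (U.card : ℝ) + V.card ≤ ((X ∪ Y) ∩ S).card + 1 +
      ((M.filter (fun p => p.2 = v0)).card + (M.filter (fun p => p.1 = u1)).card) := by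
      exact_mod_cast h6
    have h8 : (0 : ℝ) ≤ (M.filter (fun p => p.1 = v0)).card := by positivity
    have h9 : (0 : ℝ) ≤ (M.filter (fun p => p.2 = u1)).card := by positivity
    linarith

theorem core_col (l : ℕ) [NeZero l] (B S : Finset ℤ) (M : Finset (ℤ × ℤ)) (K : ℝ) (hK : 0 < K)
    (hB0 : 0 ∈ B) (hBl : (l : ℤ) ∈ B) (hB : ∀ b ∈ B, 0 ≤ b ∧ b ≤ l)
    (hgen : ∀ T : AddSubgroup ℤ, (∀ b ∈ B, b ∈ T) → (1 : ℤ) ∈ T)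
    (hM : (M.card : ℝ) ≤ K ^ 2)
    (hS : ∀ a ∈ B, ∀ b ∈ B, (a, b) ∉ M → a - b ∈ S)
    (hreg : ∀ b ∈ B, ((M.filter (fun p => p.1 = b)).card : ℝ) +
      ((M.filter (fun p => p.2 = b)).card : ℝ) ≤ 2 * K)
    (hcol : ((M.filter (fun p => p.2 = 0)).card : ℝ) +
      ((M.filter (fun p => p.2 = (l : ℤ))).card : ℝ) ≤ 2 * K) :
    (l : ℝ) + B.card - 5 / 2 * K ≤ S.card ∨ 3 * ((B.card : ℝ) - 1) - 13 / 2 * K ≤ S.card := by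
  classical
  have hl0 : 0 < l := Nat.pos_of_ne_zero (NeZero.ne l)
  set π : ℤ →+ ZMod l := Int.castAddHom (ZMod l) with hπ
  have hπl : π (l : ℤ) = 0 := by simp [hπ]
  have hπinj : Set.InjOn π (B.erase (l : ℤ) : Set ℤ) := by
    intro x hx y hy hxy
    have hx' := Finset.mem_erase.1 (Finset.mem_coe.1 hx)
    have hy' := Finset.mem_erase.1 (Finset.mem_coe.1 hy)
    have hxb := hB x hx'.2
    have hyb := hB y hy'.2
    have h : (x : ZMod l) = (y : ZMod l) := by simpa [hπ] using hxy
    rw [ZMod.intCast_eq_intCast_iff] at h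
    have h2 : x % l = y % l := h
    rwa [Int.emod_eq_of_lt hxb.1 (lt_of_le_of_ne hxb.2 hx'.1),
      Int.emod_eq_of_lt hyb.1 (lt_of_le_of_ne hyb.2 hy'.1)] at h2
  set A : Finset (ZMod l) := B.image π with hA
  have hA' : A = (B.erase (l : ℤ)).image π := by
    apply Finset.Subset.antisymm
    · intro z hz
      obtain ⟨b, hb, rfl⟩ := Finset.mem_image.1 hz
      by_cases h : b = l
      · refine Finset.mem_image.2 ⟨0, Finset.mem_erase.2 ⟨by omega, hB0⟩, ?_⟩
        rw [h, hπl, map_zero]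
      · exact Finset.mem_image_of_mem _ (Finset.mem_erase.2 ⟨h, hb⟩)
    · exact Finset.image_subset_image (Finset.erase_subset _ _)
  have hAc : A.card + 1 = B.card := by
    rw [hA', Finset.card_image_of_injOn hπinj, Finset.card_erase_add_one hBl]
  have hA0 : (0 : ZMod l) ∈ A := Finset.mem_image.2 ⟨0, hB0, map_zero _⟩
  have hAcR : (B.card : ℝ) = A.card + 1 := by exact_mod_cast hAc.symm
  set St := S.image π with hSt
  -- the doubled residues
  set Q : Finset ℤ := B.image (fun u => u - 0) ∪ B.image (fun u => u - (l : ℤ)) with hQ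
  have hQA : ∀ q ∈ Q, π q ∈ A := by
    intro q hq
    rcases Finset.mem_union.1 hq with h | h
    · obtain ⟨u, hu, rfl⟩ := Finset.mem_image.1 h
      rw [sub_zero]; exact Finset.mem_image_of_mem π hu
    · obtain ⟨u, hu, rfl⟩ := Finset.mem_image.1 h
      rw [map_sub, hπl, sub_zero]; exact Finset.mem_image_of_mem π hu
  have hQS : 2 * (A.card : ℝ) + 1 - 2 * K ≤ ((Q ∩ S).card : ℝ) := by
    have h1 := Finset.card_union_add_card_inter (B.image (fun u => u - 0)) (B.image (fun u => u - (l : ℤ)))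
    have c1 : (B.image (fun u => u - 0)).card = B.card :=
      Finset.card_image_of_injective _ (fun x y hxy => by simpa using hxy)
    have c2 : (B.image (fun u => u - (l : ℤ))).card = B.card :=
      Finset.card_image_of_injective _ (fun x y hxy => by simpa using hxy)
    have hI : (B.image (fun u => u - 0) ∩ B.image (fun u => u - (l : ℤ))).card ≤ 1 := by
      rw [← Finset.card_singleton (0 : ℤ)]
      apply Finset.card_le_card
      intro z hz
      obtain ⟨hz1, hz2⟩ := Finset.mem_inter.1 hz
      obtain ⟨u, hu, rfl⟩ := Finset.mem_image.1 hz1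
      obtain ⟨v, hv, h⟩ := Finset.mem_image.1 hz2
      have e1 := hB u hu
      have e2 := hB v hv
      rw [Finset.mem_singleton]
      omega
    have h2 := Finset.card_inter_add_card_sdiff Q S
    have h2' : (Q \ S).card ≤ (B.image (fun u => u - 0) \ S).card +
        (B.image (fun u => u - (l : ℤ)) \ S).card := by
      rw [hQ, Finset.union_sdiff_distrib]; exact Finset.card_union_le _ _
    have h3 := loss_col B S M hS 0 hB0
    have h4 := loss_col B S M hS l hBl
    have h6 : 2 * A.card + 1 ≤ (Q ∩ S).card + ((M.filter (fun p => p.2 = 0)).card +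
      (M.filter (fun p => p.2 = (l : ℤ))).card) := by
      rw [← hQ] at h1
      omega
    have h7 : 2 * (A.card : ℝ) + 1 ≤ (Q ∩ S).card + ((M.filter (fun p => p.2 = 0)).card +
      (M.filter (fun p => p.2 = (l : ℤ))).card) := by exact_mod_cast h6
    linarith
  have hD : (St.card : ℝ) + A.card + 1 - 2 * K ≤ S.card := by
    have h := count_split S π A ∅ Q ∅ hQA (by simp) (by simp)
    have h' : ((Q ∩ S).card : ℝ) + St.card ≤ S.card + A.card := by
      have : (Q ∩ S).card + St.card ≤ S.card + A.card := by simpa using h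
      exact_mod_cast this
    linarith
  by_contra hcon
  push Not at hcon
  obtain ⟨hcon1, hcon2⟩ := hcon
  -- popularity
  have hpop : ∀ x ∈ (A - A) \ St, 2 * K ≤ (((B ×ˢ B).filter (fun p => π p.1 - π p.2 = x)).card : ℝ) := by
    intro x hx
    by_contra hlt
    push Not at hlt
    obtain ⟨hx1, hx2⟩ := Finset.mem_sdiff.1 hx
    obtain ⟨a', ha', b', hb', rfl⟩ := Finset.mem_sub.1 hx1
    obtain ⟨a, ha, rfl⟩ := Finset.mem_image.1 ha'
    obtain ⟨b, hb, rfl⟩ := Finset.mem_image.1 hb'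
    have h1 := unpopular_col π B S M hS a b ha hb
    have h2 := unpopular_row π B S M hS a b ha hb
    rw [← hA, ← hSt] at h1 h2
    have h1' : 2 * (A.card : ℝ) ≤ St.card +
      ((B ×ˢ B).filter (fun p => π p.1 - π p.2 = π a - π b)).card +
      (M.filter (fun p => p.2 = a)).card + (M.filter (fun p => p.2 = b)).card := by exact_mod_cast h1
    have h2' : 2 * (A.card : ℝ) ≤ St.card +
      ((B ×ˢ B).filter (fun p => π p.1 - π p.2 = π a - π b)).card +
      (M.filter (fun p => p.1 = a)).card + (M.filter (fun p => p.1 = b)).card := by exact_mod_cast h2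
    have h3 := hreg a ha
    have h4 := hreg b hb
    linarith
  have hbad : ((((A - A) \ St).card : ℕ) : ℝ) ≤ K / 2 := by
    have h1 : ((B ×ˢ B).filter (fun p => π p.1 - π p.2 ∈ (A - A) \ St)).card ≤ M.card := by
      apply Finset.card_le_card
      intro p hp
      obtain ⟨hp1, hp2⟩ := Finset.mem_filter.1 hp
      by_contra hpM
      obtain ⟨ha, hb⟩ := Finset.mem_product.1 hp1
      have := hS p.1 ha p.2 hb hpM
      exact (Finset.mem_sdiff.1 hp2).2 (Finset.mem_image.2 ⟨_, this, by simp⟩)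
    have h2 : ((B ×ˢ B).filter (fun p => π p.1 - π p.2 ∈ (A - A) \ St)).card =
        ∑ x ∈ (A - A) \ St, ((B ×ˢ B).filter (fun p => π p.1 - π p.2 = x)).card := by
      rw [Finset.card_eq_sum_card_fiberwise (f := fun p => π p.1 - π p.2) (t := (A - A) \ St)]
      · apply Finset.sum_congr rfl
        intro x hx
        congr 1
        ext p
        simp only [Finset.mem_filter]
        constructor
        · rintro ⟨⟨h, _⟩, h'⟩; exact ⟨h, h'⟩
        · rintro ⟨h, h'⟩; exact ⟨⟨h, h' ▸ hx⟩, h'⟩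
      · intro p hp
        exact (Finset.mem_filter.1 (Finset.mem_coe.1 hp)).2
    have h3 := Finset.card_nsmul_le_sum ((A - A) \ St)
      (fun x => (((B ×ˢ B).filter (fun p => π p.1 - π p.2 = x)).card : ℝ)) (2 * K) hpop
    rw [← Nat.cast_sum, ← h2, nsmul_eq_mul] at h3
    have h4 : (((B ×ˢ B).filter (fun p => π p.1 - π p.2 ∈ (A - A) \ St)).card : ℝ) ≤ M.card := by
      exact_mod_cast h1
    have h5 : (((A - A) \ St).card : ℝ) * (2 * K) ≤ K ^ 2 := by linarith
    have h6 : (2 * K) * ((((A - A) \ St).card : ℝ) - K / 2) ≤ 0 := by nlinarith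
    by_contra h
    push Not at h
    have := mul_pos (show (0:ℝ) < 2 * K by linarith) (sub_pos.2 h)
    linarith
  have hSA : ((A - A).card : ℝ) - K / 2 ≤ St.card := by
    have h1 := Finset.card_le_card (Finset.subset_union_left (s₁ := A - A) (s₂ := St))
    rw [← Finset.sdiff_union_self_eq_union] at h1
    have h2 := Finset.card_union_le ((A - A) \ St) St
    have h3 : ((A - A).card : ℝ) ≤ ((A - A) \ St).card + St.card := by exact_mod_cast h1.trans h2
    linarith
  have hAAne : A - A ≠ univ := by
    intro h
    rw [h, Finset.card_univ, ZMod.card] at hSA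
    linarith
  have hAne : A ≠ univ := by
    intro h
    apply hAAne
    rw [Finset.eq_univ_iff_forall]
    intro x
    exact Finset.mem_sub.2 ⟨x, by rw [h]; exact Finset.mem_univ _, 0, hA0, by simp⟩
  obtain ⟨H, H0, Hsub, hHA, hmann⟩ := mann_atom A hAne
  have hmann1 := hmann (-A) ⟨-0, Finset.neg_mem_neg hA0⟩ (by rw [neg_add_eq_sub]; exact hAAne)
  rw [neg_add_eq_sub, Finset.card_neg, add_comm H A] at hmann1
  have hmann1' : (A.card : ℝ) + (A + H).card ≤ (A - A).card + H.card := by exact_mod_cast hmann1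
  have hbigR : ((A + H).card : ℝ) < A.card + H.card := by linarith
  have hbig : (A + H).card < A.card + H.card := by exact_mod_cast hbigR
  have Hneg : ∀ a ∈ H, -a ∈ H := fun a ha => by simpa using Hsub 0 H0 a ha
  have Hadd : ∀ a ∈ H, ∀ b ∈ H, a + b ∈ H := fun a ha b hb => by
    simpa using Hsub a ha _ (Hneg b hb)
  have hnot : ∃ b ∈ A, b ∉ H := by
    by_contra hc
    push Not at hc
    let T0 : AddSubgroup (ZMod l) :=
      { carrier := H
        zero_mem' := H0
        add_mem' := fun {a b} ha hb => Hadd a ha b hb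
        neg_mem' := fun {a} ha => Hneg a ha }
    have h1 := hgen (T0.comap π) (fun b hb => by
      rw [AddSubgroup.mem_comap]; exact hc _ (Finset.mem_image_of_mem π hb))
    rw [AddSubgroup.mem_comap] at h1
    apply hHA
    rw [Finset.eq_univ_iff_forall]
    intro x
    obtain ⟨z, rfl⟩ := ZMod.intCast_surjective x
    have h2 : π z ∈ T0 := by
      have := T0.zsmul_mem h1 z
      rw [← map_zsmul] at this
      simpa using this
    exact Finset.mem_add.2 ⟨π z, h2, 0, hA0, by simp [hπ]⟩
  have hper := diff_periodic A H hA0 H0 Hsub hnot hbig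
  have heq : -A + H + A = A - A := by rw [add_right_comm, neg_add_eq_sub A A, hper]
  have hmann2 := hmann (-A + H) ⟨-0 + 0, Finset.add_mem_add (Finset.neg_mem_neg hA0) H0⟩ (by
    rw [heq]; exact hAAne)
  rw [heq, add_comm H A] at hmann2
  have hcardneg : (-A + H).card = (A + H).card := by
    have : -A + H = -(A + H) := by
      ext z
      simp only [Finset.mem_neg, Finset.mem_add]
      constructor
      · rintro ⟨_, ⟨a, ha, rfl⟩, h, hh, rfl⟩
        exact ⟨a + -h, ⟨a, ha, -h, Hneg h hh, rfl⟩, by abel⟩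
      · rintro ⟨_, ⟨a, ha, h, hh, rfl⟩, rfl⟩
        exact ⟨-a, ⟨a, ha, rfl⟩, -h, Hneg h hh, by abel⟩
    rw [this, Finset.card_neg]
  rw [hcardneg] at hmann2
  have hAsub : A ⊆ A + H := fun x hx => Finset.mem_add.2 ⟨x, hx, 0, H0, by simp⟩
  have hHsub : H ⊆ A + H := fun x hx => Finset.mem_add.2 ⟨0, hA0, x, hx, by simp⟩
  have hHlt : H.card < (A + H).card := by
    obtain ⟨b, hb, hbH⟩ := hnot
    exact Finset.card_lt_card (Finset.ssubset_iff_of_subset hHsub |>.2 ⟨b, hAsub hb, hbH⟩)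
  have hnew : ∃ y ∈ A - A, y ∉ A + H := by
    by_contra hc
    push Not at hc
    have := Finset.card_le_card (show A - A ⊆ A + H from hc)
    omega
  obtain ⟨y, hy, hyn⟩ := hnew
  obtain ⟨a, ha, b, hb, rfl⟩ := Finset.mem_sub.1 hy
  have hpair := coset_pair A H H0 Hsub a b ha hb (fun h => hyn (hHsub h))
  have hlift : ∀ c ∈ A, ∃ U : Finset ℤ, U ⊆ B ∧ U.Nonempty ∧ (∀ u ∈ U, π u - c ∈ H) ∧
      U.card = (A.filter (fun u => u - c ∈ H)).card := by
    intro c hc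
    refine ⟨(B.erase (l : ℤ)).filter (fun u => π u - c ∈ H),
      (Finset.filter_subset _ _).trans (Finset.erase_subset _ _), ?_,
      fun u hu => (Finset.mem_filter.1 hu).2, ?_⟩
    · rw [hA'] at hc
      obtain ⟨u, hu, rfl⟩ := Finset.mem_image.1 hc
      exact ⟨u, Finset.mem_filter.2 ⟨hu, by simpa using H0⟩⟩
    · rw [hA', Finset.filter_image, Finset.card_image_of_injOn]
      exact hπinj.mono (by
        intro z hz
        exact Finset.mem_coe.2 (Finset.filter_subset _ _ (Finset.mem_coe.1 hz)))
  obtain ⟨U, hUB, hUne, hUH, hUc⟩ := hlift a ha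
  obtain ⟨V, hVB, hVne, hVH, hVc⟩ := hlift b hb
  obtain ⟨Z, hZ, hZc⟩ := two_sets B S M K hS hreg U V hUB hVB hUne hVne
  set C := H.image (fun h => (a - b) + h) with hC
  have hCc : C.card = H.card := Finset.card_image_of_injective _ (add_right_injective _)
  have hAC : Disjoint A C := by
    rw [Finset.disjoint_left]
    intro z hz1 hz2
    obtain ⟨h, hh, rfl⟩ := Finset.mem_image.1 hz2
    exact hyn (Finset.mem_add.2 ⟨_, hz1, -h, Hneg h hh, by abel⟩)
  have hZC : ∀ z ∈ Z, π z ∈ C := by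
    intro z hz
    obtain ⟨u, hu, v, hv, rfl⟩ := hZ z hz
    refine Finset.mem_image.2 ⟨(π u - a) - (π v - b), Hsub _ (hUH u hu) _ (hVH v hv), ?_⟩
    rw [map_sub]; abel
  have hfin := count_split S π A C Q Z hQA hZC hAC
  rw [← hSt, hCc] at hfin
  rw [← hUc, ← hVc] at hpair
  have hfinR : ((Q ∩ S).card : ℝ) + (Z ∩ S).card + St.card ≤ S.card + A.card + H.card := by
    exact_mod_cast hfin
  have hpairR : 2 * (H.card : ℝ) + A.card ≤ U.card + V.card + (A + H).card := by
    exact_mod_cast hpair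
  have hmann2R : ((A + H).card : ℝ) + (A + H).card ≤ (A - A).card + H.card := by
    exact_mod_cast hmann2
  have hAleR : (A.card : ℝ) ≤ (A + H).card := by exact_mod_cast Finset.card_le_card hAsub
  linarith

theorem core_both (l : ℕ) [NeZero l] (B S : Finset ℤ) (M : Finset (ℤ × ℤ)) (K : ℝ) (hK : 0 < K)
    (hB0 : 0 ∈ B) (hBl : (l : ℤ) ∈ B) (hB : ∀ b ∈ B, 0 ≤ b ∧ b ≤ l)
    (hgen : ∀ T : AddSubgroup ℤ, (∀ b ∈ B, b ∈ T) → (1 : ℤ) ∈ T)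
    (hM : (M.card : ℝ) ≤ K ^ 2)
    (hS : ∀ a ∈ B, ∀ b ∈ B, (a, b) ∉ M → a - b ∈ S)
    (hreg : ∀ b ∈ B, ((M.filter (fun p => p.1 = b)).card : ℝ) +
      ((M.filter (fun p => p.2 = b)).card : ℝ) ≤ 2 * K) :
    (l : ℝ) + B.card - 5 / 2 * K ≤ S.card ∨ 3 * ((B.card : ℝ) - 1) - 13 / 2 * K ≤ S.card := by
  by_cases hcol : ((M.filter (fun p => p.2 = 0)).card : ℝ) +
      ((M.filter (fun p => p.2 = (l : ℤ))).card : ℝ) ≤ 2 * K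
  · exact core_col l B S M K hK hB0 hBl hB hgen hM hS hreg hcol
  · have f1 : ∀ b, ((M.image Prod.swap).filter (fun p => p.1 = b)).card =
        (M.filter (fun p => p.2 = b)).card := by
      intro b
      rw [Finset.filter_image, Finset.card_image_of_injective _ Prod.swap_injective]
      rfl
    have f2 : ∀ b, ((M.image Prod.swap).filter (fun p => p.2 = b)).card =
        (M.filter (fun p => p.1 = b)).card := by
      intro b
      rw [Finset.filter_image, Finset.card_image_of_injective _ Prod.swap_injective]
      rfl
    have hSc : (S.image (fun s => -s)).card = S.card :=
      Finset.card_image_of_injective _ neg_injective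
    have := core_col l B (S.image (fun s => -s)) (M.image Prod.swap) K hK hB0 hBl hB hgen
      (by rw [Finset.card_image_of_injective _ Prod.swap_injective]; exact hM)
      (by
        intro a ha b hb hab
        refine Finset.mem_image.2 ⟨b - a, hS b hb a ha (fun h => hab ?_), by ring⟩
        exact Finset.mem_image.2 ⟨(b, a), h, rfl⟩)
      (by intro b hb; rw [f1, f2]; have := hreg b hb; linarith)
      (by
        rw [f2, f2]
        have h1 := hreg 0 hB0
        have h2 := hreg l hBl
        push Not at hcol
        linarith)
    rwa [hSc] at this

theorem core_general (B S : Finset ℤ) (M : Finset (ℤ × ℤ)) (K : ℝ) (hK : 0 < K)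
    (hB2 : 2 ≤ B.card) (hMB : M ⊆ B ×ˢ B)
    (hM : (M.card : ℝ) ≤ K ^ 2)
    (hS : ∀ a ∈ B, ∀ b ∈ B, (a, b) ∉ M → a - b ∈ S)
    (hreg : ∀ b ∈ B, ((M.filter (fun p => p.1 = b)).card : ℝ) +
      ((M.filter (fun p => p.2 = b)).card : ℝ) ≤ 2 * K) :
    (∃ (P : Finset ℤ) (d : ℤ),
      (∃ x, P = (Finset.range P.card).image fun i : ℕ => x + d * (i : ℤ)) ∧ B ⊆ P ∧
      (P.card : ℝ) ≤ S.card - B.card + 5 / 2 * K + 1) ∨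
      3 * ((B.card : ℝ) - 1) - 13 / 2 * K ≤ S.card := by
  have hBne : B.Nonempty := Finset.card_pos.1 (by omega)
  set b0 := B.min' hBne with hb0
  set b1 := B.max' hBne with hb1
  have hb0m : b0 ∈ B := Finset.min'_mem _ _
  have hb1m : b1 ∈ B := Finset.max'_mem _ _
  have hb01 : b0 < b1 := Finset.min'_lt_max'_of_card B (by omega)
  set T := AddSubgroup.closure ((fun b => b - b0) '' (B : Set ℤ)) with hT
  have hTm : ∀ b ∈ B, b - b0 ∈ T := fun b hb => AddSubgroup.subset_closure ⟨b, hb, rfl⟩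
  obtain ⟨g, hgpos, hgT, hgdvd⟩ : ∃ g : ℤ, 0 < g ∧ g ∈ T ∧ ∀ t ∈ T, g ∣ t := by
    obtain ⟨g, hg⟩ := Int.subgroup_cyclic T
    have hmem : ∀ t, t ∈ T ↔ g ∣ t := by
      intro t
      rw [hg, ← AddSubgroup.zmultiples_eq_closure, Int.mem_zmultiples_iff]
    have hg0 : g ≠ 0 := by
      rintro rfl
      have := (hmem _).1 (hTm b1 hb1m)
      rw [zero_dvd_iff] at this
      omega
    exact ⟨|g|, abs_pos.2 hg0, (hmem _).2 ((dvd_abs _ _).2 dvd_rfl),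
      fun t ht => (abs_dvd _ _).2 ((hmem t).1 ht)⟩
  set q : ℤ → ℤ := fun b => (b - b0) / g with hq
  have hqm : ∀ b ∈ B, b - b0 = g * q b := fun b hb =>
    (Int.mul_ediv_cancel' (hgdvd _ (hTm b hb))).symm
  have hqinj : Set.InjOn q (B : Set ℤ) := by
    intro x hx y hy hxy
    have h1 := hqm x hx
    have h2 := hqm y hy
    rw [hxy] at h1
    linarith
  have hq0 : q b0 = 0 := by simp [hq]
  have hqle : ∀ b ∈ B, 0 ≤ q b ∧ q b ≤ q b1 := by
    intro b hb
    have e1 : b0 ≤ b := Finset.min'_le B b hb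
    have e2 : b ≤ b1 := Finset.le_max' B b hb
    exact ⟨Int.ediv_nonneg (by omega) hgpos.le, Int.ediv_le_ediv hgpos (by omega)⟩
  have hq1 : 0 < q b1 := by
    have h1 := hqm b1 hb1m
    by_contra h
    have : q b1 = 0 := le_antisymm (not_lt.1 h) (hqle b1 hb1m).1
    rw [this] at h1
    omega
  obtain ⟨l, hl⟩ : ∃ l : ℕ, (l : ℤ) = q b1 := ⟨(q b1).toNat, Int.toNat_of_nonneg hq1.le⟩
  have : NeZero l := ⟨by omega⟩
  set B1 := B.image q with hB1
  have hB1c : B1.card = B.card := Finset.card_image_of_injOn hqinj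
  set S1 := (S.filter (fun s => g ∣ s)).image (fun s => s / g) with hS1
  have hS1c : S1.card ≤ S.card := Finset.card_image_le.trans (Finset.card_filter_le _ _)
  set M1 := M.image (fun p => (q p.1, q p.2)) with hM1
  have hMB' : ∀ p ∈ M, p.1 ∈ B ∧ p.2 ∈ B := fun p hp => Finset.mem_product.1 (hMB hp)
  have hmain := core_both l B1 S1 M1 K hK
    (Finset.mem_image.2 ⟨b0, hb0m, hq0⟩) (Finset.mem_image.2 ⟨b1, hb1m, hl.symm⟩)
    (by
      intro z hz
      obtain ⟨b, hb, rfl⟩ := Finset.mem_image.1 hz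
      rw [hl]; exact hqle b hb)
    (by
      intro T1 hT1
      have hle : T ≤ T1.map (AddMonoidHom.mulLeft g) := by
        rw [hT, AddSubgroup.closure_le]
        rintro _ ⟨b, hb, rfl⟩
        exact ⟨q b, hT1 _ (Finset.mem_image_of_mem q hb), (hqm b hb).symm⟩
      obtain ⟨t, ht, ht2⟩ := hle hgT
      have h3 : g * t = g * 1 := by simpa using ht2
      rwa [mul_left_cancel₀ hgpos.ne' h3] at ht)
    (le_trans (by exact_mod_cast Finset.card_image_le) hM)
    (by
      intro x hx y hy hxy
      obtain ⟨a, ha, rfl⟩ := Finset.mem_image.1 hx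
      obtain ⟨b, hb, rfl⟩ := Finset.mem_image.1 hy
      have h1 := hS a ha b hb (fun h => hxy (Finset.mem_image.2 ⟨(a, b), h, rfl⟩))
      have h2 : a - b = g * (q a - q b) := by
        have := hqm a ha
        have := hqm b hb
        linarith
      refine Finset.mem_image.2 ⟨a - b, Finset.mem_filter.2 ⟨h1, ⟨_, h2⟩⟩, ?_⟩
      rw [h2, Int.mul_ediv_cancel_left _ hgpos.ne'])
    (by
      intro z hz
      obtain ⟨b, hb, rfl⟩ := Finset.mem_image.1 hz
      have c1 : (M1.filter (fun p => p.1 = q b)).card ≤ (M.filter (fun p => p.1 = b)).card := by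
        refine le_trans (Finset.card_le_card ?_)
          (Finset.card_image_le (f := fun p : ℤ × ℤ => (q p.1, q p.2)))
        intro w hw
        obtain ⟨hw1, hw2⟩ := Finset.mem_filter.1 hw
        obtain ⟨p, hp, rfl⟩ := Finset.mem_image.1 hw1
        exact Finset.mem_image.2 ⟨p, Finset.mem_filter.2 ⟨hp, hqinj (hMB' p hp).1 hb hw2⟩, rfl⟩
      have c2 : (M1.filter (fun p => p.2 = q b)).card ≤ (M.filter (fun p => p.2 = b)).card := by
        refine le_trans (Finset.card_le_card ?_)
          (Finset.card_image_le (f := fun p : ℤ × ℤ => (q p.1, q p.2)))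
        intro w hw
        obtain ⟨hw1, hw2⟩ := Finset.mem_filter.1 hw
        obtain ⟨p, hp, rfl⟩ := Finset.mem_image.1 hw1
        exact Finset.mem_image.2 ⟨p, Finset.mem_filter.2 ⟨hp, hqinj (hMB' p hp).2 hb hw2⟩, rfl⟩
      have c1' : ((M1.filter (fun p => p.1 = q b)).card : ℝ) ≤ (M.filter (fun p => p.1 = b)).card := by
        exact_mod_cast c1
      have c2' : ((M1.filter (fun p => p.2 = q b)).card : ℝ) ≤ (M.filter (fun p => p.2 = b)).card := by
        exact_mod_cast c2
      have := hreg b hb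
      linarith)
  rw [hB1c] at hmain
  have hS1R : (S1.card : ℝ) ≤ S.card := by exact_mod_cast hS1c
  rcases hmain with h | h
  · left
    have hPc : ((Finset.range (l + 1)).image fun i : ℕ => b0 + g * (i : ℤ)).card = l + 1 := by
      rw [Finset.card_image_of_injective, Finset.card_range]
      intro i j hij
      have h3 : g * (i : ℤ) = g * (j : ℤ) := by simpa using hij
      exact_mod_cast mul_left_cancel₀ hgpos.ne' h3
    refine ⟨(Finset.range (l + 1)).image fun i : ℕ => b0 + g * (i : ℤ), g, ⟨b0, by rw [hPc]⟩, ?_, ?_⟩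
    · intro b hb
      obtain ⟨h1, h2⟩ := hqle b hb
      refine Finset.mem_image.2 ⟨(q b).toNat, Finset.mem_range.2 (by omega), ?_⟩
      rw [Int.toNat_of_nonneg h1, ← hqm b hb]
      ring
    · rw [hPc]; push_cast; linarith
  · right; linarith

end helpers

/-- A robust version of Freiman's 3k-4 theorem for restricted difference sets. -/
theorem robust_freiman_diff (ε : ℝ) (hε : 0 < ε) (A : Finset ℤ) (n : ℕ)
    (hA : A.card = n) (hn3 : 3 ≤ n) (hnε : 2 / Real.sqrt ε ≤ (n : ℝ))
    (Γ : Finset (ℤ × ℤ)) (hΓsub : Γ ⊆ A ×ˢ A)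
    (hΓcard : (1 - ε) * (n : ℝ) ^ 2 ≤ (Γ.card : ℝ))
    (hsmall : ((Γ.image fun p => p.1 - p.2).card : ℝ) < (3 - 11 * Real.sqrt ε) * n) :
    ∃ (P : Finset ℤ) (d : ℤ),
      (∃ x, P = (Finset.range P.card).image fun i : ℕ => x + d * (i : ℤ)) ∧
      (P.card : ℝ) ≤ ((Γ.image fun p => p.1 - p.2).card : ℝ) - (1 - 5 * Real.sqrt ε) * n ∧
      (1 - Real.sqrt ε) * n ≤ ((A ∩ P).card : ℝ) := by
  classical
  set δ := Real.sqrt ε with hδ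
  have hδpos : 0 < δ := Real.sqrt_pos.2 hε
  have hδ2 : δ ^ 2 = ε := Real.sq_sqrt hε.le
  have hnR : (3 : ℝ) ≤ n := by exact_mod_cast hn3
  set S := Γ.image fun p => p.1 - p.2 with hS
  set K : ℝ := δ * n with hKdef
  have hK2 : 2 ≤ K := by
    rw [div_le_iff₀ hδpos] at hnε
    rw [hKdef]; linarith
  have hSnn : (0 : ℝ) ≤ S.card := Nat.cast_nonneg _
  have hsmall' : (S.card : ℝ) < 3 * n - 11 * K := by rw [hKdef]; linarith
  set M0 := (A ×ˢ A) \ Γ with hM0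
  have hM0c : (M0.card : ℝ) ≤ K ^ 2 := by
    have h1 := Finset.card_sdiff_add_card_eq_card hΓsub
    rw [Finset.card_product, hA] at h1
    have h2 : (M0.card : ℝ) + Γ.card = n * n := by exact_mod_cast h1
    have h3 : K ^ 2 = ε * n ^ 2 := by rw [hKdef, mul_pow, hδ2]
    rw [h3]; linarith
  set w : ℤ → ℝ := fun b => ((M0.filter (fun p => p.1 = b)).card : ℝ) +
      ((M0.filter (fun p => p.2 = b)).card : ℝ) with hw
  set B := A.filter (fun b => w b ≤ 2 * K) with hBdef
  have hBA : B ⊆ A := Finset.filter_subset _ _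
  have hsum : ∑ a ∈ A, w a = 2 * M0.card := by
    have h1 : M0.card = ∑ a ∈ A, (M0.filter (fun p => p.1 = a)).card :=
      Finset.card_eq_sum_card_fiberwise (f := fun p => p.1) (fun p hp =>
        (Finset.mem_product.1 (Finset.mem_sdiff.1 (Finset.mem_coe.1 hp)).1).1)
    have h2 : M0.card = ∑ a ∈ A, (M0.filter (fun p => p.2 = a)).card :=
      Finset.card_eq_sum_card_fiberwise (f := fun p => p.2) (fun p hp =>
        (Finset.mem_product.1 (Finset.mem_sdiff.1 (Finset.mem_coe.1 hp)).1).2)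
    simp only [hw]
    rw [Finset.sum_add_distrib, ← Nat.cast_sum, ← Nat.cast_sum, ← h1, ← h2]
    ring
  have hBc : (n : ℝ) - K ≤ B.card := by
    have h1 : (A.filter (fun b => ¬ w b ≤ 2 * K)).card • (2 * K) ≤
        ∑ a ∈ A.filter (fun b => ¬ w b ≤ 2 * K), w a :=
      Finset.card_nsmul_le_sum _ _ _ (fun x hx => (not_le.1 (Finset.mem_filter.1 hx).2).le)
    have h2 : ∑ a ∈ A.filter (fun b => ¬ w b ≤ 2 * K), w a ≤ ∑ a ∈ A, w a :=
      Finset.sum_le_sum_of_subset_of_nonneg (Finset.filter_subset _ _)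
        (fun i _ _ => by simp only [hw]; positivity)
    have h3 := Finset.card_filter_add_card_filter_not (s := A) (fun b => w b ≤ 2 * K)
    rw [hA] at h3
    have h4 : (B.card : ℝ) + (A.filter (fun b => ¬ w b ≤ 2 * K)).card = n := by exact_mod_cast h3
    rw [nsmul_eq_mul] at h1
    have h5 : ((A.filter (fun b => ¬ w b ≤ 2 * K)).card : ℝ) * (2 * K) ≤ K * (2 * K) := by
      nlinarith
    have h6 := le_of_mul_le_mul_right h5 (by linarith)
    linarith
  have hB2 : 2 ≤ B.card := by
    have : (1 : ℝ) < B.card := by linarith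
    have h : 1 < B.card := by exact_mod_cast this
    omega
  set M := M0 ∩ (B ×ˢ B) with hM
  have hMc : M.card ≤ M0.card := Finset.card_le_card Finset.inter_subset_left
  have hmain := core_general B S M K (by linarith) hB2 Finset.inter_subset_right
    (le_trans (by exact_mod_cast hMc) hM0c)
    (by
      intro a ha b hb hab
      refine Finset.mem_image.2 ⟨(a, b), ?_, rfl⟩
      by_contra h
      exact hab (Finset.mem_inter.2 ⟨Finset.mem_sdiff.2
        ⟨Finset.mem_product.2 ⟨hBA ha, hBA hb⟩, h⟩, Finset.mem_product.2 ⟨ha, hb⟩⟩))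
    (by
      intro b hb
      have h1 : w b ≤ 2 * K := (Finset.mem_filter.1 hb).2
      have c1 : ((M.filter (fun p => p.1 = b)).card : ℝ) ≤ (M0.filter (fun p => p.1 = b)).card := by
        exact_mod_cast Finset.card_le_card (Finset.filter_subset_filter _ Finset.inter_subset_left)
      have c2 : ((M.filter (fun p => p.2 = b)).card : ℝ) ≤ (M0.filter (fun p => p.2 = b)).card := by
        exact_mod_cast Finset.card_le_card (Finset.filter_subset_filter _ Finset.inter_subset_left)
      simp only [hw] at h1
      linarith)
  rcases hmain with ⟨P, d, hP, hBP, hPc⟩ | h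
  · refine ⟨P, d, hP, ?_, ?_⟩
    · have : (1 - 5 * δ) * n = n - 5 * K := by rw [hKdef]; ring
      rw [this]; linarith
    · have h1 : (B.card : ℝ) ≤ (A ∩ P).card := by
        exact_mod_cast Finset.card_le_card (Finset.subset_inter hBA hBP)
      have : (1 - δ) * n = n - K := by rw [hKdef]; ring
      rw [this]; linarith
  · exfalso
    linarith
end

section
/- Let ε ∈ (0, 2^{-50}). Let A ⊆ ℤ be a finite set with |A| = n ≥ ε^{-1} and C(A) ≥ 3/4 − ε. Then there exists an arithmetic progression P of integers containing 0 and symmetric about 0 (i.e. 0 ∈ P and P = −P) such that |P| ≤ (1 + 280ε^{1/4})n and |P ∩ A| ≥ (1 − 10ε^{1/4})n. -/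
open Finset

lemma delta_sq (δ : ℝ) (hδ : 0 < δ) (hδ' : δ < 1 / 4096) : δ ^ 2 ≤ δ / 4096 := by nlinarith

lemma delta_four (δ : ℝ) (hδ : 0 < δ) (hδ' : δ < 1 / 4096) : δ ^ 4 ≤ δ ^ 2 / 4096 := by
  have h1 := delta_sq δ hδ hδ'
  have h2 : δ ^ 2 * δ ^ 2 ≤ δ ^ 2 * (1 / 4096) := by
    apply mul_le_mul_of_nonneg_left _ (by positivity)
    linarith
  calc δ ^ 4 = δ ^ 2 * δ ^ 2 := by ring
    _ ≤ δ ^ 2 * (1 / 4096) := h2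
    _ = δ ^ 2 / 4096 := by ring


lemma loss_add {G : Type*} [AddCommGroup G] [DecidableEq G] (D : Finset G) (h h' : G) :
    #{x ∈ D | x + (h + h') ∉ D} ≤ #{x ∈ D | x + h ∉ D} + #{x ∈ D | x + h' ∉ D} := by
  have h1 : {x ∈ D | x + (h + h') ∉ D} ⊆
      {x ∈ D | x + h ∉ D} ∪ ({x ∈ D | x + h' ∉ D}).image (fun y => y - h) := by
    intro x hx
    simp only [mem_filter, mem_union, mem_image] at hx ⊢
    by_cases hh : x + h ∈ D
    · right
      refine ⟨x + h, ⟨hh, ?_⟩, by abel⟩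
      rw [add_assoc]; exact hx.2
    · left; exact ⟨hx.1, hh⟩
  refine (card_le_card h1).trans ((card_union_le _ _).trans ?_)
  exact Nat.add_le_add_left card_image_le _

lemma loss_neg {G : Type*} [AddCommGroup G] [DecidableEq G] (D : Finset G) (h : G) :
    #{x ∈ D | x + (-h) ∉ D} = #{x ∈ D | x + h ∉ D} := by
  have e1 := card_filter_add_card_filter_not (s := D) (fun x => x + h ∈ D)
  have e2 := card_filter_add_card_filter_not (s := D) (fun x => x + (-h) ∈ D)
  have e3 : #{x ∈ D | x + (-h) ∈ D} = #{x ∈ D | x + h ∈ D} := by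
    refine card_bij (fun x _ => x + (-h)) ?_ ?_ ?_
    · intro x hx; simp only [mem_filter] at hx ⊢; refine ⟨hx.2, by simpa using hx.1⟩
    · intro x _ y _ hxy; simpa using hxy
    · intro y hy; simp only [mem_filter] at hy
      refine ⟨y + h, ?_, by abel⟩
      simp only [mem_filter]; refine ⟨hy.2, by simpa using hy.1⟩
  omega

lemma level_card {G : Type*} [AddCommGroup G] [Fintype G] [DecidableEq G] (D : Finset G) (r : ℝ)
    (hD : 0 < (#D : ℝ)) :
    (#{h : G | (#{x ∈ D | x + h ∉ D} : ℝ) ≤ r * #D} : ℝ) * (1 - r) ≤ #D := by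
  have tot : ∑ h : G, #{x ∈ D | x + h ∈ D} = #D * #D := by
    simp_rw [card_filter]
    rw [sum_comm]
    have : ∀ x ∈ D, (∑ h : G, if x + h ∈ D then 1 else 0) = #D := by
      intro x _
      rw [← card_filter]
      refine card_bij (fun h _ => x + h) ?_ ?_ ?_
      · intro h hh; simpa using hh
      · intro a _ b _ hab; simpa using hab
      · intro y hy; exact ⟨y - x, by simpa using hy, by abel⟩
    rw [sum_congr rfl this]; simp
  have totR : ∑ h : G, (#{x ∈ D | x + h ∈ D} : ℝ) = #D * #D := by exact_mod_cast tot
  set E : Finset G := {h : G | (#{x ∈ D | x + h ∉ D} : ℝ) ≤ r * #D} with hE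
  have h1 : ∑ h ∈ E, ((1 - r) * #D : ℝ) ≤ ∑ h ∈ E, (#{x ∈ D | x + h ∈ D} : ℝ) := by
    apply sum_le_sum
    intro h hh
    have e1 := card_filter_add_card_filter_not (s := D) (fun x => x + h ∈ D)
    have e2 : (#{x ∈ D | x + h ∈ D} : ℝ) + #{x ∈ D | x + h ∉ D} = #D := by exact_mod_cast e1
    simp only [hE, mem_filter, mem_univ, true_and] at hh
    linarith
  have h2 : ∑ h ∈ E, (#{x ∈ D | x + h ∈ D} : ℝ) ≤ ∑ h : G, (#{x ∈ D | x + h ∈ D} : ℝ) :=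
    sum_le_sum_of_subset_of_nonneg (subset_univ _) (fun _ _ _ => by positivity)
  rw [sum_const, nsmul_eq_mul] at h1
  have h3 : ((#E : ℝ) * (1 - r)) * #D ≤ #D * #D := by nlinarith
  exact le_of_mul_le_mul_right h3 hD

lemma group_lemma {G : Type*} [AddCommGroup G] [Fintype G] [DecidableEq G] (D : Finset G)
    (θ β : ℝ) (hθ : 0 < θ) (hθ' : θ ≤ 1 / 20) (hD : 0 < (#D : ℝ)) (hβ : β ≤ #D / 10)
    (hbad : (#{p ∈ D ×ˢ D | p.1 + p.2 ∉ D} : ℝ) ≤ θ * #D * β) :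
    ∃ K : AddSubgroup G, (Nat.card K : ℝ) * (1 - 2 * θ) ≤ #D ∧
      ∃ D' ⊆ D, (∀ x ∈ D', x ∈ K) ∧ (#D : ℝ) - β ≤ #D' := by
  set loss : G → ℝ := fun h => (#{x ∈ D | x + h ∉ D} : ℝ) with hloss
  have ladd : ∀ a b, loss (a + b) ≤ loss a + loss b := by
    intro a b; simp only [hloss]; exact_mod_cast loss_add D a b
  have lneg : ∀ a, loss (-a) = loss a := by
    intro a; simp only [hloss]; exact_mod_cast loss_neg D a
  have lev : ∀ r : ℝ, (#{h : G | loss h ≤ r * #D} : ℝ) * (1 - r) ≤ #D :=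
    fun r => level_card D r hD
  have hH : (#D : ℝ) - β ≤ #{h ∈ D | loss h ≤ θ * #D} := by
    have e1 := card_filter_add_card_filter_not (s := D) (fun h => loss h ≤ θ * #D)
    have e2 : (#{h ∈ D | loss h ≤ θ * #D} : ℝ) + #{h ∈ D | ¬ loss h ≤ θ * #D} = #D := by
      exact_mod_cast e1
    have e3 : (#{p ∈ D ×ˢ D | p.1 + p.2 ∉ D} : ℝ) = ∑ h ∈ D, loss h := by
      simp only [hloss]
      have : #{p ∈ D ×ˢ D | p.1 + p.2 ∉ D} = ∑ h ∈ D, #{x ∈ D | x + h ∉ D} := by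
        simp_rw [card_filter]
        rw [sum_product_right]
      exact_mod_cast this
    have e4 : ∑ h ∈ {h ∈ D | ¬ loss h ≤ θ * #D}, θ * #D ≤ ∑ h ∈ {h ∈ D | ¬ loss h ≤ θ * #D}, loss h := by
      apply sum_le_sum
      intro h hh
      simp only [mem_filter, not_le] at hh
      exact hh.2.le
    have e5 : ∑ h ∈ {h ∈ D | ¬ loss h ≤ θ * #D}, loss h ≤ ∑ h ∈ D, loss h :=
      sum_le_sum_of_subset_of_nonneg (filter_subset _ _) (fun _ _ _ => by simp only [hloss]; positivity)
    rw [sum_const, nsmul_eq_mul] at e4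
    have e6 : (#{h ∈ D | ¬ loss h ≤ θ * #D} : ℝ) * (θ * #D) ≤ β * (θ * #D) := by linarith
    have e7 := le_of_mul_le_mul_right e6 (by positivity)
    linarith
  set H : Finset G := {h ∈ D | loss h ≤ θ * #D} with hHdef
  have key : ∀ h, loss h ≤ 4 * θ * #D → loss h ≤ 2 * θ * #D := by
    intro h hh
    have : ¬ Disjoint H (H.image (fun y => h + y)) := by
      intro hdis
      have hsub : H ∪ H.image (fun y => h + y) ⊆ ({g : G | loss g ≤ (5 * θ) * #D} : Finset G) := by
        intro g hg
        simp only [mem_union, mem_image, hHdef, mem_filter, mem_univ, true_and] at hg ⊢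
        rcases hg with hg | ⟨y, hy, rfl⟩
        · nlinarith [hg.2]
        · have := ladd h y
          linarith [hy.2]
      have hc := card_le_card hsub
      rw [card_union_of_disjoint hdis, card_image_of_injective _ (add_right_injective h)] at hc
      have hc' : (#H : ℝ) + #H ≤ #{g : G | loss g ≤ (5 * θ) * #D} := by exact_mod_cast hc
      have := lev (5 * θ)
      nlinarith
    rw [not_disjoint_iff] at this
    obtain ⟨g, hg, hg'⟩ := this
    simp only [mem_image, hHdef, mem_filter] at hg hg'
    obtain ⟨y, hy, rfl⟩ := hg'
    have := ladd (h + y) (-y)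
    rw [lneg, add_neg_cancel_right] at this
    linarith [hy.2, hg.2]
  let K : AddSubgroup G :=
    { carrier := {h | loss h ≤ 2 * θ * #D}
      zero_mem' := by
        have : loss 0 = 0 := by simp [hloss]
        simp only [Set.mem_ofPred_eq, this]; positivity
      add_mem' := by
        intro a b ha hb
        simp only [Set.mem_ofPred_eq] at ha hb ⊢
        apply key
        have := ladd a b
        linarith
      neg_mem' := by
        intro a ha
        simp only [Set.mem_ofPred_eq] at ha ⊢
        rw [lneg]; exact ha }
  refine ⟨K, ?_, H, filter_subset _ _, ?_, hH⟩
  · have : Nat.card K = #{h : G | loss h ≤ (2 * θ) * #D} := by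
      rw [← Nat.card_eq_finsetCard]
      apply Nat.card_congr
      exact Equiv.subtypeEquivRight (fun x => by simp [K])
    rw [this]
    exact lev _
  · intro x hx
    simp only [hHdef, mem_filter] at hx
    show loss x ≤ 2 * θ * #D
    nlinarith [hx.2]

lemma pairs_trim (A B : Finset ℤ) :
    #{p ∈ A ×ˢ A | p.1 + p.2 ∈ A} ≤ #{p ∈ B ×ˢ B | p.1 + p.2 ∈ B} + 3 * (#A * #(A \ B)) := by
  have hsub : {p ∈ A ×ˢ A | p.1 + p.2 ∈ A} ⊆ {p ∈ B ×ˢ B | p.1 + p.2 ∈ B} ∪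
      ((A ×ˢ (A \ B)) ∪ ((A \ B) ×ˢ A) ∪ (A ×ˢ (A \ B)).image (fun p => (p.1, p.2 - p.1))) := by
    rintro ⟨x, y⟩ h
    simp only [mem_filter, mem_product, mem_union, mem_image, mem_sdiff, Prod.mk.injEq, Prod.exists] at h ⊢
    by_cases h1 : x ∈ B
    · by_cases h2 : y ∈ B
      · by_cases h3 : x + y ∈ B
        · tauto
        · right; right
          exact ⟨x, x + y, ⟨h.1.1, h.2, h3⟩, rfl, by ring⟩
      · tauto
    · tauto
  have h1 := card_le_card hsub
  have h2 := card_union_le ({p ∈ B ×ˢ B | p.1 + p.2 ∈ B})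
    ((A ×ˢ (A \ B)) ∪ ((A \ B) ×ˢ A) ∪ (A ×ˢ (A \ B)).image (fun p => (p.1, p.2 - p.1)))
  have h3 := card_union_le ((A ×ˢ (A \ B)) ∪ ((A \ B) ×ˢ A))
    ((A ×ˢ (A \ B)).image (fun p => (p.1, p.2 - p.1)))
  have h4 := card_union_le (A ×ˢ (A \ B)) ((A \ B) ×ˢ A)
  have h5 : #((A ×ˢ (A \ B)).image (fun p => (p.1, p.2 - p.1))) ≤ _ := card_image_le
  rw [card_product] at h4 h5
  rw [card_product] at h4
  have := mul_comm #(A \ B) #A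
  linarith

lemma mod_of_D (M x : ℤ) (h0 : 0 < x) (h1 : x < M) : x % M = x ∧ (x - M) % M = x := by
  refine ⟨Int.emod_eq_of_lt h0.le h1, ?_⟩
  rw [Int.sub_emod_right]; exact Int.emod_eq_of_lt h0.le h1

lemma pairs_B (D : Finset ℤ) (M : ℤ) (hD : ∀ x ∈ D, 0 < x ∧ x < M) :
    #{p ∈ (D ∪ D.image (fun x => x - M)) ×ˢ (D ∪ D.image (fun x => x - M)) |
        p.1 + p.2 ∈ (D ∪ D.image (fun x => x - M))} ≤
      3 * #{p ∈ D ×ˢ D | (p.1 + p.2) % M ∈ D} := by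
  set B := D ∪ D.image (fun x => x - M) with hB
  have hBm : ∀ u ∈ B, u % M ∈ D ∧ (u = u % M ∨ u = u % M - M) ∧ -M < u ∧ u < M := by
    intro u hu
    simp only [hB, mem_union, mem_image] at hu
    rcases hu with hu | ⟨x, hx, rfl⟩
    · have := hD u hu
      have h2 := mod_of_D M u this.1 this.2
      rw [h2.1]; refine ⟨hu, Or.inl rfl, by omega, by omega⟩
    · have := hD x hx
      have h2 := mod_of_D M x this.1 this.2
      rw [h2.2]; refine ⟨hx, Or.inr rfl, by omega, by omega⟩
  apply card_le_mul_card_image_of_maps_to (f := fun p : ℤ × ℤ => (p.1 % M, p.2 % M))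
  · rintro ⟨u, v⟩ h
    simp only [mem_filter, mem_product] at h ⊢
    refine ⟨⟨(hBm u h.1.1).1, (hBm v h.1.2).1⟩, ?_⟩
    have := (hBm _ h.2).1
    rwa [Int.add_emod] at this
  · rintro ⟨x, y⟩ h
    simp only [mem_filter, mem_product] at h
    have hx := hD x h.1.1
    have hy := hD y h.1.2
    by_cases hs : x + y < M
    · refine (card_le_card (t := {(x, y), (x - M, y), (x, y - M)}) ?_).trans card_le_three
      rintro ⟨u, v⟩ huv
      simp only [mem_filter, mem_product, Prod.mk.injEq, mem_insert, mem_singleton] at huv ⊢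
      obtain ⟨⟨⟨hu, hv⟩, hs'⟩, rfl, rfl⟩ := huv
      have a1 := hBm u hu
      have a2 := hBm v hv
      have a3 := hBm _ hs'
      omega
    · refine (card_le_card (t := {(x - M, y - M), (x - M, y), (x, y - M)}) ?_).trans card_le_three
      rintro ⟨u, v⟩ huv
      simp only [mem_filter, mem_product, Prod.mk.injEq, mem_insert, mem_singleton] at huv ⊢
      obtain ⟨⟨⟨hu, hv⟩, hs'⟩, rfl, rfl⟩ := huv
      have a1 := hBm u hu
      have a2 := hBm v hv
      have a3 := hBm _ hs'
      omega

lemma pairs_count (A D : Finset ℤ) (M : ℤ) (hD : ∀ x ∈ D, 0 < x ∧ x < M)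
    (hDA : ∀ x ∈ D, x ∈ A ∧ x - M ∈ A) :
    (#{p ∈ A ×ˢ A | p.1 + p.2 ∈ A} : ℝ) ≤ 3 * #{p ∈ D ×ˢ D | (p.1 + p.2) % M ∈ D}
      + 3 * (#A * (#A - 2 * #D)) := by
  have hB : D ∪ D.image (fun x => x - M) ⊆ A := by
    intro u hu
    simp only [mem_union, mem_image] at hu
    rcases hu with hu | ⟨x, hx, rfl⟩
    · exact (hDA u hu).1
    · exact (hDA x hx).2
  have hc : #(D ∪ D.image (fun x => x - M)) = 2 * #D := by
    rw [card_union_of_disjoint, card_image_of_injective _ (sub_left_injective), two_mul]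
    rw [disjoint_left]
    intro u hu hu'
    simp only [mem_image] at hu'
    obtain ⟨x, hx, rfl⟩ := hu'
    have := hD _ hu
    have := hD _ hx
    omega
  have h1 := pairs_trim A (D ∪ D.image (fun x => x - M))
  have h2 := pairs_B D M hD
  have h3 := card_sdiff_add_card_eq_card hB
  rw [hc] at h3
  have h3' : (#(A \ (D ∪ D.image (fun x => x - M))) : ℝ) = #A - 2 * #D := by
    have : (#(A \ (D ∪ D.image (fun x => x - M))) : ℝ) + 2 * #D = #A := by exact_mod_cast h3
    linarith
  rw [← h3']
  exact_mod_cast h1.trans (by linarith)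

set_option maxHeartbeats 1000000 in
lemma core (A D : Finset ℤ) (m : ℕ) (hm : 0 < m) (δ : ℝ) (hδ : 0 < δ) (hδ' : δ < 1 / 4096)
    (hn : 1 ≤ δ ^ 4 * #A) (hD : ∀ x ∈ D, 0 < x ∧ x < (m : ℤ))
    (hDA : ∀ x ∈ D, x ∈ A ∧ x - m ∈ A)
    (hcard : (1 - 7 * δ ^ 2) * #A ≤ 2 * (#D : ℝ))
    (hT : (3 / 4 - δ ^ 4) * (#A : ℝ) ^ 2 ≤ #{p ∈ A ×ˢ A | p.1 + p.2 ∈ A}) :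
    ∃ (P : Finset ℤ) (d : ℤ),
      (∃ x, P = (Finset.range P.card).image fun i : ℕ => x + d * (i : ℤ)) ∧
      (0 : ℤ) ∈ P ∧ P = P.image (fun t => -t) ∧
      (P.card : ℝ) ≤ (1 + 280 * δ) * #A ∧
      (1 - 10 * δ) * #A ≤ ((P ∩ A).card : ℝ) := by
  have : NeZero m := ⟨hm.ne'⟩
  have hmz : (0 : ℤ) < m := by exact_mod_cast hm
  have hcount := pairs_count A D m hD hDA
  set n : ℝ := (#A : ℝ) with hndef
  have hnpos : 0 < n := by
    by_contra h
    have : n = 0 := le_antisymm (not_lt.mp h) (by positivity)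
    rw [this] at hn; norm_num at hn
  have hδ2 : δ ^ 2 ≤ δ / 4096 := delta_sq δ hδ hδ'
  have hδ4 : δ ^ 4 ≤ δ ^ 2 / 4096 := delta_four δ hδ hδ'
  have h2D : 2 * (#D : ℝ) ≤ n := by
    have hB : D ∪ D.image (fun x => x - (m : ℤ)) ⊆ A := by
      intro u hu
      simp only [mem_union, mem_image] at hu
      rcases hu with hu | ⟨x, hx, rfl⟩
      · exact (hDA u hu).1
      · exact (hDA x hx).2
    have hc : #(D ∪ D.image (fun x => x - (m : ℤ))) = 2 * #D := by
      rw [card_union_of_disjoint, card_image_of_injective _ (sub_left_injective), two_mul]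
      rw [disjoint_left]
      intro u hu hu'
      simp only [mem_image] at hu'
      obtain ⟨x, hx, rfl⟩ := hu'
      have := hD _ hu
      have := hD _ hx
      omega
    have := card_le_card hB
    rw [hc] at this
    rw [hndef]; exact_mod_cast this
  have hDn : 49 / 100 * n ≤ #D := by nlinarith
  have hDpos : 0 < (#D : ℝ) := by linarith
  set Db : Finset (ZMod m) := D.image (fun x : ℤ => (x : ZMod m)) with hDb
  have hinj : Set.InjOn (fun x : ℤ => (x : ZMod m)) (D : Set ℤ) := by
    intro x hx y hy hxy
    have h1 := hD x hx
    have h2 := hD y hy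
    have h3 := (ZMod.intCast_eq_intCast_iff' x y m).1 hxy
    rwa [Int.emod_eq_of_lt h1.1.le h1.2, Int.emod_eq_of_lt h2.1.le h2.2] at h3
  have hDbc : #Db = #D := card_image_of_injOn hinj
  have hbad1 : #{p ∈ Db ×ˢ Db | p.1 + p.2 ∉ Db} ≤ #{p ∈ D ×ˢ D | ¬ (p.1 + p.2) % (m : ℤ) ∈ D} := by
    refine (card_le_card (t := ({p ∈ D ×ˢ D | ¬ (p.1 + p.2) % (m : ℤ) ∈ D}).image
      (fun p : ℤ × ℤ => ((p.1 : ZMod m), (p.2 : ZMod m)))) ?_).trans card_image_le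
    rintro ⟨u, v⟩ h
    simp only [mem_filter, mem_product, hDb, mem_image] at h
    obtain ⟨⟨⟨x, hx, rfl⟩, ⟨y, hy, rfl⟩⟩, hn'⟩ := h
    simp only [mem_image, mem_filter, mem_product]
    refine ⟨(x, y), ⟨⟨hx, hy⟩, ?_⟩, rfl⟩
    intro hmem
    apply hn'
    refine ⟨_, hmem, ?_⟩
    simp
  have hbad2 := card_filter_add_card_filter_not (s := D ×ˢ D)
    (fun p => (p.1 + p.2) % (m : ℤ) ∈ D)
  rw [card_product] at hbad2
  have hbad2' : (#{p ∈ D ×ˢ D | (p.1 + p.2) % (m : ℤ) ∈ D} : ℝ) +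
      #{p ∈ D ×ˢ D | ¬ (p.1 + p.2) % (m : ℤ) ∈ D} = #D * #D := by exact_mod_cast hbad2
  have hbad : (#{p ∈ Db ×ˢ Db | p.1 + p.2 ∉ Db} : ℝ) ≤ (64 * δ) * #Db * (δ * n) := by
    have h1 : (#{p ∈ Db ×ˢ Db | p.1 + p.2 ∉ Db} : ℝ) ≤
      #{p ∈ D ×ˢ D | ¬ (p.1 + p.2) % (m : ℤ) ∈ D} := by exact_mod_cast hbad1
    rw [hDbc]
    have h3 : (#D : ℝ) * #D ≤ n ^ 2 / 4 := by nlinarith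
    have h4 : n * (n - 2 * #D) ≤ 7 * δ ^ 2 * n ^ 2 := by nlinarith
    have h5 : δ ^ 2 * n * (49 / 100 * n) ≤ δ ^ 2 * n * #D := by gcongr
    have h6 : δ ^ 4 * n ^ 2 ≤ δ ^ 2 * n ^ 2 := by
      gcongr ?_ * n ^ 2; linarith [sq_nonneg δ]
    nlinarith
  obtain ⟨K, hK1, D', hD'sub, hD'K, hD'c⟩ := group_lemma Db (64 * δ) (δ * n) (by positivity)
    (by linarith) (by rw [hDbc]; exact hDpos) (by rw [hDbc]; nlinarith) hbad
  rw [hDbc] at hK1 hD'c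
  obtain ⟨d0, hd0⟩ := Int.subgroup_cyclic (K.comap (Int.castAddHom (ZMod m)))
  have hmem0 : ∀ x : ℤ, ((x : ZMod m) ∈ K) ↔ d0 ∣ x := by
    intro x
    have : x ∈ K.comap (Int.castAddHom (ZMod m)) ↔ x ∈ AddSubgroup.closure {d0} := by rw [hd0]
    rw [AddSubgroup.mem_closure_singleton] at this
    simp only [AddSubgroup.mem_comap, Int.coe_castAddHom] at this
    rw [this]
    constructor
    · rintro ⟨k, rfl⟩; simp
    · rintro ⟨k, rfl⟩; exact ⟨k, by simp [mul_comm]⟩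
  obtain ⟨d, hdnn, hd⟩ : ∃ d : ℤ, 0 ≤ d ∧ ∀ x : ℤ, ((x : ZMod m) ∈ K) ↔ d ∣ x :=
    ⟨|d0|, abs_nonneg _, fun x => by rw [hmem0, abs_dvd]⟩
  have hdm : d ∣ (m : ℤ) := by rw [← hd]; simp
  obtain ⟨r0, hr0⟩ := hdm
  have hdpos : 0 < d := by
    rcases hdnn.eq_or_lt with h | h
    · rw [← h] at hr0; simp at hr0; omega
    · exact h
  have hr0pos : 0 < r0 := by
    by_contra h
    nlinarith
  obtain ⟨r, rfl⟩ := Int.eq_ofNat_of_zero_le hr0pos.le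
  have hrK : r ≤ Nat.card K := by
    have : Function.Injective (fun i : Fin r => (⟨((d * (i : ℕ) : ℤ) : ZMod m), (hd _).2 (by simp)⟩ : K)) := by
      intro i j hij
      simp only [Subtype.mk.injEq] at hij
      have h3 := (ZMod.intCast_eq_intCast_iff' _ _ m).1 hij
      have hi : ((i : ℕ) : ℤ) < r := by exact_mod_cast i.2
      have hj : ((j : ℕ) : ℤ) < r := by exact_mod_cast j.2
      rw [Int.emod_eq_of_lt (by positivity) (by rw [hr0]; nlinarith),
        Int.emod_eq_of_lt (by positivity) (by rw [hr0]; nlinarith)] at h3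
      have := mul_left_cancel₀ hdpos.ne' h3
      exact Fin.ext (by exact_mod_cast this)
    have := Nat.card_le_card_of_injective _ this
    simpa using this
  have hrK' : (r : ℝ) ≤ Nat.card K := by exact_mod_cast hrK
  set P : Finset ℤ := (Finset.range (2 * r + 1)).image (fun i : ℕ => -(d * r) + d * (i : ℤ)) with hP
  have hPc : #P = 2 * r + 1 := by
    rw [hP, card_image_of_injective, card_range]
    intro i j hij
    simp only [add_right_inj] at hij
    have := mul_left_cancel₀ hdpos.ne' hij
    exact_mod_cast this
  have hPmem : ∀ t : ℤ, t ∈ P ↔ d ∣ t ∧ -(m : ℤ) ≤ t ∧ t ≤ m := by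
    intro t
    simp only [hP, mem_image, mem_range]
    constructor
    · rintro ⟨i, hi, rfl⟩
      have hi' : (i : ℤ) ≤ 2 * r := by exact_mod_cast Nat.lt_succ_iff.1 hi
      refine ⟨⟨-r + i, by ring⟩, ?_, ?_⟩
      · rw [hr0]; nlinarith
      · rw [hr0]; nlinarith
    · rintro ⟨⟨c, rfl⟩, h1, h2⟩
      rw [hr0] at h1 h2
      have h1' : -(r : ℤ) ≤ c := by
        by_contra h; push Not at h; nlinarith
      have h2' : c ≤ r := by
        by_contra h; push Not at h; nlinarith
      refine ⟨(c + r).toNat, by omega, ?_⟩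
      rw [Int.toNat_of_nonneg (by omega)]; ring
  refine ⟨P, d, ⟨-(d * r), by rw [hPc]⟩, ?_, ?_, ?_, ?_⟩
  · rw [hPmem]; refine ⟨dvd_zero _, by omega, by omega⟩
  · ext t
    simp only [mem_image]
    constructor
    · intro ht
      refine ⟨-t, ?_, by ring⟩
      rw [hPmem] at ht ⊢
      refine ⟨(dvd_neg).2 ht.1, by omega, by omega⟩
    · rintro ⟨s, hs, rfl⟩
      rw [hPmem] at hs ⊢
      refine ⟨(dvd_neg).2 hs.1, by omega, by omega⟩
  · rw [hPc]; push_cast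
    have h1 : (r : ℝ) * (1 - 2 * (64 * δ)) ≤ #D := by
      refine le_trans ?_ hK1
      apply mul_le_mul_of_nonneg_right hrK'; linarith
    have h2 : 2 * (r : ℝ) * (1 - 128 * δ) ≤ n := by linarith
    have h3 : 1 ≤ δ * n := by nlinarith
    have h4 : n ≤ ((1 + 279 * δ) * n) * (1 - 128 * δ) := by
      have : 1 ≤ (1 + 279 * δ) * (1 - 128 * δ) := by nlinarith
      nlinarith
    have h5 : 2 * (r : ℝ) ≤ (1 + 279 * δ) * n :=
      le_of_mul_le_mul_right (h2.trans h4) (by linarith)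
    linarith
  · set D2 : Finset ℤ := {x ∈ D | (x : ZMod m) ∈ D'} with hD2
    have hD2c : #D' ≤ #D2 := by
      refine (card_le_card (t := D2.image (fun x : ℤ => (x : ZMod m))) ?_).trans card_image_le
      intro u hu
      have := hD'sub hu
      simp only [hDb, mem_image] at this
      obtain ⟨x, hx, rfl⟩ := this
      simp only [mem_image, hD2, mem_filter]
      exact ⟨x, ⟨hx, hu⟩, rfl⟩
    have hD2dvd : ∀ x ∈ D2, x ∈ D ∧ d ∣ x := by
      intro x hx
      simp only [hD2, mem_filter] at hx
      exact ⟨hx.1, (hd x).1 (hD'K _ hx.2)⟩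
    have hB : D2 ∪ D2.image (fun x => x - (m : ℤ)) ⊆ P ∩ A := by
      intro u hu
      simp only [mem_union, mem_image] at hu
      rw [mem_inter, hPmem]
      rcases hu with hu | ⟨x, hx, rfl⟩
      · obtain ⟨a1, a2⟩ := hD2dvd u hu
        have := hD u a1
        exact ⟨⟨a2, by omega, by omega⟩, (hDA u a1).1⟩
      · obtain ⟨a1, a2⟩ := hD2dvd x hx
        have := hD x a1
        exact ⟨⟨dvd_sub a2 ⟨_, hr0⟩, by omega, by omega⟩, (hDA x a1).2⟩
    have hc : #(D2 ∪ D2.image (fun x => x - (m : ℤ))) = 2 * #D2 := by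
      rw [card_union_of_disjoint, card_image_of_injective _ (sub_left_injective), two_mul]
      rw [disjoint_left]
      intro u hu hu'
      simp only [mem_image] at hu'
      obtain ⟨x, hx, rfl⟩ := hu'
      have := hD _ (hD2dvd _ hu).1
      have := hD _ (hD2dvd _ hx).1
      omega
    have h1 := card_le_card hB
    rw [hc] at h1
    have h2 : 2 * #D' ≤ #(P ∩ A) := by omega
    have h3 : 2 * (#D' : ℝ) ≤ #(P ∩ A) := by exact_mod_cast h2
    have h4 : δ ^ 2 * n ≤ δ / 4096 * n := by gcongr
    nlinarith

/-- rank of `a` among positive elements -/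
def kk (A : Finset ℤ) (a : ℤ) : ℕ := #{x ∈ A | 0 < x ∧ x ≤ a}

/-- number of elements lost after a shift -/
def ls (A : Finset ℤ) (a : ℤ) : ℕ := #{x ∈ A | x + a ∉ A}

/-- positive part -/
def pos (A : Finset ℤ) : Finset ℤ := {x ∈ A | 0 < x}

/-- reflection -/
def ng (A : Finset ℤ) : Finset ℤ := A.image (fun x => -x)

lemma mem_ng (A : Finset ℤ) (x : ℤ) : x ∈ ng A ↔ -x ∈ A := by
  simp only [ng, mem_image]
  constructor
  · rintro ⟨y, hy, rfl⟩; simpa using hy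
  · intro h; exact ⟨-x, h, by simp⟩

lemma ng_ng (A : Finset ℤ) : ng (ng A) = A := by
  ext x; simp [mem_ng]

lemma card_ng (A : Finset ℤ) : #(ng A) = #A := card_image_of_injective _ neg_injective

lemma classes_le (A : Finset ℤ) (a : ℤ) (ha : 0 < a) : #(A.image (fun x => x % a)) ≤ ls A a := by
  unfold ls
  refine (card_le_card (t := ({x ∈ A | x + a ∉ A}).image (fun x => x % a)) ?_).trans card_image_le
  intro c hc
  simp only [mem_image] at hc
  obtain ⟨x, hx, rfl⟩ := hc
  obtain ⟨y, hy, hmax⟩ := exists_max_image ({y ∈ A | y % a = x % a}) id ⟨x, by simp [hx]⟩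
  simp only [mem_filter, id] at hy hmax
  simp only [mem_image, mem_filter]
  refine ⟨y, ⟨hy.1, ?_⟩, hy.2⟩
  intro h
  have := hmax (y + a) ⟨h, by rw [Int.add_emod_right]; exact hy.2⟩
  omega

lemma kk_le_ls (A : Finset ℤ) (a : ℤ) (ha : 0 < a) : kk A a ≤ ls A a := by
  refine le_trans ?_ (classes_le A a ha)
  unfold kk
  rw [← card_image_of_injOn (s := {x ∈ A | 0 < x ∧ x ≤ a}) (f := fun x => x % a)]
  · exact card_le_card (image_subset_image (filter_subset _ _))
  · intro x hx y hy hxy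
    simp only [coe_filter, Set.mem_ofPred_eq] at hx hy
    have h1 : a ∣ x - y := Int.ModEq.dvd (Int.ModEq.symm hxy)
    have h2 : x - y = 0 := Int.eq_zero_of_abs_lt_dvd h1 (by rw [abs_lt]; omega)
    omega

lemma kk_inj (A : Finset ℤ) : Set.InjOn (kk A) (pos A : Set ℤ) := by
  have key : ∀ x ∈ pos A, ∀ y ∈ pos A, x < y → kk A x < kk A y := by
    intro x hx y hy hxy
    unfold kk
    apply card_lt_card
    rw [ssubset_iff_of_subset]
    · simp only [pos, mem_filter] at hx hy
      exact ⟨y, by simp only [mem_filter]; exact ⟨hy.1, hy.2, le_rfl⟩,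
        by simp only [mem_filter]; rintro ⟨_, _, h⟩; omega⟩
    · intro z hz
      simp only [mem_filter] at hz ⊢
      exact ⟨hz.1, hz.2.1, by omega⟩
  intro x hx y hy hxy
  rcases lt_trichotomy x y with h | h | h
  · have := key x hx y hy h; omega
  · exact h
  · have := key y hy x hx h; omega

lemma kk_range (A : Finset ℤ) (a : ℤ) (ha : a ∈ pos A) : 1 ≤ kk A a ∧ kk A a ≤ #(pos A) := by
  constructor
  · unfold kk
    rw [Nat.one_le_iff_ne_zero, ← Nat.pos_iff_ne_zero, card_pos]
    simp only [pos, mem_filter] at ha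
    exact ⟨a, by simp only [mem_filter]; exact ⟨ha.1, ha.2, le_rfl⟩⟩
  · apply card_le_card
    intro x hx
    simp only [pos, mem_filter] at hx ⊢
    exact ⟨hx.1, hx.2.1⟩

lemma sum_kk (A : Finset ℤ) : 2 * ∑ a ∈ pos A, kk A a = #(pos A) * (#(pos A) + 1) := by
  have himg : (pos A).image (kk A) = Finset.Icc 1 #(pos A) := by
    apply eq_of_subset_of_card_le
    · intro k hk
      simp only [mem_image] at hk
      obtain ⟨a, ha, rfl⟩ := hk
      rw [mem_Icc]; exact kk_range A a ha
    · rw [card_image_of_injOn (kk_inj A)]; simp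
  have h1 : ∑ a ∈ pos A, kk A a = ∑ k ∈ Finset.Icc 1 #(pos A), k := by
    rw [← himg, sum_image (kk_inj A)]
  rw [h1]
  generalize #(pos A) = p
  induction p with
  | zero => simp
  | succ p ih => rw [sum_Icc_succ_top (by omega), mul_add, ih]; ring

lemma exists_good (A : Finset ℤ) (w s E : ℝ) (hwp : w ≤ #(pos A)) (hs : 0 < s)
    (hE : E < w * s)
    (hsum : (∑ a ∈ pos A, (ls A a : ℝ)) - ∑ a ∈ pos A, (kk A a : ℝ) ≤ E) :
    ∃ a ∈ pos A, (#(pos A) : ℝ) - w ≤ kk A a ∧ (ls A a : ℝ) ≤ kk A a + s := by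
  by_contra hcon
  push Not at hcon
  set p : ℝ := (#(pos A) : ℝ) with hp
  set W : Finset ℤ := {a ∈ pos A | p - w ≤ kk A a} with hW
  have hWc : w ≤ #W := by
    have e1 := card_filter_add_card_filter_not (s := pos A) (fun a => p - w ≤ kk A a)
    have e2 : (#W : ℝ) + #{a ∈ pos A | ¬ p - w ≤ kk A a} = p := by
      rw [hp]; exact_mod_cast e1
    have e3 : #{a ∈ pos A | ¬ p - w ≤ kk A a} ≤ ⌊p - w⌋₊ := by
      rw [← card_image_of_injOn (s := {a ∈ pos A | ¬ p - w ≤ kk A a}) (f := kk A)]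
      · refine (card_le_card (t := Finset.Icc 1 ⌊p - w⌋₊) ?_).trans (by simp)
        intro k hk
        simp only [mem_image, mem_filter, not_le] at hk
        obtain ⟨a, ⟨ha, ha'⟩, rfl⟩ := hk
        rw [mem_Icc]
        exact ⟨(kk_range A a ha).1, Nat.le_floor ha'.le⟩
      · exact (kk_inj A).mono (by intro x hx; simp only [coe_filter, Set.mem_ofPred_eq] at hx; exact hx.1)
    have e4 : (⌊p - w⌋₊ : ℝ) ≤ p - w := Nat.floor_le (by linarith)
    have e5 : (#{a ∈ pos A | ¬ p - w ≤ kk A a} : ℝ) ≤ ⌊p - w⌋₊ := by exact_mod_cast e3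
    linarith
  rw [← sum_sub_distrib] at hsum
  have h1 : ∑ a ∈ W, s ≤ ∑ a ∈ W, ((ls A a : ℝ) - kk A a) := by
    apply sum_le_sum
    intro a ha
    simp only [hW, mem_filter] at ha
    have := hcon a ha.1 ha.2
    linarith
  have h2 : ∑ a ∈ W, ((ls A a : ℝ) - kk A a) ≤ ∑ a ∈ pos A, ((ls A a : ℝ) - kk A a) := by
    apply sum_le_sum_of_subset_of_nonneg (filter_subset _ _)
    intro a ha _
    have : kk A a ≤ ls A a := kk_le_ls A a (by simp only [pos, mem_filter] at ha; exact ha.2)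
    have : (kk A a : ℝ) ≤ ls A a := by exact_mod_cast this
    linarith
  rw [sum_const, nsmul_eq_mul] at h1
  nlinarith

lemma D_bound (A : Finset ℤ) (a b : ℤ) (ha : 0 < a) (hab : b ≤ a) :
    kk A a + kk (ng A) b ≤ ls A a + #{x ∈ A | 0 < x ∧ x < a ∧ x - a ∈ A} + 2 := by
  set A1 : Finset ℤ := {x ∈ A | 0 < x ∧ x < a} with hA1
  set A2 : Finset ℤ := {x ∈ A | -a < x ∧ x < 0} with hA2
  have h1 : kk A a ≤ #A1 + 1 := by
    unfold kk
    refine (card_le_card (t := insert a A1) ?_).trans (card_insert_le _ _)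
    intro x hx
    simp only [mem_filter, mem_insert, hA1] at hx ⊢
    by_cases h : x = a
    · exact Or.inl h
    · right; exact ⟨hx.1, by omega, by omega⟩
  have h2 : kk (ng A) b ≤ #A2 + 1 := by
    unfold kk
    refine (card_le_card (t := insert a (A2.image (fun x => -x))) ?_).trans
      ((card_insert_le _ _).trans (Nat.add_le_add_right card_image_le 1))
    intro x hx
    simp only [mem_filter, mem_insert, hA2, mem_image, mem_ng] at hx ⊢
    by_cases h : x = a
    · exact Or.inl h
    · right; exact ⟨-x, ⟨hx.1, by omega, by omega⟩, by ring⟩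
  have h3 := card_union_add_card_inter A1 (A2.image (fun x => x + a))
  rw [card_image_of_injective A2 (add_left_injective a)] at h3
  have h4 : #(A1 ∪ A2.image (fun x => x + a)) ≤ ls A a := by
    refine le_trans (card_le_card ?_) (classes_le A a ha)
    intro u hu
    simp only [mem_union, mem_image, hA1, hA2, mem_filter] at hu ⊢
    rcases hu with hu | ⟨x, hx, rfl⟩
    · exact ⟨u, hu.1, Int.emod_eq_of_lt (by omega) (by omega)⟩
    · refine ⟨x, hx.1, ?_⟩
      rw [← Int.add_emod_right]
      exact Int.emod_eq_of_lt (by omega) (by omega)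
  have h5 : #(A1 ∩ A2.image (fun x => x + a)) ≤ #{x ∈ A | 0 < x ∧ x < a ∧ x - a ∈ A} := by
    apply card_le_card
    intro u hu
    simp only [mem_inter, mem_image, hA1, hA2, mem_filter] at hu ⊢
    obtain ⟨⟨hu1, hu2⟩, x, hx, rfl⟩ := hu
    refine ⟨hu1, hu2.1, hu2.2, ?_⟩
    simpa using hx.1
  omega

/-- one-sided version of the theorem -/
lemma onesided (A : Finset ℤ) (a b : ℤ) (ha : 0 < a) (hab : b ≤ a) (δ : ℝ) (hδ : 0 < δ)
    (hδ' : δ < 1 / 4096) (hn : 1 ≤ δ ^ 4 * #A)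
    (hT : (3 / 4 - δ ^ 4) * (#A : ℝ) ^ 2 ≤ #{p ∈ A ×ˢ A | p.1 + p.2 ∈ A})
    (h1 : (ls A a : ℝ) ≤ kk A a + (δ ^ 2 * #A + 1))
    (h2 : (#(pos (ng A)) : ℝ) - δ ^ 2 * #A ≤ kk (ng A) b)
    (h3 : (#A : ℝ) - 2 - 2 * δ ^ 2 * #A ≤ 2 * #(pos (ng A))) :
    ∃ (P : Finset ℤ) (d : ℤ),
      (∃ x, P = (Finset.range P.card).image fun i : ℕ => x + d * (i : ℤ)) ∧
      (0 : ℤ) ∈ P ∧ P = P.image (fun t => -t) ∧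
      (P.card : ℝ) ≤ (1 + 280 * δ) * #A ∧
      (1 - 10 * δ) * #A ≤ ((P ∩ A).card : ℝ) := by
  obtain ⟨m, rfl⟩ := Int.eq_ofNat_of_zero_le ha.le
  have hD := D_bound A m b ha hab
  have hD' : (kk A m : ℝ) + kk (ng A) b ≤ ls A m +
      #{x ∈ A | 0 < x ∧ x < (m : ℤ) ∧ x - m ∈ A} + 2 := by exact_mod_cast hD
  refine core A {x ∈ A | 0 < x ∧ x < (m : ℤ) ∧ x - m ∈ A} m (by exact_mod_cast ha) δ hδ hδ' hn ?_ ?_ ?_ hT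
  · intro x hx; simp only [mem_filter] at hx; exact ⟨hx.2.1, hx.2.2.1⟩
  · intro x hx; simp only [mem_filter] at hx; exact ⟨hx.1, hx.2.2.2⟩
  · have : δ ^ 4 ≤ δ ^ 2 / 4096 := delta_four δ hδ hδ'
    have : δ ^ 4 * #A ≤ δ ^ 2 / 4096 * #A := by gcongr
    nlinarith

lemma pairs_eq_sum (A : Finset ℤ) : #{p ∈ A ×ˢ A | p.1 + p.2 ∈ A} + ∑ a ∈ A, ls A a = #A * #A := by
  have h := card_filter_add_card_filter_not (s := A ×ˢ A) (fun p => p.1 + p.2 ∈ A)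
  rw [card_product] at h
  have : #{p ∈ A ×ˢ A | ¬ p.1 + p.2 ∈ A} = ∑ a ∈ A, ls A a := by
    unfold ls
    simp_rw [card_filter]
    rw [sum_product_right]
  omega

lemma ls_ng (A : Finset ℤ) (a : ℤ) : ls (ng A) a = ls A (-a) := by
  unfold ls
  refine card_bij (fun x _ => -x) ?_ ?_ ?_
  · intro x hx
    simp only [mem_filter, mem_ng] at hx ⊢
    refine ⟨hx.1, ?_⟩
    rw [← neg_add]; exact hx.2
  · intro x _ y _ h; simpa using h
  · intro y hy
    simp only [mem_filter] at hy
    refine ⟨-y, ?_, by simp⟩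
    simp only [mem_filter, mem_ng]
    refine ⟨by simpa using hy.1, ?_⟩
    rw [neg_add, neg_neg]; exact hy.2

lemma sum_split (A : Finset ℤ) :
    ∑ a ∈ pos A, ls A a + ∑ a ∈ pos (ng A), ls (ng A) a ≤ ∑ a ∈ A, ls A a ∧
    #A ≤ #(pos A) + #(pos (ng A)) + 1 := by
  have hneg : ∑ a ∈ pos (ng A), ls (ng A) a = ∑ a ∈ {x ∈ A | x < 0}, ls A a := by
    refine sum_bij (fun x _ => -x) ?_ ?_ ?_ ?_
    · intro x hx
      simp only [pos, mem_filter, mem_ng] at hx ⊢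
      exact ⟨hx.1, by omega⟩
    · intro x _ y _ h; simpa using h
    · intro y hy
      simp only [mem_filter] at hy
      refine ⟨-y, ?_, by simp⟩
      simp only [pos, mem_filter, mem_ng]
      exact ⟨by simpa using hy.1, by omega⟩
    · intro x _; exact ls_ng A x
  have hcard : #(pos (ng A)) = #{x ∈ A | x < 0} := by
    refine card_bij (fun x _ => -x) ?_ ?_ ?_
    · intro x hx
      simp only [pos, mem_filter, mem_ng] at hx ⊢
      exact ⟨hx.1, by omega⟩
    · intro x _ y _ h; simpa using h
    · intro y hy
      simp only [mem_filter] at hy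
      refine ⟨-y, ?_, by simp⟩
      simp only [pos, mem_filter, mem_ng]
      exact ⟨by simpa using hy.1, by omega⟩
  have hdis : Disjoint (pos A) {x ∈ A | x < 0} := by
    rw [disjoint_left]
    intro x hx hx'
    simp only [pos, mem_filter] at hx hx'
    omega
  constructor
  · rw [hneg, ← sum_union hdis]
    apply sum_le_sum_of_subset
    intro x hx
    simp only [pos, mem_union, mem_filter] at hx
    tauto
  · rw [hcard, ← card_union_of_disjoint hdis]
    refine (card_le_card (t := insert 0 (pos A ∪ {x ∈ A | x < 0})) ?_).trans (card_insert_le _ _)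
    intro x hx
    simp only [pos, mem_union, mem_filter, mem_insert]
    rcases lt_trichotomy x 0 with h | h | h <;> tauto

lemma pairs_ng (A : Finset ℤ) :
    #{p ∈ ng A ×ˢ ng A | p.1 + p.2 ∈ ng A} = #{p ∈ A ×ˢ A | p.1 + p.2 ∈ A} := by
  refine card_bij (fun p _ => (-p.1, -p.2)) ?_ ?_ ?_
  · rintro ⟨x, y⟩ hx
    simp only [mem_filter, mem_product, mem_ng] at hx ⊢
    refine ⟨hx.1, ?_⟩
    rw [← neg_add]; exact hx.2
  · rintro ⟨x, y⟩ _ ⟨x', y'⟩ _ h; simpa using h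
  · rintro ⟨x, y⟩ hy
    simp only [mem_filter, mem_product] at hy
    refine ⟨(-x, -y), ?_, by simp⟩
    simp only [mem_filter, mem_product, mem_ng, neg_neg]
    refine ⟨hy.1, ?_⟩
    rw [neg_add, neg_neg, neg_neg]; exact hy.2

set_option maxHeartbeats 1000000 in
lemma twosided (A : Finset ℤ) (δ : ℝ) (hδ : 0 < δ)
    (hδ' : δ < 1 / 4096) (hn : 1 ≤ δ ^ 4 * #A)
    (hT : (3 / 4 - δ ^ 4) * (#A : ℝ) ^ 2 ≤ #{p ∈ A ×ˢ A | p.1 + p.2 ∈ A}) :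
    ∃ (P : Finset ℤ) (d : ℤ),
      (∃ x, P = (Finset.range P.card).image fun i : ℕ => x + d * (i : ℤ)) ∧
      (0 : ℤ) ∈ P ∧ P = P.image (fun t => -t) ∧
      (P.card : ℝ) ≤ (1 + 280 * δ) * #A ∧
      (1 - 10 * δ) * #A ≤ ((P ∩ A).card : ℝ) := by
  have e1 : (#{p ∈ A ×ˢ A | p.1 + p.2 ∈ A} : ℝ) + ∑ a ∈ A, (ls A a : ℝ) = #A * #A := by
    exact_mod_cast pairs_eq_sum A
  have e2 : ∑ a ∈ pos A, (ls A a : ℝ) + ∑ a ∈ pos (ng A), (ls (ng A) a : ℝ) ≤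
      ∑ a ∈ A, (ls A a : ℝ) := by exact_mod_cast (sum_split A).1
  have e3 : (#A : ℝ) ≤ #(pos A) + #(pos (ng A)) + 1 := by exact_mod_cast (sum_split A).2
  have e4 : 2 * ∑ a ∈ pos A, (kk A a : ℝ) = #(pos A) * (#(pos A) + 1) := by
    exact_mod_cast sum_kk A
  have e5 : 2 * ∑ a ∈ pos (ng A), (kk (ng A) a : ℝ) = #(pos (ng A)) * (#(pos (ng A)) + 1) := by
    exact_mod_cast sum_kk (ng A)
  have lsk : ∀ B : Finset ℤ, ∑ a ∈ pos B, (kk B a : ℝ) ≤ ∑ a ∈ pos B, (ls B a : ℝ) := by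
    intro B
    apply sum_le_sum
    intro a ha
    have := kk_le_ls B a (by simp only [pos, mem_filter] at ha; exact ha.2)
    exact_mod_cast this
  have e6 := lsk A
  have e7 := lsk (ng A)
  have hA1 : 1 ≤ (#A : ℝ) := by
    have : δ ^ 4 ≤ 1 := pow_le_one₀ hδ.le (by linarith)
    nlinarith [Nat.cast_nonneg (α := ℝ) #A]
  set n : ℝ := (#A : ℝ) with hndef
  set p : ℝ := (#(pos A) : ℝ) with hp
  set q : ℝ := (#(pos (ng A)) : ℝ) with hq
  set S1 := ∑ a ∈ pos A, (ls A a : ℝ)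
  set S2 := ∑ a ∈ pos (ng A), (ls (ng A) a : ℝ)
  set k1 := ∑ a ∈ pos A, (kk A a : ℝ)
  set k2 := ∑ a ∈ pos (ng A), (kk (ng A) a : ℝ)
  have hp0 : 0 ≤ p := by positivity
  have hq0 : 0 ≤ q := by positivity
  have hsq : (p - q) ^ 2 + 4 * (S1 - k1 + (S2 - k2)) ≤ 4 * δ ^ 4 * n ^ 2 + 1 := by
    have a1 : S1 + S2 ≤ (1 / 4 + δ ^ 4) * n ^ 2 := by nlinarith
    have a2 : (n - 1) ^ 2 ≤ (p + q) ^ 2 := by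
      apply pow_le_pow_left₀ <;> linarith
    nlinarith
  have hy : 0 < δ ^ 2 * n := by positivity
  have hpq : |p - q| ≤ 2 * (δ ^ 2 * n) + 1 := by
    apply abs_le_of_sq_le_sq _ (by positivity)
    nlinarith
  rw [abs_le] at hpq
  have hδs : δ ^ 2 ≤ 1 / 16 := by linarith [delta_sq δ hδ hδ']
  have hnbig : 16 ≤ n := by
    have : δ ^ 4 ≤ 1 / 16 := by linarith [delta_four δ hδ hδ']
    nlinarith
  have hyn : δ ^ 2 * n ≤ 1 / 16 * n := by gcongr
  obtain ⟨a, ha, ha1, ha2⟩ := exists_good A (δ ^ 2 * n) (δ ^ 2 * n + 1) (δ ^ 4 * n ^ 2 + 1 / 4)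
    (by linarith) (by linarith) (by
      have : 1 ≤ δ ^ 2 * n := by
        have : δ ^ 4 * n ≤ δ ^ 2 * n := by gcongr ?_ * n; linarith [sq_nonneg δ, delta_four δ hδ hδ']
        linarith
      nlinarith) (by nlinarith [sq_nonneg (p - q)])
  obtain ⟨b, hb, hb1, hb2⟩ := exists_good (ng A) (δ ^ 2 * n) (δ ^ 2 * n + 1) (δ ^ 4 * n ^ 2 + 1 / 4)
    (by linarith) (by linarith) (by
      have : 1 ≤ δ ^ 2 * n := by
        have : δ ^ 4 * n ≤ δ ^ 2 * n := by gcongr ?_ * n; linarith [sq_nonneg δ, delta_four δ hδ hδ']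
        linarith
      nlinarith) (by nlinarith [sq_nonneg (p - q)])
  have ha0 : 0 < a := by simp only [pos, mem_filter] at ha; exact ha.2
  have hb0 : 0 < b := by simp only [pos, mem_filter] at hb; exact hb.2
  rcases le_total b a with hab | hab
  · exact onesided A a b ha0 hab δ hδ hδ' hn hT ha2 hb1 (by linarith)
  · have hcn : (#(ng A) : ℝ) = n := by rw [card_ng]
    obtain ⟨P, d, hP1, hP2, hP3, hP4, hP5⟩ := onesided (ng A) b a hb0 hab δ hδ hδ'
      (by rw [hcn]; exact hn) (by rw [hcn, pairs_ng]; exact hT) (by rw [hcn]; exact hb2)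
      (by rw [hcn, ng_ng]; exact ha1) (by rw [hcn, ng_ng]; linarith)
    rw [hcn] at hP4 hP5
    refine ⟨P, d, hP1, hP2, hP3, hP4, hP5.trans ?_⟩
    have : #(P ∩ ng A) ≤ #(P ∩ A) := by
      refine (card_le_card (t := (P ∩ A).image (fun t => -t)) ?_).trans card_image_le
      intro x hx
      rw [mem_inter, mem_ng] at hx
      rw [mem_image]
      refine ⟨-x, ?_, by simp⟩
      rw [mem_inter]
      refine ⟨?_, hx.2⟩
      rw [hP3, mem_image]
      exact ⟨x, hx.1, rfl⟩
    exact_mod_cast this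

/-- Structure theorem for sets with many summing triples:
if C(A) ≥ 3/4 - ε, then A is almost a symmetric AP around 0. -/
theorem carry_structure (ε : ℝ) (hε : 0 < ε) (hε' : ε < 2 ^ (-50 : ℤ))
    (A : Finset ℤ) (n : ℕ) (hA : A.card = n) (hn : ε⁻¹ ≤ (n : ℝ))
    (hC : (3 : ℝ) / 4 - ε ≤
      (((A ×ˢ A).filter fun p => p.1 + p.2 ∈ A).card : ℝ) / (n : ℝ) ^ 2) :
    ∃ (P : Finset ℤ) (d : ℤ),
      (∃ x, P = (Finset.range P.card).image fun i : ℕ => x + d * (i : ℤ)) ∧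
      (0 : ℤ) ∈ P ∧ P = P.image (fun t => -t) ∧
      (P.card : ℝ) ≤ (1 + 280 * ε ^ ((1 : ℝ) / 4)) * n ∧
      (1 - 10 * ε ^ ((1 : ℝ) / 4)) * n ≤ ((P ∩ A).card : ℝ) := by
  subst hA
  have hδ4 : (ε ^ ((1 : ℝ) / 4)) ^ 4 = ε := by
    rw [← Real.rpow_natCast, ← Real.rpow_mul hε.le]; norm_num
  have hδ : 0 < ε ^ ((1 : ℝ) / 4) := Real.rpow_pos_of_pos hε _
  generalize ε ^ ((1 : ℝ) / 4) = δ at hδ4 hδ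
  have hδ' : δ < 1 / 4096 := by
    apply lt_of_pow_lt_pow_left₀ 4 (by norm_num)
    rw [hδ4]
    refine hε'.trans ?_
    norm_num
  have hnpos : 0 < (#A : ℝ) := lt_of_lt_of_le (by positivity) hn
  apply twosided A δ hδ hδ'
  · rw [hδ4]
    have := mul_le_mul_of_nonneg_left hn hε.le
    rwa [mul_inv_cancel₀ hε.ne'] at this
  · rw [hδ4]
    rwa [le_div_iff₀ (by positivity)] at hC
end
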